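/- arXiv:math/0601253 — 2 statements merged into one kernel-verified Lean document; each statement's English description precedes it below -/
import Mathlib

section
/- For every ε₁ with 0 < ε₁ < 1/3, the number q(n) of plane partitions of n satisfies, as n → ∞, q(n) = (ζ(3)^{7/36} / (2^{11/36} · 3^{1/2} · π^{1/2})) · e^{2c} · n^{−25/36} · exp( 3 ζ(3)^{1/3} (n/2)^{2/3} ) · (1 + O(n^{−(1/3 − ε₁)})). -/
open Real Filter Asymptotics

/-- The number of plane partitions of `n`. -/
noncomputable def planePartitionCount (n : ℕ) : ℕ :=
  Nat.card {ω : ℕ → ℕ → ℕ //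
    (∀ i j, ω (i + 1) j ≤ ω i j) ∧ (∀ i j, ω i (j + 1) ≤ ω i j) ∧
    (∑' p : ℕ × ℕ, ω p.1 p.2) = n}

/-- `ζ(3)` as a real number. -/
noncomputable def zeta3 : ℝ := ∑' j : ℕ, 1 / ((j : ℝ) + 1) ^ 3

/-- The constant `c = ∫₀^∞ y log y / (e^{2πy} - 1) dy`. -/
noncomputable def cConst : ℝ := ∫ y in Set.Ioi (0 : ℝ), y * Real.log y / (Real.exp (2 * π * y) - 1)

namespace PlanePartition

open scoped ENNReal

/-- Interlacing of sequences: `κ ≺ lam` means `lam 0 ≥ κ 0 ≥ lam 1 ≥ κ 1 ≥ …`. -/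
def Interlace (κ lam : ℕ →₀ ℕ) : Prop := ∀ i, κ i ≤ lam i ∧ lam (i + 1) ≤ κ i

lemma degree_eq_sum_range (f : ℕ →₀ ℕ) {M : ℕ} (h : ∀ i, M ≤ i → f i = 0) :
    f.degree = ∑ i ∈ Finset.range M, f i := by
  rw [Finsupp.degree_apply]
  apply Finset.sum_subset
  · intro i hi
    by_contra hM
    simp only [Finset.mem_range, not_lt] at hM
    exact (Finsupp.mem_support_iff.mp hi) (h i hM)
  · intro i _ hi
    simpa using hi

lemma exists_vanish (f : ℕ →₀ ℕ) : ∃ M, ∀ i, M ≤ i → f i = 0 := by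
  obtain ⟨M, hM⟩ := f.support.exists_nat_subset_range
  refine ⟨M, fun i hi => ?_⟩
  by_contra h
  have := hM (Finsupp.mem_support_iff.mpr h)
  simp at this; omega

lemma Interlace.degree_le {κ lam : ℕ →₀ ℕ} (h : Interlace κ lam) : κ.degree ≤ lam.degree := by
  obtain ⟨M, hM⟩ := exists_vanish lam
  have hM' : ∀ i, M ≤ i → κ i = 0 := fun i hi => by have := (h i).1; have := hM i hi; omega
  rw [degree_eq_sum_range lam hM, degree_eq_sum_range κ hM']
  exact Finset.sum_le_sum fun i _ => (h i).1

lemma interlace_zero_iff {κ : ℕ →₀ ℕ} : Interlace κ 0 ↔ κ = 0 := by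
  constructor
  · intro h; ext i; have := (h i).1; simpa using this
  · rintro rfl i; simp

/-- The local reflection underlying the commutation of interlacing transfer operators: sequences
interlacing above both `lam` and `μ` correspond to sequences interlacing below both together with
a natural number. -/
noncomputable def toggleUp (lam μ κ : ℕ →₀ ℕ) (m : ℕ) : ℕ →₀ ℕ :=
  Finsupp.ofSupportFinite
    (fun i => match i with
      | 0 => max (lam 0) (μ 0) + m
      | i + 1 => min (lam i) (μ i) + max (lam (i + 1)) (μ (i + 1)) - κ i)
    (by
      obtain ⟨M, hM⟩ := exists_vanish lam
      obtain ⟨M', hM'⟩ := exists_vanish μ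
      apply (Finset.range (M + M' + 1)).finite_toSet.subset
      intro i hi
      simp only [Finset.coe_range, Set.mem_Iio]
      by_contra h
      apply hi
      obtain ⟨j, rfl⟩ : ∃ j, i = j + 1 := ⟨i - 1, by omega⟩
      have := hM (j + 1) (by omega)
      have := hM' (j + 1) (by omega)
      have := hM j (by omega)
      simp [*])

lemma toggleUp_zero (lam μ κ : ℕ →₀ ℕ) (m : ℕ) :
    toggleUp lam μ κ m 0 = max (lam 0) (μ 0) + m := rfl

lemma toggleUp_succ (lam μ κ : ℕ →₀ ℕ) (m i : ℕ) :
    toggleUp lam μ κ m (i + 1) =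
      min (lam i) (μ i) + max (lam (i + 1)) (μ (i + 1)) - κ i := rfl

noncomputable def toggleDown (lam μ ν : ℕ →₀ ℕ) : ℕ →₀ ℕ :=
  Finsupp.ofSupportFinite
    (fun i => min (lam i) (μ i) + max (lam (i + 1)) (μ (i + 1)) - ν (i + 1))
    (by
      obtain ⟨M, hM⟩ := exists_vanish lam
      obtain ⟨M', hM'⟩ := exists_vanish μ
      apply (Finset.range (M + M')).finite_toSet.subset
      intro i hi
      simp only [Finset.coe_range, Set.mem_Iio]
      by_contra h
      apply hi
      have := hM (i + 1) (by omega)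
      have := hM' (i + 1) (by omega)
      have := hM i (by omega)
      simp [*])

lemma toggleDown_apply (lam μ ν : ℕ →₀ ℕ) (i : ℕ) :
    toggleDown lam μ ν i = min (lam i) (μ i) + max (lam (i + 1)) (μ (i + 1)) - ν (i + 1) := rfl

noncomputable def toggleEquiv (lam μ : ℕ →₀ ℕ) :
    {κ : ℕ →₀ ℕ // Interlace κ lam ∧ Interlace κ μ} × ℕ ≃
      {ν : ℕ →₀ ℕ // Interlace lam ν ∧ Interlace μ ν} where
  toFun p := ⟨toggleUp lam μ p.1.1 p.2, by
    obtain ⟨⟨κ, h1, h2⟩, m⟩ := p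
    constructor
    · intro i
      rw [toggleUp_succ]
      cases i with
      | zero => rw [toggleUp_zero]; have := h1 0; have := h2 0; simp only [zero_add] at *; omega
      | succ i =>
        rw [toggleUp_succ]
        have := h1 i; have := h2 i; have := h1 (i + 1); have := h2 (i + 1); simp only; omega
    · intro i
      rw [toggleUp_succ]
      cases i with
      | zero => rw [toggleUp_zero]; have := h1 0; have := h2 0; simp only [zero_add] at *; omega
      | succ i =>
        rw [toggleUp_succ]
        have := h1 i; have := h2 i; have := h1 (i + 1); have := h2 (i + 1); simp only; omega⟩
  invFun ν := ⟨⟨toggleDown lam μ ν.1, by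
    obtain ⟨ν, h1, h2⟩ := ν
    constructor <;>
    · intro i
      rw [toggleDown_apply]
      have := h1 i; have := h2 i; have := h1 (i + 1); have := h2 (i + 1); simp only; omega⟩,
    ν.1 0 - max (lam 0) (μ 0)⟩
  left_inv p := by
    obtain ⟨⟨κ, h1, h2⟩, m⟩ := p
    simp only [Prod.mk.injEq, Subtype.mk.injEq]
    constructor
    · ext i
      rw [toggleDown_apply, toggleUp_succ]
      have := h1 i; have := h2 i; omega
    · rw [toggleUp_zero]; omega
  right_inv ν := by
    obtain ⟨ν, h1, h2⟩ := ν
    simp only [Subtype.mk.injEq]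
    ext i
    cases i with
    | zero => rw [toggleUp_zero]; have := h1 0; have := h2 0; omega
    | succ i =>
      rw [toggleUp_succ, toggleDown_apply]
      have := h1 i; have := h2 i; have := h1 (i + 1); have := h2 (i + 1); omega

lemma degree_toggleUp (lam μ κ : ℕ →₀ ℕ) (hκ : Interlace κ lam) (hκ' : Interlace κ μ) (m : ℕ) :
    (toggleUp lam μ κ m).degree + κ.degree = lam.degree + μ.degree + m := by
  obtain ⟨M, hM⟩ := exists_vanish lam
  obtain ⟨M', hM'⟩ := exists_vanish μ
  set K := M + M'
  have h1 : ∀ i, K ≤ i → lam i = 0 := fun i hi => hM i (by omega)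
  have h2 : ∀ i, K ≤ i → μ i = 0 := fun i hi => hM' i (by omega)
  have h3 : ∀ i, K ≤ i → κ i = 0 := fun i hi => by have := (hκ i).1; have := h1 i hi; omega
  have h4 : ∀ i, K + 1 ≤ i → toggleUp lam μ κ m i = 0 := fun i hi => by
    obtain ⟨j, rfl⟩ : ∃ j, i = j + 1 := ⟨i - 1, by omega⟩
    rw [toggleUp_succ]
    have := h1 j (by omega); have := h1 (j + 1) (by omega); have := h2 (j + 1) (by omega); omega
  have h1' : ∀ i, K + 1 ≤ i → lam i = 0 := fun i hi => h1 i (by omega)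
  have h2' : ∀ i, K + 1 ≤ i → μ i = 0 := fun i hi => h2 i (by omega)
  rw [degree_eq_sum_range _ h4, degree_eq_sum_range κ h3, Finset.sum_range_succ']
  have e1 : ∑ i ∈ Finset.range K, toggleUp lam μ κ m (i + 1) + ∑ i ∈ Finset.range K, κ i =
      ∑ i ∈ Finset.range K, min (lam i) (μ i) +
        ∑ i ∈ Finset.range K, max (lam (i + 1)) (μ (i + 1)) := by
    rw [← Finset.sum_add_distrib, ← Finset.sum_add_distrib]
    refine Finset.sum_congr rfl fun i _ => ?_
    rw [toggleUp_succ]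
    have := hκ i; have := hκ' i; omega
  have e2 : ∑ i ∈ Finset.range K, max (lam (i + 1)) (μ (i + 1)) + max (lam 0) (μ 0) =
      ∑ i ∈ Finset.range K, max (lam i) (μ i) := by
    rw [← Finset.sum_range_succ' (fun i => max (lam i) (μ i)), Finset.sum_range_succ,
      h1 K le_rfl, h2 K le_rfl]
    simp
  have e3 : ∑ i ∈ Finset.range K, min (lam i) (μ i) + ∑ i ∈ Finset.range K, max (lam i) (μ i) =
      lam.degree + μ.degree := by
    rw [degree_eq_sum_range lam h1, degree_eq_sum_range μ h2, ← Finset.sum_add_distrib,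
      ← Finset.sum_add_distrib]
    exact Finset.sum_congr rfl fun i _ => min_add_max _ _
  rw [toggleUp_zero]
  omega

open Classical in
/-- The commutation relation for the interlacing transfer operators. -/
lemma tsum_interlace_comm (x y : ℝ≥0∞) (lam μ : ℕ →₀ ℕ) :
    ∑' ν : ℕ →₀ ℕ, (if Interlace lam ν ∧ Interlace μ ν then
        x ^ (ν.degree - lam.degree) * y ^ (ν.degree - μ.degree) else 0) =
      (1 - x * y)⁻¹ * ∑' κ : ℕ →₀ ℕ, (if Interlace κ lam ∧ Interlace κ μ then
        x ^ (μ.degree - κ.degree) * y ^ (lam.degree - κ.degree) else 0) := by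
  have e : ∀ (p : (ℕ →₀ ℕ) → Prop) [DecidablePred p] (f : (ℕ →₀ ℕ) → ℝ≥0∞),
      ∑' ν, (if p ν then f ν else 0) = ∑' ν : {ν // p ν}, f ν := by
    intro p _ f
    rw [show ∑' ν : {ν // p ν}, f ν = ∑' ν : ({ν | p ν} : Set (ℕ →₀ ℕ)), f ν from rfl, tsum_subtype]
    exact tsum_congr fun ν => by simp [Set.indicator_apply]
  rw [e, e, ← (toggleEquiv lam μ).tsum_eq, ENNReal.tsum_prod', mul_comm, ← ENNReal.tsum_mul_right]
  refine tsum_congr fun κ => ?_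
  rw [← ENNReal.tsum_geometric, ← ENNReal.tsum_mul_left]
  refine tsum_congr fun m => ?_
  obtain ⟨κ, h1, h2⟩ := κ
  have hd := degree_toggleUp lam μ κ h1 h2 m
  have d1 := h1.degree_le
  have d2 := h2.degree_le
  simp only [toggleEquiv, Equiv.coe_fn_mk]
  rw [show (toggleUp lam μ κ m).degree - lam.degree = μ.degree - κ.degree + m by omega,
    show (toggleUp lam μ κ m).degree - μ.degree = lam.degree - κ.degree + m by omega,
    pow_add, pow_add, mul_pow]
  ring

open Classical in
/-- Schur-type functions defined by interlacing branching. -/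
noncomputable def branch : List ℝ≥0∞ → (ℕ →₀ ℕ) → ℝ≥0∞
  | [], lam => if lam = 0 then 1 else 0
  | x :: xs, lam => ∑' κ : ℕ →₀ ℕ,
      if Interlace κ lam then x ^ (lam.degree - κ.degree) * branch xs κ else 0

open Classical in
lemma tsum_branch_above (y : ℝ≥0∞) (xs : List ℝ≥0∞) (μ : ℕ →₀ ℕ) :
    ∑' ν : ℕ →₀ ℕ, (if Interlace μ ν then y ^ (ν.degree - μ.degree) * branch xs ν else 0) =
      (xs.map fun x => (1 - x * y)⁻¹).prod * branch xs μ := by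
  induction xs generalizing μ with
  | nil =>
    rw [tsum_eq_single 0]
    · simp only [branch, interlace_zero_iff]
      split_ifs with h <;> simp [h]
    · intro ν hν; simp [branch, hν]
  | cons x xs ih =>
    have h1 : ∀ ν : ℕ →₀ ℕ, (if Interlace μ ν then
        y ^ (ν.degree - μ.degree) * branch (x :: xs) ν else 0) =
        ∑' κ : ℕ →₀ ℕ, branch xs κ * (if Interlace κ ν ∧ Interlace μ ν then
          x ^ (ν.degree - κ.degree) * y ^ (ν.degree - μ.degree) else 0) := by
      intro ν
      split_ifs with h
      · rw [branch, ← ENNReal.tsum_mul_left]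
        refine tsum_congr fun κ => ?_
        split_ifs <;> simp_all <;> ring
      · simp [h]
    simp_rw [h1]
    rw [ENNReal.tsum_comm]
    simp_rw [ENNReal.tsum_mul_left, tsum_interlace_comm, branch]
    rw [List.map_cons, List.prod_cons]
    have h2 : ∀ κ : ℕ →₀ ℕ, branch xs κ * ((1 - x * y)⁻¹ * ∑' ρ : ℕ →₀ ℕ,
        (if Interlace ρ κ ∧ Interlace ρ μ then
          x ^ (μ.degree - ρ.degree) * y ^ (κ.degree - ρ.degree) else 0)) =
        ∑' ρ : ℕ →₀ ℕ, (1 - x * y)⁻¹ * (if Interlace ρ μ then x ^ (μ.degree - ρ.degree) else 0) *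
          (if Interlace ρ κ then y ^ (κ.degree - ρ.degree) * branch xs κ else 0) := by
      intro κ
      rw [← mul_assoc, ← ENNReal.tsum_mul_left]
      refine tsum_congr fun ρ => ?_
      split_ifs <;> simp_all
      ring
    simp_rw [h2]
    rw [ENNReal.tsum_comm]
    simp_rw [ENNReal.tsum_mul_left, ih]
    rw [← ENNReal.tsum_mul_left]
    refine tsum_congr fun ρ => ?_
    split_ifs
    · ring
    · simp

/-- The Cauchy identity. -/
lemma tsum_branch_mul_branch (xs ys : List ℝ≥0∞) :
    ∑' lam : ℕ →₀ ℕ, branch xs lam * branch ys lam =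
      (ys.map fun y => (xs.map fun x => (1 - x * y)⁻¹).prod).prod := by
  classical
  induction ys with
  | nil =>
    rw [tsum_eq_single 0]
    · have : ∀ xs : List ℝ≥0∞, branch xs 0 = 1 := by
        intro xs
        induction xs with
        | nil => simp [branch]
        | cons x xs ih =>
          rw [branch, tsum_eq_single 0]
          · simp [ih, interlace_zero_iff]
          · intro κ hκ; simp [interlace_zero_iff, hκ]
      simp [this]
    · intro lam h; simp [branch, h]
  | cons y ys ih =>
    have h1 : ∀ lam : ℕ →₀ ℕ, branch xs lam * branch (y :: ys) lam =
        ∑' κ : ℕ →₀ ℕ, branch ys κ *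
          (if Interlace κ lam then y ^ (lam.degree - κ.degree) * branch xs lam else 0) := by
      intro lam
      rw [branch, ← ENNReal.tsum_mul_left]
      refine tsum_congr fun κ => ?_
      split_ifs
      · ring
      · simp
    simp_rw [h1]
    rw [ENNReal.tsum_comm]
    simp_rw [ENNReal.tsum_mul_left, tsum_branch_above]
    rw [List.map_cons, List.prod_cons, ← ih, ← ENNReal.tsum_mul_left]
    refine tsum_congr fun κ => ?_
    ring

/-- A sequence of successively interlacing sequences. -/
def IsChain (e : ℕ → ℕ →₀ ℕ) : Prop := ∀ k, Interlace (e (k + 1)) (e k)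

lemma IsChain.eq_zero_of_le {e : ℕ → ℕ →₀ ℕ} (he : IsChain e) {N k : ℕ} (hN : e N = 0)
    (hk : N ≤ k) : e k = 0 := by
  induction k, hk using Nat.le_induction with
  | base => exact hN
  | succ k _ ih => have := he k; rw [ih] at this; exact interlace_zero_iff.mp this

/-- Splitting off the first term of a sequence. -/
def consSeq (α : Type*) : α × (ℕ → α) ≃ (ℕ → α) where
  toFun p k := match k with
    | 0 => p.1
    | k + 1 => p.2 k
  invFun e := (e 0, fun k => e (k + 1))
  left_inv p := rfl
  right_inv e := by ext k; cases k <;> rfl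

open Classical in
/-- The generating function of chains starting at `lam` and vanishing from index `N` on. -/
noncomputable def chainSum (x : ℝ≥0∞) (N : ℕ) (lam : ℕ →₀ ℕ) : ℝ≥0∞ :=
  ∑' e : ℕ → ℕ →₀ ℕ, if e 0 = lam ∧ IsChain e ∧ e N = 0 then
    x ^ (∑ k ∈ Finset.range N, (e k).degree) else 0

lemma isChain_consSeq {a : ℕ →₀ ℕ} {d : ℕ → ℕ →₀ ℕ} :
    IsChain (consSeq _ (a, d)) ↔ Interlace (d 0) a ∧ IsChain d := by
  constructor
  · intro h
    exact ⟨h 0, fun k => h (k + 1)⟩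
  · rintro ⟨h0, h1⟩ k
    cases k with
    | zero => exact h0
    | succ k => exact h1 k

open Classical in
lemma chainSum_zero (x : ℝ≥0∞) (lam : ℕ →₀ ℕ) :
    chainSum x 0 lam = if lam = 0 then 1 else 0 := by
  rw [chainSum, tsum_eq_single 0]
  · have : IsChain 0 := fun k => interlace_zero_iff.mpr rfl
    simp [this, eq_comm]
  · intro e he
    rw [if_neg]
    rintro ⟨_, h2, h3⟩
    exact he (funext fun k => h2.eq_zero_of_le h3 (Nat.zero_le k))

open Classical in
lemma chainSum_succ (x : ℝ≥0∞) (N : ℕ) (lam : ℕ →₀ ℕ) :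
    chainSum x (N + 1) lam =
      x ^ lam.degree * ∑' κ : ℕ →₀ ℕ, if Interlace κ lam then chainSum x N κ else 0 := by
  rw [chainSum, ← (consSeq _).tsum_eq, ENNReal.tsum_prod', tsum_eq_single lam]
  · have h : ∀ κ : ℕ →₀ ℕ, (if Interlace κ lam then chainSum x N κ else 0) =
        ∑' d : ℕ → ℕ →₀ ℕ, if d 0 = κ ∧ Interlace κ lam ∧ IsChain d ∧ d N = 0 then
          x ^ (∑ k ∈ Finset.range N, (d k).degree) else 0 := by
      intro κ
      split_ifs with h
      · simp [chainSum, h]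
      · simp [h]
    simp_rw [h]
    rw [ENNReal.tsum_comm, ← ENNReal.tsum_mul_left]
    refine tsum_congr fun d => ?_
    rw [tsum_eq_single (d 0)]
    · simp_rw [isChain_consSeq, Finset.sum_range_succ']
      simp only [consSeq, Equiv.coe_fn_mk, true_and, and_assoc]
      split_ifs
      · rw [pow_add, mul_comm]
      · simp
    · intro κ hκ
      rw [if_neg]
      rintro ⟨h, _⟩
      exact hκ h.symm
  · intro a ha
    rw [ENNReal.tsum_eq_zero]
    intro d
    rw [if_neg]
    rintro ⟨h, _⟩
    exact ha h

lemma chainSum_eq_branch (x : ℝ≥0∞) (N c : ℕ) (lam : ℕ →₀ ℕ) :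
    x ^ (c * lam.degree) * chainSum x N lam =
      branch ((List.range' (c + 1) N).map fun i => x ^ i) lam := by
  classical
  induction N generalizing c lam with
  | zero =>
    rw [chainSum_zero]
    by_cases h : lam = 0 <;> simp [branch, h]
  | succ N ih =>
    rw [List.range'_succ, List.map_cons, branch, chainSum_succ, ← mul_assoc, ← pow_add,
      ← ENNReal.tsum_mul_left]
    refine tsum_congr fun κ => ?_
    split_ifs with h
    · rw [← ih, ← mul_assoc, ← pow_mul, ← pow_add]
      congr 2
      have := h.degree_le
      obtain ⟨t, ht⟩ := Nat.exists_eq_add_of_le this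
      rw [ht, Nat.add_sub_cancel_left]
      ring
    · simp

open Classical in
/-- Generating function of pairs of chains that encode plane partitions with bounded diagonals. -/
lemma tsum_chain_pair (x : ℝ≥0∞) (N : ℕ) :
    ∑' p : (ℕ → ℕ →₀ ℕ) × (ℕ → ℕ →₀ ℕ),
      (if (IsChain p.1 ∧ IsChain p.2 ∧ Interlace (p.2 0) (p.1 0)) ∧ p.1 N = 0 ∧ p.2 N = 0 then
        x ^ (∑ k ∈ Finset.range N, (p.1 k).degree + ∑ k ∈ Finset.range N, (p.2 k).degree)
        else 0) =
      ∏ j ∈ Finset.range (N + 1), ∏ i ∈ Finset.range N, (1 - x ^ (i + j + 1))⁻¹ := by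
  have hL : ∀ lam, chainSum x N lam = branch ((List.range' 1 N).map fun i => x ^ i) lam := by
    intro lam; simpa using chainSum_eq_branch x N 0 lam
  have hR : ∀ lam : ℕ →₀ ℕ, ∑' κ : ℕ →₀ ℕ, (if Interlace κ lam then chainSum x N κ else 0) =
      branch ((List.range' 0 (N + 1)).map fun i => x ^ i) lam := by
    intro lam
    rw [List.range'_succ, List.map_cons, branch]
    refine tsum_congr fun κ => ?_
    simp [hL]
  have hprod : ∏ j ∈ Finset.range (N + 1), ∏ i ∈ Finset.range N, (1 - x ^ (i + j + 1))⁻¹ =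
      (((List.range' 0 (N + 1)).map fun i => x ^ i).map fun y =>
        (((List.range' 1 N).map fun i => x ^ i).map fun x => (1 - x * y)⁻¹).prod).prod := by
    have hl : ∀ (f : ℕ → ℝ≥0∞) (n : ℕ), ((List.range n).map f).prod =
        ∏ i ∈ Finset.range n, f i := fun f n => by
      simp [Finset.prod, Finset.range, Multiset.range]
    simp only [List.range'_eq_map_range, List.map_map]
    rw [hl]
    refine Finset.prod_congr rfl fun j _ => ?_
    simp only [Function.comp]
    rw [hl]
    refine Finset.prod_congr rfl fun i _ => ?_
    simp only [Function.comp]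
    rw [← pow_add]
    ring_nf
  rw [hprod, ← tsum_branch_mul_branch]
  simp_rw [← hL, ← hR]
  have h1 : ∀ lam : ℕ →₀ ℕ, chainSum x N lam *
      ∑' κ : ℕ →₀ ℕ, (if Interlace κ lam then chainSum x N κ else 0) =
      ∑' p : (ℕ → ℕ →₀ ℕ) × (ℕ → ℕ →₀ ℕ), ∑' κ : ℕ →₀ ℕ,
        if p.1 0 = lam ∧ p.2 0 = κ ∧ (IsChain p.1 ∧ IsChain p.2 ∧ Interlace κ lam) ∧
          p.1 N = 0 ∧ p.2 N = 0 then
        x ^ (∑ k ∈ Finset.range N, (p.1 k).degree + ∑ k ∈ Finset.range N, (p.2 k).degree)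
        else 0 := by
    intro lam
    rw [chainSum, ENNReal.tsum_prod', ← ENNReal.tsum_mul_right]
    refine tsum_congr fun e => ?_
    rw [ENNReal.tsum_comm, ← ENNReal.tsum_mul_left]
    refine tsum_congr fun κ => ?_
    by_cases hκ : Interlace κ lam
    · rw [if_pos hκ, chainSum, ← ENNReal.tsum_mul_left]
      refine tsum_congr fun f => ?_
      rw [ite_zero_mul_ite_zero, pow_add]
      refine if_congr ?_ rfl rfl
      tauto
    · simp [hκ]
  simp_rw [h1]
  rw [ENNReal.tsum_comm]
  refine tsum_congr fun p => ?_
  rw [tsum_eq_single (p.1 0), tsum_eq_single (p.2 0)]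
  · simp
  · intro κ hκ
    rw [if_neg]
    rintro ⟨_, h, _⟩
    exact hκ h.symm
  · intro lam hlam
    rw [ENNReal.tsum_eq_zero]
    intro κ
    rw [if_neg]
    rintro ⟨h, _⟩
    exact hlam h.symm

/-- Plane partitions of finite size. -/
def PPart : Type := {ω : ℕ → ℕ → ℕ // (∀ i j, ω (i + 1) j ≤ ω i j) ∧ (∀ i j, ω i (j + 1) ≤ ω i j) ∧
  (Function.support fun p : ℕ × ℕ => ω p.1 p.2).Finite}

/-- The size of a plane partition. -/
noncomputable def PPart.size (ω : PPart) : ℕ := ∑' p : ℕ × ℕ, ω.1 p.1 p.2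

/-- Pairs of chains of diagonals of plane partitions. -/
def DiagPair : Type := {p : (ℕ → ℕ →₀ ℕ) × (ℕ → ℕ →₀ ℕ) //
  (IsChain p.1 ∧ IsChain p.2 ∧ Interlace (p.2 0) (p.1 0)) ∧ ∃ N, p.1 N = 0 ∧ p.2 N = 0}

/-- The diagonals on and above the main one, of a plane partition. -/
noncomputable def PPart.upper (ω : PPart) (k : ℕ) : ℕ →₀ ℕ :=
  Finsupp.ofSupportFinite (fun i => ω.1 i (i + k)) (by
    have := ω.2.2.2.preimage (f := fun i : ℕ => (i, i + k))
      (fun a _ b _ h => by simpa using congrArg Prod.fst h)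
    exact this)

/-- The diagonals below the main one, of a plane partition. -/
noncomputable def PPart.lower (ω : PPart) (k : ℕ) : ℕ →₀ ℕ :=
  Finsupp.ofSupportFinite (fun i => ω.1 (i + k + 1) i) (by
    have := ω.2.2.2.preimage (f := fun i : ℕ => (i + k + 1, i))
      (fun a _ b _ h => by simpa using congrArg Prod.snd h)
    exact this)

lemma PPart.upper_apply (ω : PPart) (k i : ℕ) : ω.upper k i = ω.1 i (i + k) := rfl
lemma PPart.lower_apply (ω : PPart) (k i : ℕ) : ω.lower k i = ω.1 (i + k + 1) i := rfl

lemma PPart.exists_vanish (ω : PPart) : ∃ N, ω.upper N = 0 ∧ ω.lower N = 0 := by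
  have hfin := ω.2.2.2
  obtain ⟨N, hN⟩ := (hfin.image fun p => p.1 + p.2).bddAbove
  refine ⟨N + 1, ?_, ?_⟩
  · ext i
    rw [upper_apply]
    by_contra h
    have := hN ⟨(i, i + (N + 1)), h, rfl⟩
    simp at this; omega
  · ext i
    rw [lower_apply]
    by_contra h
    have := hN ⟨(i + (N + 1) + 1, i), h, rfl⟩
    simp at this; omega

lemma IsChain.le_zero {e : ℕ → ℕ →₀ ℕ} (he : IsChain e) (k i : ℕ) : e k i ≤ e 0 i := by
  induction k with
  | zero => exact le_rfl
  | succ k ih => exact ((he k i).1).trans ih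

/-- The array with prescribed diagonals. -/
def ofDiag (p : (ℕ → ℕ →₀ ℕ) × (ℕ → ℕ →₀ ℕ)) (i j : ℕ) : ℕ :=
  if i ≤ j then p.1 (j - i) i else p.2 (i - j - 1) j

lemma ofDiag_upper (p : (ℕ → ℕ →₀ ℕ) × (ℕ → ℕ →₀ ℕ)) (i k : ℕ) :
    ofDiag p i (i + k) = p.1 k i := by
  simp [ofDiag]

lemma ofDiag_lower (p : (ℕ → ℕ →₀ ℕ) × (ℕ → ℕ →₀ ℕ)) (i k : ℕ) :
    ofDiag p (i + k + 1) i = p.2 k i := by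
  rw [ofDiag, if_neg (by omega), show i + k + 1 - i - 1 = k by omega]

lemma DiagPair.anti_left (p : DiagPair) (i j : ℕ) : ofDiag p.1 (i + 1) j ≤ ofDiag p.1 i j := by
  obtain ⟨p, ⟨h1, h2, h3⟩, -⟩ := p
  rcases lt_trichotomy i j with h | h | h
  · obtain ⟨k, rfl⟩ : ∃ k, j = i + 1 + k := ⟨j - i - 1, by omega⟩
    rw [ofDiag_upper, show i + 1 + k = i + (k + 1) by omega, ofDiag_upper]
    exact (h1 k i).2
  · subst h
    have a := ofDiag_lower p i 0
    have b := ofDiag_upper p i 0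
    simp only [add_zero] at a b
    rw [a, b]
    exact (h3 i).1
  · obtain ⟨k, rfl⟩ : ∃ k, i = j + k + 1 := ⟨i - j - 1, by omega⟩
    rw [ofDiag_lower, show j + k + 1 + 1 = j + (k + 1) + 1 by omega, ofDiag_lower]
    exact (h2 k j).1

lemma DiagPair.anti_right (p : DiagPair) (i j : ℕ) : ofDiag p.1 i (j + 1) ≤ ofDiag p.1 i j := by
  obtain ⟨p, ⟨h1, h2, h3⟩, -⟩ := p
  rcases le_or_gt i j with h | h
  · obtain ⟨k, rfl⟩ : ∃ k, j = i + k := ⟨j - i, by omega⟩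
    rw [ofDiag_upper, show i + k + 1 = i + (k + 1) by omega, ofDiag_upper]
    exact (h1 k i).1
  · obtain ⟨k, rfl⟩ : ∃ k, i = j + k + 1 := ⟨i - j - 1, by omega⟩
    rw [ofDiag_lower]
    cases k with
    | zero =>
      have b := ofDiag_upper p (j + 1) 0
      simp only [add_zero] at b ⊢
      rw [b]; exact (h3 j).2
    | succ k =>
      rw [show j + (k + 1) + 1 = j + 1 + k + 1 by omega, ofDiag_lower]
      exact (h2 k j).2

lemma DiagPair.finite (p : DiagPair) :
    (Function.support fun q : ℕ × ℕ => ofDiag p.1 q.1 q.2).Finite := by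
  obtain ⟨p, ⟨h1, h2, h3⟩, N, hN1, hN2⟩ := p
  obtain ⟨M, hM⟩ := PlanePartition.exists_vanish (p.1 0)
  apply ((Finset.range (M + N + 1)) ×ˢ (Finset.range (M + N + 1))).finite_toSet.subset
  rintro ⟨i, j⟩ hij
  simp only [Function.mem_support] at hij
  simp only [Finset.coe_product, Finset.coe_range, Set.mem_prod, Set.mem_Iio]
  rcases le_or_gt i j with h | h
  · obtain ⟨k, rfl⟩ : ∃ k, j = i + k := ⟨j - i, by omega⟩
    rw [ofDiag_upper] at hij
    have hk : k < N := by
      by_contra hk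
      rw [h1.eq_zero_of_le hN1 (by omega)] at hij; simp at hij
    have hi : i < M := by
      by_contra hi
      have := h1.le_zero k i; have := hM i (by omega); omega
    omega
  · obtain ⟨k, rfl⟩ : ∃ k, i = j + k + 1 := ⟨i - j - 1, by omega⟩
    rw [ofDiag_lower] at hij
    have hk : k < N := by
      by_contra hk
      rw [h2.eq_zero_of_le hN2 (by omega)] at hij; simp at hij
    have hi : j < M := by
      by_contra hi
      have := h2.le_zero k j; have := (h3 j).1; have := hM j (by omega); omega
    omega

/-- Plane partitions correspond to pairs of chains of diagonals. -/
noncomputable def diagEquiv : PPart ≃ DiagPair where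
  toFun ω := ⟨(ω.upper, ω.lower), by
    obtain ⟨h1, h2, -⟩ := ω.2
    refine ⟨⟨fun k i => ⟨h2 _ _, ?_⟩, fun k i => ⟨h1 _ _, ?_⟩, fun i => ⟨h1 _ _, h2 _ _⟩⟩,
      ω.exists_vanish⟩
    · rw [PPart.upper_apply, PPart.upper_apply, show i + 1 + k = i + (k + 1) by omega]
      exact h1 _ _
    · rw [PPart.lower_apply, PPart.lower_apply, show i + 1 + k + 1 = i + (k + 1) + 1 by omega]
      exact h2 _ _⟩
  invFun p := ⟨ofDiag p.1, p.anti_left, p.anti_right, p.finite⟩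
  left_inv ω := by
    apply Subtype.ext
    funext i j
    rcases le_or_gt i j with h | h
    · obtain ⟨k, rfl⟩ : ∃ k, j = i + k := ⟨j - i, by omega⟩
      exact ofDiag_upper _ _ _
    · obtain ⟨k, rfl⟩ : ∃ k, i = j + k + 1 := ⟨i - j - 1, by omega⟩
      exact ofDiag_lower _ _ _
  right_inv p := by
    apply Subtype.ext
    refine Prod.ext ?_ ?_
    · funext k; ext i; exact ofDiag_upper _ _ _
    · funext k; ext i; exact ofDiag_lower _ _ _

/-- Indexing the quadrant by diagonals. -/
def quadrantEquiv : (ℕ × ℕ) ⊕ (ℕ × ℕ) ≃ ℕ × ℕ where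
  toFun s := match s with
    | .inl (k, i) => (i, i + k)
    | .inr (k, i) => (i + k + 1, i)
  invFun q := if q.1 ≤ q.2 then .inl (q.2 - q.1, q.1) else .inr (q.1 - q.2 - 1, q.2)
  left_inv s := by
    rcases s with ⟨k, i⟩ | ⟨k, i⟩
    · simp
    · simp only
      rw [if_neg (by omega)]
      congr 2; omega
  right_inv q := by
    obtain ⟨i, j⟩ := q
    simp only
    split_ifs with h
    · simp only [Prod.mk.injEq, true_and]; omega
    · simp only [Prod.mk.injEq, and_true]; omega

lemma IsChain.hasSum {e : ℕ → ℕ →₀ ℕ} (he : IsChain e) {N : ℕ} (hN : e N = 0) :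
    HasSum (fun q : ℕ × ℕ => e q.1 q.2) (∑ k ∈ Finset.range N, (e k).degree) := by
  obtain ⟨M, hM⟩ := PlanePartition.exists_vanish (e 0)
  have h0 : ∀ k i, M ≤ i → e k i = 0 := fun k i hi => by
    have := he.le_zero k i; have := hM i hi; omega
  have : HasSum (fun q : ℕ × ℕ => e q.1 q.2) (∑ q ∈ Finset.range N ×ˢ Finset.range M, e q.1 q.2) :=
    hasSum_sum_of_ne_finset_zero (by
      rintro ⟨k, i⟩ hki
      simp only [Finset.mem_product, Finset.mem_range, not_and_or, not_lt] at hki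
      rcases hki with h | h
      · simp [he.eq_zero_of_le hN h]
      · exact h0 k i h)
  rw [Finset.sum_product] at this
  convert this using 2 with k
  exact degree_eq_sum_range _ (h0 k)

lemma PPart.size_eq (ω : PPart) {N : ℕ} (h1 : ω.upper N = 0) (h2 : ω.lower N = 0) :
    ω.size = ∑ k ∈ Finset.range N, (ω.upper k).degree +
      ∑ k ∈ Finset.range N, (ω.lower k).degree := by
  have hc := (diagEquiv ω).2.1
  rw [size, ← quadrantEquiv.tsum_eq]
  apply HasSum.tsum_eq
  exact HasSum.sum (hc.1.hasSum h1) (hc.2.1.hasSum h2)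

open Classical in
lemma tsum_size_le (x : ℝ≥0∞) (N : ℕ) :
    ∑' ω : PPart, (if ω.upper N = 0 ∧ ω.lower N = 0 then x ^ ω.size else 0) =
      ∏ j ∈ Finset.range (N + 1), ∏ i ∈ Finset.range N, (1 - x ^ (i + j + 1))⁻¹ := by
  rw [← tsum_chain_pair, ← diagEquiv.symm.tsum_eq]
  have h : ∀ q : DiagPair, (if (diagEquiv.symm q).upper N = 0 ∧ (diagEquiv.symm q).lower N = 0 then
      x ^ (diagEquiv.symm q).size else 0) = (if q.1.1 N = 0 ∧ q.1.2 N = 0 then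
        x ^ (∑ k ∈ Finset.range N, (q.1.1 k).degree + ∑ k ∈ Finset.range N, (q.1.2 k).degree)
        else 0) := by
    intro q
    obtain ⟨ω, rfl⟩ := diagEquiv.surjective q
    rw [Equiv.symm_apply_apply]
    refine if_ctx_congr Iff.rfl (fun h => ?_) fun _ => rfl
    rw [ω.size_eq h.1 h.2]
    rfl
  simp_rw [h]
  have := tsum_subtype {p : (ℕ → ℕ →₀ ℕ) × (ℕ → ℕ →₀ ℕ) |
    (IsChain p.1 ∧ IsChain p.2 ∧ Interlace (p.2 0) (p.1 0)) ∧ ∃ N, p.1 N = 0 ∧ p.2 N = 0}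
    (fun p => if p.1 N = 0 ∧ p.2 N = 0 then
        x ^ (∑ k ∈ Finset.range N, (p.1 k).degree + ∑ k ∈ Finset.range N, (p.2 k).degree)
        else (0 : ℝ≥0∞))
  refine this.trans (tsum_congr fun p => ?_)
  rw [Set.indicator_apply]
  by_cases h1 : p.1 N = 0 ∧ p.2 N = 0
  · have : ∃ N, p.1 N = 0 ∧ p.2 N = 0 := ⟨N, h1⟩
    simp only [Set.mem_ofPred_eq, h1, this, and_true]
    simp
  · simp [h1]

lemma tsum_size_eq_iSup (x : ℝ≥0∞) :
    ∑' ω : PPart, x ^ ω.size =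
      ⨆ N, ∏ j ∈ Finset.range (N + 1), ∏ i ∈ Finset.range N, (1 - x ^ (i + j + 1))⁻¹ := by
  classical
  apply le_antisymm
  · rw [ENNReal.tsum_eq_iSup_sum]
    refine iSup_le fun s => ?_
    choose f hf using PPart.exists_vanish
    obtain ⟨N, hN⟩ := (s.image f).exists_nat_subset_range
    refine le_iSup_of_le N ?_
    rw [← tsum_size_le]
    refine le_trans (le_of_eq (Finset.sum_congr rfl fun ω hω => ?_)) (ENNReal.sum_le_tsum s)
    have hfN : f ω ≤ N := by
      have := hN (Finset.mem_image_of_mem f hω); simp at this; omega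
    have hc := (diagEquiv ω).2.1
    rw [if_pos ⟨hc.1.eq_zero_of_le (hf ω).1 hfN, hc.2.1.eq_zero_of_le (hf ω).2 hfN⟩]
  · refine iSup_le fun N => ?_
    rw [← tsum_size_le]
    refine ENNReal.tsum_le_tsum fun ω => ?_
    split_ifs <;> simp

/-- The frequency attached to an index of the double series of the logarithm of the generating
function. -/
def freq (p : ℕ × ℕ) : ℝ := (p.1 + 1) * (p.2 + 1)

/-- The coefficient attached to an index of the double series of the logarithm of the generating
function. -/
noncomputable def coeff (p : ℕ × ℕ) : ℝ := (p.1 + 1) / (p.2 + 1)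

/-- The series of the `j`-th derivative (up to sign) of the logarithm of the generating
function. -/
noncomputable def logSeries (j : ℕ) (r : ℝ) : ℝ :=
  ∑' p : ℕ × ℕ, coeff p * freq p ^ j * Real.exp (-freq p * r)

/-- The logarithm of the generating function. -/
noncomputable def logGen (z : ℂ) : ℂ := ∑' p : ℕ × ℕ, (coeff p : ℂ) * Complex.exp (-freq p * z)

lemma freq_pos (p : ℕ × ℕ) : 0 < freq p := by unfold freq; positivity
lemma coeff_pos (p : ℕ × ℕ) : 0 < coeff p := by unfold coeff; positivity

lemma summable_logSeries (j : ℕ) {r : ℝ} (hr : 0 < r) :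
    Summable fun p : ℕ × ℕ => coeff p * freq p ^ j * Real.exp (-freq p * r) := by
  have h1 (k : ℕ) : Summable fun n : ℕ => ((n : ℝ) + 1) ^ k * Real.exp (-r * (n + 1)) := by
    have := (summable_nat_add_iff 1).2 (Real.summable_pow_mul_exp_neg_nat_mul k hr)
    simpa using this
  have h2 := ((h1 (j + 1)).mul_of_nonneg (h1 j) (fun _ => by positivity)
    (fun _ => by positivity)).mul_left (Real.exp r)
  refine Summable.of_nonneg_of_le (fun p => ?_) (fun p => ?_) h2
  · have := coeff_pos p; have := freq_pos p; positivity
  · have e1 : Real.exp (-freq p * r) ≤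
        Real.exp r * (Real.exp (-r * (p.1 + 1)) * Real.exp (-r * (p.2 + 1))) := by
      rw [← Real.exp_add, ← Real.exp_add]
      apply Real.exp_le_exp.2
      unfold freq
      have : 0 ≤ (p.1 : ℝ) * p.2 * r := by positivity
      nlinarith
    have e2 : coeff p * freq p ^ j ≤ ((p.1 : ℝ) + 1) ^ (j + 1) * ((p.2 : ℝ) + 1) ^ j := by
      unfold coeff freq
      rw [mul_pow, div_mul_eq_mul_div, div_le_iff₀ (by positivity), pow_succ]
      have : (1 : ℝ) ≤ p.2 + 1 := by simp
      calc _ = ((p.1 : ℝ) + 1) ^ j * (p.1 + 1) * ((p.2 : ℝ) + 1) ^ j * 1 := by ring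
        _ ≤ _ := by gcongr
    calc _ ≤ (((p.1 : ℝ) + 1) ^ (j + 1) * ((p.2 : ℝ) + 1) ^ j) *
          (Real.exp r * (Real.exp (-r * (p.1 + 1)) * Real.exp (-r * (p.2 + 1)))) := by
          gcongr
      _ = _ := by ring

lemma ennreal_tsum_prod_add (f : ℕ → ℝ≥0∞) :
    ∑' p : ℕ × ℕ, f (p.1 + p.2) = ∑' n : ℕ, (n + 1 : ℝ≥0∞) * f n := by
  rw [← (Finset.HasAntidiagonal.sigmaAntidiagonalEquivProd (A := ℕ)).tsum_eq, ENNReal.tsum_sigma']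
  refine tsum_congr fun n => ?_
  have : ∀ b : Finset.HasAntidiagonal.antidiagonal n, f ((Finset.HasAntidiagonal.sigmaAntidiagonalEquivProd ⟨n, b⟩).1 +
      (Finset.HasAntidiagonal.sigmaAntidiagonalEquivProd ⟨n, b⟩).2) = f n := by
    rintro ⟨b, hb⟩
    simp [Finset.HasAntidiagonal.sigmaAntidiagonalEquivProd_apply, Finset.HasAntidiagonal.mem_antidiagonal.1 hb]
  simp_rw [this]
  simp

lemma ennreal_tsum_neg_log {r : ℝ} (hr : 0 < r) :
    ∑' p : ℕ × ℕ, ENNReal.ofReal (-Real.log (1 - Real.exp (-r) ^ (p.1 + p.2 + 1))) =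
      ENNReal.ofReal (logSeries 0 r) := by
  rw [ennreal_tsum_prod_add (fun n => ENNReal.ofReal (-Real.log (1 - Real.exp (-r) ^ (n + 1)))),
    logSeries, ENNReal.ofReal_tsum_of_nonneg (fun p => by
      have := coeff_pos p; have := freq_pos p; positivity) (summable_logSeries 0 hr),
    ENNReal.tsum_prod']
  refine tsum_congr fun n => ?_
  have hx : |Real.exp (-r) ^ (n + 1)| < 1 := by
    rw [abs_of_pos (by positivity)]
    exact pow_lt_one₀ (by positivity) (by simpa using hr) (by simp)
  have h := Real.hasSum_pow_div_log_of_abs_lt_one hx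
  rw [← h.tsum_eq, ENNReal.ofReal_tsum_of_nonneg (fun _ => by positivity) h.summable,
    ← ENNReal.tsum_mul_left]
  refine tsum_congr fun k => ?_
  rw [show (n + 1 : ℝ≥0∞) = ENNReal.ofReal (n + 1) by
    rw [ENNReal.ofReal_add (by positivity) (by positivity)]; simp,
    ← ENNReal.ofReal_mul (by positivity), ← pow_mul, ← Real.exp_nat_mul]
  congr 1
  simp only [coeff, freq, pow_zero]
  push_cast
  rw [show ((n : ℝ) + 1) * (k + 1) * -r = -((n + 1) * (k + 1)) * r by ring]
  ring

lemma tsum_size_eq_exp {r : ℝ} (hr : 0 < r) :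
    ∑' ω : PPart, ENNReal.ofReal (Real.exp (-r)) ^ ω.size =
      ENNReal.ofReal (Real.exp (logSeries 0 r)) := by
  rw [tsum_size_eq_iSup]
  set u : ℕ × ℕ → ℝ := fun p => -Real.log (1 - Real.exp (-r) ^ (p.1 + p.2 + 1)) with hu
  have hlt (m : ℕ) : Real.exp (-r) ^ (m + 1) < 1 :=
    pow_lt_one₀ (by positivity) (by simpa using hr) (by simp)
  have hu0 (p) : 0 ≤ u p := by
    have := hlt (p.1 + p.2)
    rw [hu]; simp only [Left.nonneg_neg_iff]
    apply Real.log_nonpos <;> linarith [show 0 < Real.exp (-r) ^ (p.1 + p.2 + 1) by positivity]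
  have hE := ennreal_tsum_neg_log hr
  have hsum : Summable u := by
    have := ENNReal.summable_toReal (hE.trans_ne ENNReal.ofReal_ne_top)
    refine this.congr fun p => ENNReal.toReal_ofReal (hu0 p)
  have hL0 : 0 ≤ logSeries 0 r := tsum_nonneg fun p => by
    have := coeff_pos p; have := freq_pos p; positivity
  have hval : HasSum u (logSeries 0 r) := by
    have : ∑' p, u p = logSeries 0 r := by
      rw [← ENNReal.ofReal_tsum_of_nonneg hu0 hsum] at hE
      exact (ENNReal.ofReal_eq_ofReal_iff (tsum_nonneg hu0) hL0).1 hE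
    rw [← this]; exact hsum.hasSum
  have hprod (N : ℕ) : ∏ j ∈ Finset.range (N + 1), ∏ i ∈ Finset.range N,
      (1 - ENNReal.ofReal (Real.exp (-r)) ^ (i + j + 1))⁻¹ =
      ENNReal.ofReal (Real.exp (∑ p ∈ Finset.range (N + 1) ×ˢ Finset.range N, u p)) := by
    rw [← Finset.prod_product', Real.exp_sum, ENNReal.ofReal_prod_of_nonneg
      (fun _ _ => by positivity)]
    refine Finset.prod_congr rfl fun p _ => ?_
    have := hlt (p.1 + p.2)
    rw [hu]
    simp only
    rw [Real.exp_neg (Real.log _), Real.exp_log (by linarith), ENNReal.ofReal_inv_of_pos (by linarith),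
      ENNReal.ofReal_sub _ (by positivity), ENNReal.ofReal_one, ENNReal.ofReal_pow (by positivity),
      add_comm p.2 p.1]
  simp_rw [hprod]
  apply le_antisymm
  · refine iSup_le fun N => ENNReal.ofReal_le_ofReal (Real.exp_le_exp.2 ?_)
    exact sum_le_hasSum _ (fun p _ => hu0 p) hval
  · have ht : Tendsto (fun N : ℕ => Finset.range (N + 1) ×ˢ Finset.range N) atTop atTop := by
      refine tendsto_atTop_finset_of_monotone (fun a b hab => ?_) (fun p => ?_)
      · exact Finset.product_subset_product (Finset.range_subset_range.2 (by omega))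
          (Finset.range_subset_range.2 hab)
      · exact ⟨p.1 + p.2 + 1, by simp; omega⟩
    have h2 : Tendsto (fun N : ℕ => ENNReal.ofReal
        (Real.exp (∑ p ∈ Finset.range (N + 1) ×ˢ Finset.range N, u p))) atTop
        (nhds (ENNReal.ofReal (Real.exp (logSeries 0 r)))) := by
      have h3 : Tendsto (fun N : ℕ => ∑ p ∈ Finset.range (N + 1) ×ˢ Finset.range N, u p) atTop
          (nhds (logSeries 0 r)) := Tendsto.comp (g := fun s => ∑ p ∈ s, u p) hval ht
      exact ((ENNReal.continuous_ofReal.comp Real.continuous_exp).tendsto _).comp h3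
    exact le_of_tendsto' h2 fun N => le_iSup (fun N : ℕ => ENNReal.ofReal
        (Real.exp (∑ p ∈ Finset.range (N + 1) ×ˢ Finset.range N, u p))) N

/-- The number of plane partitions of size `n`. -/
noncomputable def ppCount (n : ℕ) : ℕ := Nat.card {ω : PPart // ω.size = n}

lemma tsum_card_eq {r : ℝ} (hr : 0 < r) :
    ∑' n : ℕ, (ENat.card {ω : PPart // ω.size = n} : ℝ≥0∞) *
      ENNReal.ofReal (Real.exp (-r)) ^ n = ENNReal.ofReal (Real.exp (logSeries 0 r)) := by
  rw [← tsum_size_eq_exp hr, ← (Equiv.sigmaFiberEquiv PPart.size).tsum_eq, ENNReal.tsum_sigma']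
  refine tsum_congr fun n => ?_
  rw [← ENNReal.tsum_const]
  refine tsum_congr fun ω => ?_
  rw [Equiv.sigmaFiberEquiv_apply, ω.2]

lemma finite_size_eq (n : ℕ) : Finite {ω : PPart // ω.size = n} := by
  by_contra h
  rw [not_finite_iff_infinite] at h
  have h1 := tsum_card_eq one_pos
  have h2 := ENNReal.le_tsum (f := fun n : ℕ => (ENat.card {ω : PPart // ω.size = n} : ℝ≥0∞) *
      ENNReal.ofReal (Real.exp (-1)) ^ n) n
  rw [h1, ENat.card_eq_top_of_infinite] at h2
  rw [ENat.toENNReal_top, ENNReal.top_mul] at h2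
  · exact ENNReal.ofReal_ne_top (top_le_iff.1 h2)
  · have : 0 < ENNReal.ofReal (Real.exp (-1)) := by simp [Real.exp_pos]
    exact (pow_ne_zero _ this.ne')

lemma hasSum_ppCount {r : ℝ} (hr : 0 < r) :
    HasSum (fun n : ℕ => (ppCount n : ℝ) * Real.exp (-n * r)) (Real.exp (logSeries 0 r)) := by
  have h := tsum_card_eq hr
  have h0 (n : ℕ) : (ENat.card {ω : PPart // ω.size = n} : ℝ≥0∞) *
      ENNReal.ofReal (Real.exp (-r)) ^ n =
      ENNReal.ofReal ((ppCount n : ℝ) * Real.exp (-n * r)) := by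
    have := finite_size_eq n
    rw [ENat.card_eq_coe_natCard, ENNReal.ofReal_mul (by positivity), ENNReal.ofReal_natCast,
      ← ENNReal.ofReal_pow (by positivity), ← Real.exp_nat_mul, mul_neg, neg_mul]
    rfl
  simp_rw [h0] at h
  have hs : Summable fun n : ℕ => (ppCount n : ℝ) * Real.exp (-n * r) := by
    refine (ENNReal.summable_toReal (h.trans_ne ENNReal.ofReal_ne_top)).congr fun n => ?_
    exact ENNReal.toReal_ofReal (by positivity)
  rw [← ENNReal.ofReal_tsum_of_nonneg (fun _ => by positivity) hs,
    ENNReal.ofReal_eq_ofReal_iff (tsum_nonneg fun _ => by positivity) (by positivity)] at h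
  exact h ▸ hs.hasSum

lemma norm_cexp_mul (a : ℝ) (z : ℂ) : ‖Complex.exp (-a * z)‖ = Real.exp (-a * z.re) := by
  rw [Complex.norm_exp]; simp

lemma norm_logGen_term (p : ℕ × ℕ) (z : ℂ) :
    ‖(coeff p : ℂ) * Complex.exp (-freq p * z)‖ = coeff p * Real.exp (-freq p * z.re) := by
  rw [norm_mul, norm_cexp_mul, Complex.norm_real, Real.norm_of_nonneg (coeff_pos p).le]

lemma summable_logGen {z : ℂ} (hz : 0 < z.re) :
    Summable fun p : ℕ × ℕ => (coeff p : ℂ) * Complex.exp (-freq p * z) := by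
  apply Summable.of_norm
  simp_rw [norm_logGen_term]
  simpa using summable_logSeries 0 hz

lemma logGen_ofReal (r : ℝ) : logGen r = logSeries 0 r := by
  rw [logGen, logSeries, Complex.ofReal_tsum]
  refine tsum_congr fun p => ?_
  push_cast; ring

lemma isOpen_halfPlane (δ : ℝ) : IsOpen {z : ℂ | δ < z.re} :=
  isOpen_lt continuous_const Complex.continuous_re

lemma tsum_ppCount_eq {z : ℂ} (hz : 0 < z.re) :
    ∑' n : ℕ, (ppCount n : ℂ) * Complex.exp (-n * z) = Complex.exp (logGen z) := by
  set δ := z.re / 2 with hδ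
  have hδ0 : 0 < δ := by positivity
  have hD1 : DifferentiableOn ℂ (fun z => ∑' n : ℕ, (ppCount n : ℂ) * Complex.exp (-n * z))
      {z : ℂ | δ < z.re} := by
    refine Complex.differentiableOn_tsum_of_summable_norm (hasSum_ppCount hδ0).summable
      (fun n => by fun_prop) (isOpen_halfPlane δ) fun n w hw => ?_
    have := norm_cexp_mul n w
    push_cast at this
    rw [norm_mul, this, Complex.norm_natCast]
    have : δ < w.re := hw
    refine mul_le_mul_of_nonneg_left (Real.exp_le_exp.2 ?_) (by positivity)
    nlinarith [n.cast_nonneg (α := ℝ)]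
  have hD2 : DifferentiableOn ℂ logGen {z : ℂ | δ < z.re} := by
    refine Complex.differentiableOn_tsum_of_summable_norm
      (by simpa using summable_logSeries 0 hδ0)
      (fun n => by fun_prop) (isOpen_halfPlane δ) fun p w hw => ?_
    rw [norm_logGen_term]
    have : δ < w.re := hw
    have := coeff_pos p
    have := freq_pos p
    gcongr
    nlinarith
  have hpre : IsPreconnected {z : ℂ | δ < z.re} := (convex_halfSpace_re_gt δ).isPreconnected
  refine AnalyticOnNhd.eqOn_of_preconnected_of_frequently_eq (U := {z : ℂ | δ < z.re})
    (z₀ := ((2 * δ : ℝ) : ℂ)) (hD1.analyticOnNhd (isOpen_halfPlane δ))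
    (hD2.cexp.analyticOnNhd (isOpen_halfPlane δ)) hpre ?_ ?_ ?_
  · simp; linarith
  · have htend : Tendsto (fun t : ℝ => (t : ℂ)) (nhdsWithin (2 * δ) {2 * δ}ᶜ)
        (nhdsWithin ((2 * δ : ℝ) : ℂ) {((2 * δ : ℝ) : ℂ)}ᶜ) := by
      refine tendsto_nhdsWithin_iff.2 ⟨?_, ?_⟩
      · exact (Complex.continuous_ofReal.tendsto _).mono_left nhdsWithin_le_nhds
      · filter_upwards [self_mem_nhdsWithin] with t ht
        simpa [← Complex.ofReal_mul] using fun h => ht (by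
          have : (t : ℂ) = ((2 * δ : ℝ) : ℂ) := by exact_mod_cast h
          exact_mod_cast this)
    refine htend.frequently (Eventually.frequently ?_)
    have : ∀ᶠ t in nhdsWithin (2 * δ) {2 * δ}ᶜ, 0 < t :=
      nhdsWithin_le_nhds (lt_mem_nhds (by linarith))
    filter_upwards [this] with t ht
    rw [logGen_ofReal, ← Complex.ofReal_exp, ← (hasSum_ppCount ht).tsum_eq, Complex.ofReal_tsum]
    refine tsum_congr fun n => ?_
    push_cast; rfl
  · show δ < z.re
    linarith

lemma finite_support_of_tsum_ne_zero {f : ℕ × ℕ → ℕ} (h : ∑' p, f p ≠ 0) :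
    (Function.support f).Finite := by
  have hs : Summable f := by
    by_contra hs
    exact h (tsum_eq_zero_of_not_summable hs)
  have := (hs.map (Nat.castAddMonoidHom ℤ) (by fun_prop)).hasFiniteSupport_of_discreteTopology
  refine Set.Finite.subset this fun p hp => ?_
  simpa using hp

lemma planePartitionCount_eq {n : ℕ} (hn : n ≠ 0) : planePartitionCount n = ppCount n := by
  refine Nat.card_congr ⟨fun ω => ⟨⟨ω.1, ω.2.1, ω.2.2.1,
      finite_support_of_tsum_ne_zero (ω.2.2.2.trans_ne hn)⟩, ω.2.2.2⟩,
    fun ω => ⟨ω.1.1, ω.1.2.1, ω.1.2.2.1, ω.2⟩, fun _ => rfl, fun _ => rfl⟩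

lemma planePartitionCount_zero : planePartitionCount 0 = 0 := by
  rw [planePartitionCount, Nat.card_eq_zero]
  right
  refine Infinite.of_injective (β := ℕ) (fun k => ⟨fun _ _ => k, by simp, by simp, ?_⟩) ?_
  · by_contra h
    rcases Nat.eq_zero_or_pos k with rfl | hk
    · simp at h
    · have := finite_support_of_tsum_ne_zero h
      rw [show Function.support (fun _ : ℕ × ℕ => k) = Set.univ by ext; simp; omega] at this
      exact Set.infinite_univ this
  · intro a b h
    simpa [funext_iff] using h

lemma integral_cexp_int (k : ℤ) :
    ∫ θ in (-π)..π, Complex.exp (k * (θ * Complex.I)) = if k = 0 then 2 * (π : ℂ) else 0 := by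
  split_ifs with hk
  · simp [hk]; ring
  · have hc : (k : ℂ) * Complex.I ≠ 0 := by simp [hk]
    have := integral_exp_mul_complex (a := -π) (b := π) hc
    rw [show (fun θ : ℝ => Complex.exp (k * (θ * Complex.I))) =
      fun θ : ℝ => Complex.exp (k * Complex.I * θ) by ext; ring_nf, this]
    have h2 : Complex.exp (k * Complex.I * (π : ℝ)) = Complex.exp (k * Complex.I * (-π : ℝ)) := by
      rw [Complex.exp_eq_exp_iff_exists_int]
      exact ⟨k, by push_cast; ring⟩
    rw [h2]; simp

lemma continuous_logGen {r : ℝ} (hr : 0 < r) :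
    Continuous fun θ : ℝ => logGen (r + θ * Complex.I) := by
  refine continuous_tsum (fun p => by fun_prop) (by simpa using summable_logSeries 0 hr)
    fun p θ => ?_
  rw [norm_logGen_term]
  simp

lemma ppCount_eq_integral (n : ℕ) {r : ℝ} (hr : 0 < r) :
    (2 * π * ppCount n : ℂ) = ∫ θ in (-π)..π,
      Complex.exp (logGen (r + θ * Complex.I) + n * (r + θ * Complex.I)) := by
  have h := intervalIntegral.hasSum_integral_of_dominated_convergence
    (μ := MeasureTheory.volume) (a := -π) (b := π)
    (F := fun (m : ℕ) (θ : ℝ) => (ppCount m : ℂ) * Complex.exp (-m * (r + θ * Complex.I)) *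
      Complex.exp (n * (r + θ * Complex.I)))
    (f := fun θ => Complex.exp (logGen (r + θ * Complex.I) + n * (r + θ * Complex.I)))
    (fun m _ => (ppCount m : ℝ) * Real.exp (-m * r) * Real.exp (n * r))
    (fun m => by fun_prop) (fun m => Eventually.of_forall fun θ _ => by
      rw [norm_mul, norm_mul, Complex.norm_exp, Complex.norm_exp, Complex.norm_natCast]
      simp) (Eventually.of_forall fun θ _ => ((hasSum_ppCount hr).summable.mul_right _))
    (by simp) (Eventually.of_forall fun θ _ => by
      have hz : 0 < (r + θ * Complex.I : ℂ).re := by simpa using hr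
      rw [Complex.exp_add, ← tsum_ppCount_eq hz]
      apply HasSum.mul_right
      apply Summable.hasSum
      apply Summable.of_norm
      refine (hasSum_ppCount hr).summable.congr fun m => ?_
      rw [norm_mul, Complex.norm_exp, Complex.norm_natCast]
      simp)
  rw [← h.tsum_eq, tsum_eq_single n]
  · simp_rw [mul_assoc, ← Complex.exp_add]
    simp
    ring
  · intro m hm
    have h1 (θ : ℝ) : (ppCount m : ℂ) * Complex.exp (-m * (r + θ * Complex.I)) *
      Complex.exp (n * (r + θ * Complex.I)) = (ppCount m : ℂ) * Complex.exp ((n - m) * r) *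
        Complex.exp (((n - m : ℤ) : ℂ) * (θ * Complex.I)) := by
      rw [mul_assoc, mul_assoc, ← Complex.exp_add, ← Complex.exp_add]
      push_cast
      ring_nf
    simp_rw [h1]
    rw [intervalIntegral.integral_const_mul, integral_cexp_int, if_neg (by omega), mul_zero]

lemma lipschitz_formula {k : ℕ} (hk : 1 ≤ k) {w : ℝ} (hw : 0 < w) :
    ((∑' n : ℕ, (n : ℝ) ^ k * Real.exp (-n * w) : ℝ) : ℂ) =
      (Nat.factorial k : ℂ) * ∑' n : ℤ, 1 / ((w : ℂ) - 2 * π * Complex.I * n) ^ (k + 1) := by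
  have hpi : (π : ℂ) ≠ 0 := by exact_mod_cast Real.pi_ne_zero
  set z : UpperHalfPlane := ⟨Complex.I * (w / (2 * π) : ℝ), by
    rw [Complex.I_mul_im, Complex.ofReal_re]; positivity⟩ with hz
  have hzc : (z : ℂ) = Complex.I * (w / (2 * π) : ℝ) := rfl
  have h := EisensteinSeries.qExpansion_identity hk z
  rw [hzc] at h
  have h1 (n : ℤ) : 1 / (Complex.I * ((w / (2 * π) : ℝ) : ℂ) + n) ^ (k + 1) =
      (-2 * π * Complex.I) ^ (k + 1) * (1 / ((w : ℂ) - 2 * π * Complex.I * n) ^ (k + 1)) := by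
    have : (w : ℂ) - 2 * π * Complex.I * n =
        (-2 * π * Complex.I) * (Complex.I * ((w / (2 * π) : ℝ) : ℂ) + n) := by
      push_cast
      field_simp
      ring_nf
      simp
    have key : ∀ a b : ℂ, a ≠ 0 → 1 / b ^ (k + 1) = a ^ (k + 1) * (1 / (a * b) ^ (k + 1)) := by
      intro a b ha
      rw [mul_pow]; field_simp
    rw [this]
    exact key _ _ (by simp [hpi])
  have h2 (n : ℕ) : (n : ℂ) ^ k * Complex.exp (2 * π * Complex.I *
      (Complex.I * ((w / (2 * π) : ℝ) : ℂ))) ^ n =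
      (((n : ℝ) ^ k * Real.exp (-n * w) : ℝ) : ℂ) := by
    rw [← Complex.exp_nat_mul]
    push_cast
    congr 2
    field_simp
    ring_nf
    simp
  have h2' (n : ℕ) := h2 n
  simp_rw [h1] at h
  rw [tsum_mul_left] at h
  simp only [h2'] at h
  rw [Complex.ofReal_tsum]
  have hne : (-2 * π * Complex.I : ℂ) ^ (k + 1) ≠ 0 := by simp [hpi]
  have hf : (Nat.factorial k : ℂ) ≠ 0 := by exact_mod_cast (Nat.factorial_pos k).ne'
  have h3 := mul_left_cancel₀ hne (h.trans (by rw [div_mul_eq_mul_div, mul_div_assoc]))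
  rw [h3, ← mul_div_assoc, mul_div_cancel_left₀ _ hf]

/-- The remainder of the series `∑ n ^ k * exp (-n * w)`. -/
noncomputable def powExpRem (k : ℕ) (w : ℝ) : ℝ :=
  ∑' n : ℕ, (n : ℝ) ^ k * Real.exp (-n * w) - Nat.factorial k / w ^ (k + 1)

lemma norm_sub_ge (w : ℝ) (n : ℤ) :
    w ≤ ‖(w : ℂ) - 2 * π * Complex.I * n‖ ∧ |(n : ℝ)| ≤ ‖(w : ℂ) - 2 * π * Complex.I * n‖ := by
  constructor
  · have := Complex.abs_re_le_norm ((w : ℂ) - 2 * π * Complex.I * n)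
    simp at this
    exact (le_abs_self w).trans this
  · have := Complex.abs_im_le_norm ((w : ℂ) - 2 * π * Complex.I * n)
    simp [abs_mul, abs_of_pos Real.pi_pos] at this
    refine le_trans ?_ this
    nlinarith [Real.pi_gt_three, abs_nonneg (n : ℝ)]

lemma norm_term_le {k : ℕ} {α : ℝ} (hα : 0 ≤ α) (hαk : α < k) {w : ℝ} (hw : 0 < w) {n : ℤ}
    (hn : n ≠ 0) : ‖1 / ((w : ℂ) - 2 * π * Complex.I * n) ^ (k + 1)‖ ≤
      w ^ (-α) * |(n : ℝ)| ^ (-(k + 1 - α)) := by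
  obtain ⟨h1, h2⟩ := norm_sub_ge w n
  set N := ‖(w : ℂ) - 2 * π * Complex.I * n‖
  have hN : 0 < N := hw.trans_le h1
  have hn' : 0 < |(n : ℝ)| := by positivity
  rw [norm_div, norm_pow, norm_one, Real.rpow_neg hw.le, Real.rpow_neg hn'.le, ← mul_inv, one_div]
  apply inv_anti₀ (by positivity)
  calc _ ≤ N ^ α * N ^ ((k : ℝ) + 1 - α) := by
        have : 0 ≤ (k : ℝ) + 1 - α := by linarith
        gcongr
    _ = N ^ (k + 1) := by
        rw [← Real.rpow_add hN, ← Real.rpow_natCast]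
        congr 1; push_cast; ring

lemma powExpRem_eq {k : ℕ} (hk : 1 ≤ k) {w : ℝ} (hw : 0 < w) :
    (Summable fun n : ℤ => 1 / ((w : ℂ) - 2 * π * Complex.I * n) ^ (k + 1)) ∧
    (powExpRem k w : ℂ) = Nat.factorial k *
      ∑' n : ℤ, if n = 0 then 0 else 1 / ((w : ℂ) - 2 * π * Complex.I * n) ^ (k + 1) := by
  have hs : Summable fun n : ℤ => 1 / ((w : ℂ) - 2 * π * Complex.I * n) ^ (k + 1) := by
    apply Summable.of_norm
    have h1 := ((Real.summable_abs_int_rpow (b := (k : ℝ) + 1) (by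
      have : (1 : ℝ) ≤ k := by exact_mod_cast hk
      linarith)).mul_left (w ^ (-(0 : ℝ))))
    refine Summable.of_norm_bounded_eventually h1 ?_
    filter_upwards [(Set.finite_singleton (0 : ℤ)).compl_mem_cofinite] with n hn
    rw [norm_norm]
    have := norm_term_le (k := k) le_rfl (by exact_mod_cast hk) hw (n := n) hn
    simpa using this
  refine ⟨hs, ?_⟩
  rw [powExpRem, Complex.ofReal_sub, lipschitz_formula hk hw, hs.tsum_eq_add_tsum_ite 0]
  push_cast
  simp
  ring

lemma powExpRem_bound {k : ℕ} (hk : 1 ≤ k) {α : ℝ} (hα : 0 ≤ α) (hαk : α < k) :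
    ∃ C, 0 ≤ C ∧ ∀ w, 0 < w → |powExpRem k w| ≤ C * w ^ (-α) := by
  have hs := Real.summable_abs_int_rpow (b := (k : ℝ) + 1 - α) (by linarith)
  refine ⟨Nat.factorial k * ∑' n : ℤ, |(n : ℝ)| ^ (-((k : ℝ) + 1 - α)),
    mul_nonneg (by positivity) (tsum_nonneg fun _ => by positivity), fun w hw => ?_⟩
  rw [← Real.norm_eq_abs, ← Complex.norm_real, (powExpRem_eq hk hw).2, norm_mul,
    Complex.norm_natCast, mul_assoc (Nat.factorial k : ℝ), ← tsum_mul_right]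
  gcongr
  refine tsum_of_norm_bounded (hs.mul_right _).hasSum fun n => ?_
  split_ifs with hn
  · simp; positivity
  · exact (norm_term_le hα hαk hw hn).trans_eq (mul_comm _ _)

lemma hasSum_logSeries (j : ℕ) {r : ℝ} (hr : 0 < r) :
    HasSum (fun m : ℕ => ((m : ℝ) + 1) ^ j / (m + 1) * powExpRem (j + 1) ((m + 1) * r))
      (logSeries j r - Nat.factorial (j + 1) * zeta3 / r ^ (j + 2)) := by
  have hs := summable_logSeries j hr
  have hz : Summable fun m : ℕ => 1 / ((m : ℝ) + 1) ^ 3 := by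
    have := (summable_nat_add_iff 1).2 (Real.summable_one_div_nat_pow.2 (by norm_num : 1 < 3))
    simpa using this
  have h2 := (hz.hasSum.mul_left (Nat.factorial (j + 1) : ℝ)).mul_right (r ^ (j + 2))⁻¹
  have hs' : Summable fun p : ℕ × ℕ => coeff p.swap * freq p.swap ^ j *
      Real.exp (-freq p.swap * r) := hs.prod_symm
  have h1 : HasSum (fun m : ℕ => ∑' n : ℕ, coeff (n, m) * freq (n, m) ^ j *
      Real.exp (-freq (n, m) * r)) (logSeries j r) := by
    have e : logSeries j r = ∑' p : ℕ × ℕ, coeff p.swap * freq p.swap ^ j *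
      Real.exp (-freq p.swap * r) := ((Equiv.prodComm ℕ ℕ).tsum_eq _).symm
    rw [e]
    exact hs'.hasSum.prod_fiberwise fun m => (hs'.prod_factor m).hasSum
  have h3 := h1.sub h2
  rw [← div_eq_mul_inv] at h3
  refine h3.congr_fun fun m => ?_
  rw [powExpRem, mul_sub]
  congr 1
  · have hm : 0 < ((m : ℝ) + 1) * r := by positivity
    have hsum : Summable fun n : ℕ => (n : ℝ) ^ (j + 1) * Real.exp (-n * ((m + 1) * r)) := by
      refine (Real.summable_pow_mul_exp_neg_nat_mul (j + 1) hm).congr fun n => ?_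
      ring_nf
    rw [hsum.tsum_eq_zero_add]
    simp only [ne_eq, Nat.add_eq_zero_iff, one_ne_zero, and_false, not_false_eq_true,
      Nat.cast_zero, zero_pow, zero_mul, zero_add]
    rw [← tsum_mul_left]
    refine tsum_congr fun n => ?_
    simp only [coeff, freq]
    push_cast
    rw [show -((n : ℝ) + 1) * ((m + 1) * r) = -((n + 1) * (m + 1)) * r by ring]
    field_simp
    rw [mul_pow]
    ring
  · rw [mul_pow]
    field_simp
    ring

lemma logSeries_bound (j : ℕ) {α : ℝ} (hα : j < α) (hαj : α < j + 1) :
    ∃ C, 0 ≤ C ∧ ∀ r, 0 < r →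
      |logSeries j r - Nat.factorial (j + 1) * zeta3 / r ^ (j + 2)| ≤ C * r ^ (-α) := by
  have hα0 : 0 ≤ α := (Nat.cast_nonneg j).trans hα.le
  obtain ⟨C, hC, h⟩ := powExpRem_bound (k := j + 1) (by omega) hα0 (by push_cast; exact hαj)
  have hs : Summable fun m : ℕ => ((m : ℝ) + 1) ^ ((j : ℝ) - 1 - α) := by
    have := (summable_nat_add_iff 1).2 (Real.summable_nat_rpow.2
      (by linarith : (j : ℝ) - 1 - α < -1))
    simpa using this
  refine ⟨C * ∑' m : ℕ, ((m : ℝ) + 1) ^ ((j : ℝ) - 1 - α),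
    mul_nonneg hC (tsum_nonneg fun _ => by positivity), fun r hr => ?_⟩
  rw [← Real.norm_eq_abs, ← (hasSum_logSeries j hr).tsum_eq]
  refine tsum_of_norm_bounded ((hs.hasSum.mul_left C).mul_right _) fun m => ?_
  have hm : 0 < (m : ℝ) + 1 := by positivity
  rw [norm_mul, Real.norm_eq_abs, Real.norm_eq_abs, abs_of_pos (by positivity)]
  calc _ ≤ ((m : ℝ) + 1) ^ j / (m + 1) * (C * ((m + 1) * r) ^ (-α)) := by
        gcongr
        exact h _ (by positivity)
    _ = _ := by
        rw [Real.mul_rpow hm.le hr.le, Real.rpow_sub hm, Real.rpow_sub hm, Real.rpow_natCast,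
          Real.rpow_one, Real.rpow_neg hm.le]
        ring

section

open MeasureTheory Set

/-- The kernel of the Abel–Plana formula. -/
noncomputable def planaKernel (y : ℝ) : ℝ := y / (Real.exp (2 * π * y) - 1)

lemma exp_two_pi_mul_sub_one {y : ℝ} (hy : 0 < y) :
    y * Real.exp y ≤ Real.exp (2 * π * y) - 1 := by
  have h1 : Real.exp (y + y) ≤ Real.exp (2 * π * y) := by
    apply Real.exp_le_exp.2
    nlinarith [Real.pi_gt_three]
  rw [Real.exp_add] at h1
  nlinarith [Real.add_one_le_exp y, Real.exp_pos y]

lemma planaKernel_nonneg {y : ℝ} (hy : 0 < y) : 0 ≤ planaKernel y := by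
  have := exp_two_pi_mul_sub_one hy
  have h2 : 0 < y * Real.exp y := by positivity
  exact div_nonneg hy.le (by linarith)

lemma planaKernel_le {y : ℝ} (hy : 0 < y) : planaKernel y ≤ Real.exp (-y) := by
  have := exp_two_pi_mul_sub_one hy
  have h2 : 0 < y * Real.exp y := by positivity
  rw [planaKernel, div_le_iff₀ (by linarith)]
  calc y = Real.exp (-y) * (y * Real.exp y) := by
        rw [Real.exp_neg]; field_simp
    _ ≤ _ := by gcongr

lemma measurable_planaKernel : Measurable planaKernel := by
  unfold planaKernel; fun_prop

lemma integrableOn_rpow_mul_exp_neg {s b : ℝ} (hs : -1 < s) (hb : 0 < b) :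
    IntegrableOn (fun y : ℝ => y ^ s * Real.exp (-b * y)) (Ioi 0) := by
  simpa using integrableOn_rpow_mul_exp_neg_mul_rpow hs one_pos hb

lemma integrableOn_mul_exp_neg {b : ℝ} (hb : 0 < b) :
    IntegrableOn (fun y : ℝ => y * Real.exp (-b * y)) (Ioi 0) := by
  simpa using integrableOn_rpow_mul_exp_neg (s := 1) (by norm_num) hb

lemma integrableOn_planaKernel_mul_rpow {s : ℝ} (hs : -1 < s) :
    IntegrableOn (fun y : ℝ => planaKernel y * y ^ s) (Ioi 0) := by
  refine Integrable.mono' (integrableOn_rpow_mul_exp_neg hs one_pos)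
    (measurable_planaKernel.mul (by fun_prop)).aestronglyMeasurable ?_
  filter_upwards [ae_restrict_mem measurableSet_Ioi] with y hy
  have hy : 0 < y := hy
  rw [norm_mul, Real.norm_of_nonneg (planaKernel_nonneg hy), Real.norm_of_nonneg (by positivity),
    mul_comm]
  have := planaKernel_le hy
  simp only [neg_mul, one_mul]
  gcongr

lemma integrableOn_planaKernel : IntegrableOn planaKernel (Ioi 0) := by
  simpa using integrableOn_planaKernel_mul_rpow (s := 0) (by norm_num)

lemma integral_mul_cexp_neg {a : ℂ} (ha : 0 < a.re) :
    ∫ y in Ioi (0 : ℝ), (y : ℂ) * Complex.exp (-a * y) = 1 / a ^ 2 := by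
  have ha0 : a ≠ 0 := by rintro rfl; simp at ha
  have hn (y : ℝ) : ‖Complex.exp (-a * y)‖ = Real.exp (-a.re * y) := by
    rw [Complex.norm_exp]; simp
  have hfint : IntegrableOn (fun y : ℝ => (y : ℂ) * Complex.exp (-a * y)) (Ioi 0) := by
    refine Integrable.mono' (integrableOn_mul_exp_neg ha) (by fun_prop) ?_
    filter_upwards [ae_restrict_mem measurableSet_Ioi] with y hy
    rw [norm_mul, hn, Complex.norm_real, Real.norm_of_nonneg (le_of_lt hy)]
  have hderiv (y : ℝ) : HasDerivAt (fun y : ℝ => -(y / a + 1 / a ^ 2) * Complex.exp (-a * y))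
      ((y : ℂ) * Complex.exp (-a * y)) y := by
    have h1 : HasDerivAt (fun y : ℝ => (y : ℂ)) 1 y := Complex.ofRealCLM.hasDerivAt
    have h2 := ((h1.const_mul (-a)).cexp)
    have h3 := (((h1.div_const a).add_const (1 / a ^ 2)).neg.mul h2)
    refine h3.congr_deriv ?_
    simp only [Pi.neg_apply]
    field_simp
    ring
  have htend : Tendsto (fun y : ℝ => -(y / a + 1 / a ^ 2) * Complex.exp (-a * y)) atTop
      (nhds 0) := by
    have t1 := (tendsto_rpow_mul_exp_neg_mul_atTop_nhds_zero 1 a.re ha).const_mul (1 / ‖a‖)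
    have t0 := (tendsto_rpow_mul_exp_neg_mul_atTop_nhds_zero 0 a.re ha).const_mul (1 / ‖a‖ ^ 2)
    have t2 := t1.add t0
    simp only [mul_zero, add_zero] at t2
    refine squeeze_zero_norm' ?_ t2
    filter_upwards [eventually_ge_atTop 0] with y hy
    rw [norm_mul, hn, norm_neg]
    calc _ ≤ (‖(y : ℂ) / a‖ + ‖1 / a ^ 2‖) * Real.exp (-a.re * y) := by
          gcongr; exact norm_add_le _ _
      _ = _ := by
          rw [norm_div, norm_div, norm_pow, Complex.norm_real, Real.norm_of_nonneg hy]
          simp; ring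
  rw [integral_Ioi_of_hasDerivAt_of_tendsto' (fun y _ => hderiv y) hfint htend]
  simp

lemma hasSum_planaKernel {y : ℝ} (hy : 0 < y) :
    HasSum (fun n : ℕ => y * Real.exp (-(2 * π * (n + 1)) * y)) (planaKernel y) := by
  have h1 : Real.exp (-(2 * π * y)) < 1 := by
    rw [Real.exp_lt_one_iff]; simp; positivity
  have h := ((hasSum_geometric_of_lt_one (by positivity) h1).mul_left
    (y * Real.exp (-(2 * π * y))))
  have e : planaKernel y = y * Real.exp (-(2 * π * y)) * (1 - Real.exp (-(2 * π * y)))⁻¹ := by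
    have h2 : (1 : ℝ) < Real.exp (2 * π * y) := Real.one_lt_exp_iff.2 (by positivity)
    have h3 : Real.exp (2 * π * y) - 1 ≠ 0 := by linarith
    rw [planaKernel, Real.exp_neg]
    have h4 : 1 - (Real.exp (2 * π * y))⁻¹ ≠ 0 := by
      rw [Real.exp_neg] at h1; linarith
    field_simp
  rw [e]
  refine h.congr_fun fun n => ?_
  rw [← Real.exp_nat_mul, mul_assoc y, ← Real.exp_add]
  congr 2; ring

lemma hasSum_integral_planaKernel (w : ℝ) :
    HasSum (fun n : ℕ => 1 / (2 * π * (n + 1) + w * Complex.I : ℂ) ^ 2)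
      (∫ y in Ioi (0 : ℝ), (planaKernel y : ℂ) * Complex.exp (-(w * y) * Complex.I)) := by
  have hre (n : ℕ) : (2 * π * (n + 1) + w * Complex.I : ℂ).re = 2 * π * (n + 1) := by simp
  have hpos (n : ℕ) : 0 < 2 * π * ((n : ℝ) + 1) := by positivity
  have hfint (n : ℕ) := integrableOn_mul_exp_neg (hpos n)
  have hval (n : ℕ) : ∫ y in Ioi (0 : ℝ), y * Real.exp (-(2 * π * ((n : ℝ) + 1)) * y) =
      1 / (2 * π * (n + 1)) ^ 2 := by
    have := Real.integral_rpow_mul_exp_neg_mul_Ioi two_pos (hpos n)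
    norm_num at this
    simp only [neg_mul]
    rw [this]
    field_simp
  have hnorm (n : ℕ) (y : ℝ) (hy : y ∈ Ioi (0 : ℝ)) :
      ‖(y : ℂ) * Complex.exp (-(2 * π * (n + 1) + w * Complex.I) * y)‖ =
        y * Real.exp (-(2 * π * ((n : ℝ) + 1)) * y) := by
    rw [norm_mul, Complex.norm_exp, Complex.norm_real, Real.norm_of_nonneg (le_of_lt hy)]
    simp
  have hF (n : ℕ) : IntegrableOn (fun y : ℝ =>
      (y : ℂ) * Complex.exp (-(2 * π * (n + 1) + w * Complex.I) * y)) (Ioi 0) := by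
    refine Integrable.mono' (hfint n) (by fun_prop) ?_
    filter_upwards [ae_restrict_mem measurableSet_Ioi] with y hy
    exact (hnorm n y hy).le
  have h := MeasureTheory.hasSum_integral_of_summable_integral_norm hF (by
    have e (n : ℕ) : ∫ y in Ioi (0 : ℝ), ‖(y : ℂ) *
        Complex.exp (-(2 * π * (n + 1) + w * Complex.I) * y)‖ =
        (1 / (2 * π) ^ 2) * (1 / ((n : ℝ) + 1) ^ 2) := by
      rw [setIntegral_congr_fun measurableSet_Ioi (hnorm n), hval]
      rw [mul_pow]; field_simp
    simp_rw [e]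
    apply Summable.mul_left
    have := (summable_nat_add_iff 1).2 (Real.summable_one_div_nat_pow.2 (by norm_num : 1 < 2))
    simpa using this)
  have h1 (n : ℕ) : ∫ y in Ioi (0 : ℝ), (y : ℂ) *
      Complex.exp (-(2 * π * (n + 1) + w * Complex.I) * y) =
      1 / (2 * π * (n + 1) + w * Complex.I : ℂ) ^ 2 := by
    exact integral_mul_cexp_neg (by rw [hre]; exact hpos n)
  simp_rw [h1] at h
  have h4 : ∫ y in Ioi (0 : ℝ), (planaKernel y : ℂ) * Complex.exp (-(w * y) * Complex.I) =
      ∫ y in Ioi (0 : ℝ), ∑' n : ℕ, (y : ℂ) *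
        Complex.exp (-(2 * π * (n + 1) + w * Complex.I) * y) := ?_
  · rw [h4]; exact h
  refine setIntegral_congr_fun measurableSet_Ioi fun y hy => ?_
  have h3 := ((Complex.hasSum_ofReal.2 (hasSum_planaKernel hy)).mul_right
    (Complex.exp (-(w * y) * Complex.I)))
  rw [← h3.tsum_eq]
  refine tsum_congr fun n => ?_
  push_cast
  rw [mul_assoc, ← Complex.exp_add]
  ring_nf

lemma integrableOn_planaKernel_mul {g : ℝ → ℝ} (hg : Measurable g) {B : ℝ} (hB : ∀ y, |g y| ≤ B) :
    IntegrableOn (fun y => planaKernel y * g y) (Ioi 0) :=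
  integrableOn_planaKernel.mul_bdd (c := B) hg.aestronglyMeasurable (Eventually.of_forall hB)

lemma hasSum_integral_planaKernel_re (w : ℝ) :
    HasSum (fun n : ℕ => (1 / (2 * π * (n + 1) + w * Complex.I : ℂ) ^ 2).re)
      (∫ y in Ioi (0 : ℝ), planaKernel y * Real.cos (w * y)) := by
  have h := Complex.hasSum_re (hasSum_integral_planaKernel w)
  have hi : IntegrableOn (fun y : ℝ => (planaKernel y : ℂ) * Complex.exp (-(w * y) * Complex.I))
      (Ioi 0) := by
    refine Integrable.mul_bdd (c := 1) integrableOn_planaKernel.ofReal (by fun_prop)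
      (Eventually.of_forall fun y => ?_)
    rw [Complex.norm_exp]; simp
  have h2 := integral_re hi
  simp only [RCLike.re_to_complex] at h2
  rw [← h2] at h
  convert h using 1
  refine integral_congr_ae (Eventually.of_forall fun y => ?_)
  simp only
  rw [Complex.re_ofReal_mul]
  congr 1
  rw [Complex.exp_re]
  simp

lemma integral_planaKernel : ∫ y in Ioi (0 : ℝ), planaKernel y = 1 / 24 := by
  have h := hasSum_integral_planaKernel_re 0
  simp only [Complex.ofReal_zero, zero_mul, add_zero, Real.cos_zero, mul_one] at h
  have h2 : HasSum (fun n : ℕ => (1 : ℝ) / ((n : ℝ) + 1) ^ 2) (π ^ 2 / 6) := by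
    have := (hasSum_nat_add_iff' 1).2 hasSum_zeta_two
    simpa using this
  have h3 := h2.mul_left (1 / (2 * π) ^ 2)
  refine h.unique ?_
  have e : 1 / (2 * π) ^ 2 * (π ^ 2 / 6) = 1 / 24 := by field_simp; norm_num
  rw [← e]
  refine h3.congr_fun fun n => ?_
  have : (1 / (2 * (π : ℂ) * (n + 1)) ^ 2) = ((1 / (2 * π) ^ 2 * (1 / ((n : ℝ) + 1) ^ 2) : ℝ) : ℂ) := by
    push_cast; rw [mul_pow]; field_simp
  rw [this, Complex.ofReal_re]

lemma powExpRem_one {w : ℝ} (hw : 0 < w) :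
    powExpRem 1 w = -2 * ∫ y in Ioi (0 : ℝ), planaKernel y * Real.cos (w * y) := by
  set f : ℤ → ℂ := fun n => if n = 0 then 0 else 1 / ((w : ℂ) - 2 * π * Complex.I * n) ^ 2 with hf
  have h := (powExpRem_eq le_rfl hw).2
  have hsq (a b : ℂ) (hab : a = -Complex.I * b) : 1 / a ^ 2 = -(1 / b ^ 2) := by
    rw [hab, mul_pow, neg_sq, Complex.I_sq]; simp
  have hsq' (a b : ℂ) (hab : a = Complex.I * b) : 1 / a ^ 2 = -(1 / b ^ 2) := by
    rw [hab, mul_pow, Complex.I_sq]; simp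
  have h1 : HasSum (fun n : ℕ => (f (n + 1)).re)
      (-∫ y in Ioi (0 : ℝ), planaKernel y * Real.cos (w * y)) := by
    refine (hasSum_integral_planaKernel_re w).neg.congr_fun fun n => ?_
    have : (n : ℤ) + 1 ≠ 0 := by omega
    simp only [hf, if_neg this]
    rw [hsq _ (2 * π * (n + 1) + w * Complex.I), Complex.neg_re]
    push_cast
    ring_nf; simp
  have h2 : HasSum (fun n : ℕ => (f (-(n + 1))).re)
      (-∫ y in Ioi (0 : ℝ), planaKernel y * Real.cos (w * y)) := by
    have := (hasSum_integral_planaKernel_re (-w)).neg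
    simp only [neg_mul, Real.cos_neg] at this
    refine this.congr_fun fun n => ?_
    have : -((n : ℤ) + 1) ≠ 0 := by omega
    simp only [hf, if_neg this]
    rw [hsq' _ (2 * π * (n + 1) + (-w : ℝ) * Complex.I), Complex.neg_re]
    push_cast
    ring_nf; simp
  have h3 := HasSum.of_add_one_of_neg_add_one (f := fun n => (f n).re) h1 h2
  have h0 : f 0 = 0 := by simp [hf]
  have hsf : Summable f := by
    have hs := (powExpRem_eq le_rfl hw).1
    refine (hs.hasSum.update 0 0).summable.congr fun n => ?_
    by_cases hn : n = 0 <;> simp [hf, hn]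
  have h4 := Complex.hasSum_re hsf.hasSum
  have h5 := h4.unique h3
  have h6 : powExpRem 1 w = (∑' n, f n).re := by
    rw [← Complex.ofReal_re (powExpRem 1 w), h]; simp [hf]
  rw [h6, h5]
  simp [h0]; ring

end

section

open MeasureTheory Set

lemma abs_log_norm_sub_le {r y : ℝ} (hr : 0 < r) (hr1 : r ≤ 1) (hy : 0 < y) :
    |Real.log ‖1 - (Real.exp (-r ^ 6) : ℂ) * Complex.exp (Complex.I * (r * y : ℝ))‖ -
      Real.log (r * y)| ≤ r * (2 * y ^ (-(1 / 2) : ℝ) + 7 * y ^ 2 + 2 * y + 1) := by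
  set ρ := Real.exp (-r ^ 6) with hρ
  set x := r * y with hx
  set N := ‖1 - (ρ : ℂ) * Complex.exp (Complex.I * (x : ℝ))‖ with hN
  have hx0 : 0 < x := by positivity
  have hδ1 : r ^ 6 ≤ 1 := pow_le_one₀ hr.le hr1
  have hδr : r ^ 6 ≤ r ^ 2 := pow_le_pow_of_le_one hr.le hr1 (by norm_num)
  have hr2 : r ^ 2 ≤ r := by nlinarith
  have hρ0 : 0 < ρ := Real.exp_pos _
  have hρ1 : ρ < 1 := by rw [hρ, Real.exp_lt_one_iff]; simp; positivity
  have hρδ : 1 - r ^ 6 ≤ ρ := by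
    have := Real.add_one_le_exp (-r ^ 6); linarith
  have hNl : r ^ 6 / 2 ≤ N := by
    have h1 : 1 - ρ ≤ N := by
      have := norm_sub_norm_le (1 : ℂ) ((ρ : ℂ) * Complex.exp (Complex.I * (x : ℝ)))
      rw [norm_mul, mul_comm Complex.I, Complex.norm_exp_ofReal_mul_I, Complex.norm_real,
        Real.norm_of_nonneg hρ0.le, mul_comm _ Complex.I] at this
      simpa using this
    have h2 : ρ ≤ 1 - r ^ 6 / 2 := by
      have := Real.add_one_le_exp (r ^ 6)
      rw [hρ, Real.exp_neg]
      rw [inv_le_comm₀ (Real.exp_pos _) (by linarith)]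
      refine le_trans ?_ this
      rw [inv_le_iff_one_le_mul₀ (by linarith)]
      nlinarith [pow_pos hr 6]
    linarith
  have hN0 : 0 < N := lt_of_lt_of_le (by positivity) hNl
  have hs0 : 0 < y ^ (-(1 / 2) : ℝ) := by positivity
  have hs2 : (y ^ (-(1 / 2) : ℝ)) ^ 2 = y⁻¹ := by
    rw [← Real.rpow_natCast, ← Real.rpow_mul hy.le]; norm_num
    rw [Real.rpow_neg_one]
  rw [abs_le]
  constructor
  · rcases le_or_gt x 1 with hx1 | hx1
    · have hcos := (abs_le.1 (Real.cos_bound (x := x) (by rw [abs_of_pos hx0]; exact hx1))).2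
      rw [abs_of_pos hx0] at hcos
      have hNsq : N ^ 2 = (1 - ρ) ^ 2 + 2 * ρ * (1 - Real.cos x) := by
        rw [hN, ← Complex.normSq_eq_norm_sq, Complex.normSq_apply, mul_comm Complex.I,
          Complex.exp_mul_I]
        simp [Complex.cos_ofReal_re, Complex.sin_ofReal_re]
        nlinarith [Real.sin_sq_add_cos_sq x]
      have hx2 : x ^ 2 ≤ 1 := pow_le_one₀ hx0.le hx1
      set t := 5 / 48 * x ^ 2 with ht
      have ht0 : 0 < t := by positivity
      have h1t : 0 < 1 - t := by linarith
      have h1 : ρ * x ^ 2 * (1 - t) ≤ N ^ 2 := by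
        rw [hNsq]
        have : x ^ 2 * (1 - t) ≤ 2 * (1 - Real.cos x) := by
          rw [ht]; nlinarith
        nlinarith [sq_nonneg (1 - ρ)]
      have h2 := Real.log_le_log (by positivity) h1
      rw [Real.log_mul (by positivity) h1t.ne', Real.log_mul hρ0.ne' (by positivity), hρ,
        Real.log_exp, Real.log_pow, Real.log_pow] at h2
      have h3 : -(2 * t) ≤ Real.log (1 - t) := by
        have := Real.one_sub_inv_le_log_of_pos h1t
        refine le_trans ?_ this
        have : (1 - t)⁻¹ ≤ 1 + 2 * t := by
          rw [inv_le_iff_one_le_mul₀ h1t]; nlinarith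
        linarith
      push_cast at h2
      have h4 : x ^ 2 = r ^ 2 * y ^ 2 := by rw [hx]; ring
      have h5 : r ^ 2 * y ^ 2 ≤ r * y ^ 2 := by gcongr
      have h6 : 0 ≤ r * y := hx0.le
      have h7 : 0 ≤ r * y ^ (-(1 / 2) : ℝ) := by positivity
      have h8 : 0 ≤ r * y ^ 2 := by positivity
      nlinarith
    · have h1 := Real.log_le_log (by positivity) hNl
      rw [Real.log_div (by positivity) (by norm_num), Real.log_pow] at h1
      have h2 := Real.one_sub_inv_le_log_of_pos hr
      have h3 := Real.log_le_sub_one_of_pos hx0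
      have h4 := Real.log_le_sub_one_of_pos (x := 2) (by norm_num)
      push_cast at h1
      have h5 : r⁻¹ ≤ r * y ^ 2 := by
        rw [inv_le_iff_one_le_mul₀ hr]
        have : r * y ^ 2 * r = x ^ 2 := by rw [hx]; ring
        rw [this]; nlinarith
      have h7 : 0 ≤ r * y ^ (-(1 / 2) : ℝ) := by positivity
      have h8 : 0 ≤ r * y ^ 2 := by positivity
      nlinarith
  · have h1 : N ≤ r ^ 6 + x := by
      have e : (1 : ℂ) - (ρ : ℂ) * Complex.exp (Complex.I * (x : ℝ)) =
        ((1 - ρ : ℝ) : ℂ) - (ρ : ℂ) * (Complex.exp (Complex.I * (x : ℝ)) - 1) := by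
          push_cast; ring
      rw [hN, e]
      refine (norm_sub_le _ _).trans ?_
      rw [norm_mul, Complex.norm_real, Complex.norm_real, Real.norm_of_nonneg hρ0.le,
        Real.norm_of_nonneg (by linarith)]
      have h2 := Real.norm_exp_I_mul_ofReal_sub_one_le (x := x)
      rw [Real.norm_of_nonneg hx0.le] at h2
      have : ρ * ‖Complex.exp (Complex.I * (x : ℝ)) - 1‖ ≤ 1 * x := by gcongr
      linarith
    set s := r * y ^ (-(1 / 2) : ℝ) with hs
    have hspos : 0 < s := by positivity
    have h2 : r ^ 6 + x ≤ x * (1 + s) ^ 2 := by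
      have : x * s ^ 2 = r ^ 3 := by
        rw [hs, hx, mul_pow, hs2]; field_simp
      have h3 : r ^ 6 ≤ r ^ 3 := pow_le_pow_of_le_one hr.le hr1 (by norm_num)
      nlinarith [mul_pos hx0 hspos]
    have h3 := Real.log_le_log hN0 (h1.trans h2)
    rw [Real.log_mul hx0.ne' (by positivity), Real.log_pow] at h3
    have h4 := Real.log_le_sub_one_of_pos (x := 1 + s) (by positivity)
    push_cast at h3
    have : r * (2 * y ^ (-(1 / 2) : ℝ) + 7 * y ^ 2 + 2 * y + 1) =
      2 * s + r * (7 * y ^ 2 + 2 * y + 1) := by rw [hs]; ring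
    rw [this]
    have : 0 ≤ r * (7 * y ^ 2 + 2 * y + 1) := by positivity
    linarith

lemma abs_log_le {y : ℝ} (hy : 0 < y) : |Real.log y| ≤ y + 2 * y ^ (-(1 / 2) : ℝ) := by
  have h0 : 0 < y ^ (-(1 / 2) : ℝ) := by positivity
  rw [abs_le]
  constructor
  · have := Real.log_le_sub_one_of_pos h0
    rw [Real.log_rpow hy] at this
    linarith
  · have := Real.log_le_sub_one_of_pos hy
    linarith

lemma integrableOn_planaKernel_mul_log :
    IntegrableOn (fun y => planaKernel y * Real.log y) (Ioi 0) := by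
  have h1 := integrableOn_planaKernel_mul_rpow (s := 1) (by norm_num)
  have h2 := (integrableOn_planaKernel_mul_rpow (s := -(1 / 2)) (by norm_num)).const_mul 2
  refine Integrable.mono' (h1.add h2)
    (measurable_planaKernel.mul Real.measurable_log).aestronglyMeasurable ?_
  filter_upwards [ae_restrict_mem measurableSet_Ioi] with y hy
  have hy : 0 < y := hy
  rw [norm_mul, Real.norm_of_nonneg (planaKernel_nonneg hy), Real.norm_eq_abs]
  have := mul_le_mul_of_nonneg_left (abs_log_le hy) (planaKernel_nonneg hy)
  simp only [Pi.add_apply, Real.rpow_one]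
  linarith

lemma integral_planaKernel_mul_log :
    ∫ y in Ioi (0 : ℝ), planaKernel y * Real.log y = cConst := by
  rw [cConst]
  refine integral_congr_ae (Eventually.of_forall fun y => ?_)
  simp only [planaKernel]
  ring

lemma integral_planaKernel_log_norm :
    ∃ C, ∀ r, 0 < r → r ≤ 1 → |(∫ y in Ioi (0 : ℝ), planaKernel y *
      Real.log ‖1 - (Real.exp (-r ^ 6) : ℂ) * Complex.exp (Complex.I * (r * y : ℝ))‖) -
      (Real.log r / 24 + cConst)| ≤ C * r := by
  set B : ℝ → ℝ := fun y => 2 * y ^ (-(1 / 2) : ℝ) + 7 * y ^ 2 + 2 * y + 1 with hB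
  have hBi : IntegrableOn (fun y => planaKernel y * B y) (Ioi 0) := by
    have h1 := (integrableOn_planaKernel_mul_rpow (s := -(1 / 2)) (by norm_num)).const_mul 2
    have h2 := (integrableOn_planaKernel_mul_rpow (s := 2) (by norm_num)).const_mul 7
    have h3 := (integrableOn_planaKernel_mul_rpow (s := 1) (by norm_num)).const_mul 2
    refine (((h1.add h2).add h3).add integrableOn_planaKernel).congr
      (Eventually.of_forall fun y => ?_)
    simp [hB]; ring
  refine ⟨∫ y in Ioi (0 : ℝ), planaKernel y * B y, fun r hr hr1 => ?_⟩
  set G : ℝ → ℝ := fun y =>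
    Real.log ‖1 - (Real.exp (-r ^ 6) : ℂ) * Complex.exp (Complex.I * (r * y : ℝ))‖ with hG
  have hGm : Measurable G := by
    rw [hG]; fun_prop
  have hbound : ∀ᵐ y ∂(volume.restrict (Ioi (0 : ℝ))),
      ‖planaKernel y * (G y - Real.log (r * y))‖ ≤ planaKernel y * B y * r := by
    filter_upwards [ae_restrict_mem measurableSet_Ioi] with y hy
    have hy : 0 < y := hy
    rw [norm_mul, Real.norm_of_nonneg (planaKernel_nonneg hy), Real.norm_eq_abs, mul_assoc]
    refine mul_le_mul_of_nonneg_left ?_ (planaKernel_nonneg hy)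
    rw [mul_comm (B y)]
    exact abs_log_norm_sub_le hr hr1 hy
  have hDi : IntegrableOn (fun y => planaKernel y * (G y - Real.log (r * y))) (Ioi 0) :=
    Integrable.mono' (hBi.mul_const r) (measurable_planaKernel.mul
      (hGm.sub (by fun_prop))).aestronglyMeasurable hbound
  have hsplit : ∫ y in Ioi (0 : ℝ), planaKernel y * G y =
      (∫ y in Ioi (0 : ℝ), planaKernel y * (G y - Real.log (r * y))) +
        (Real.log r / 24 + cConst) := by
    have e : Real.log r / 24 + cConst = ∫ y in Ioi (0 : ℝ),
        (planaKernel y * Real.log r + planaKernel y * Real.log y) := by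
      rw [integral_add (integrableOn_planaKernel.mul_const _) integrableOn_planaKernel_mul_log,
        integral_mul_const, integral_planaKernel, integral_planaKernel_mul_log]
      ring
    have hi2 : IntegrableOn
        (fun y => planaKernel y * Real.log r + planaKernel y * Real.log y) (Ioi 0) :=
      (integrableOn_planaKernel.mul_const _).add integrableOn_planaKernel_mul_log
    rw [e, ← integral_add hDi hi2]
    refine setIntegral_congr_fun measurableSet_Ioi fun y hy => ?_
    have hy : 0 < y := hy
    rw [Real.log_mul hr.ne' hy.ne']
    ring
  rw [hsplit, add_sub_cancel_right, ← Real.norm_eq_abs, ← integral_mul_const]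
  exact norm_integral_le_of_norm_le (hBi.mul_const r) hbound

end

section

open MeasureTheory Set

lemma hasSum_pow_mul_powExpRem_one {r ρ : ℝ} (hr : 0 < r) (hρ0 : 0 ≤ ρ) (hρ1 : ρ < 1) :
    HasSum (fun m : ℕ => ρ ^ (m + 1) / (m + 1) * powExpRem 1 ((m + 1) * r))
      (2 * ∫ y in Ioi (0 : ℝ), planaKernel y *
        Real.log ‖1 - (ρ : ℂ) * Complex.exp (Complex.I * (r * y : ℝ))‖) := by
  set F : ℕ → ℝ → ℝ := fun m y =>
    planaKernel y * (ρ ^ (m + 1) / (m + 1) * Real.cos ((m + 1) * r * y)) with hF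
  have hb (m : ℕ) (y : ℝ) : |ρ ^ (m + 1) / (m + 1) * Real.cos ((m + 1) * r * y)| ≤ ρ ^ m := by
    rw [abs_mul, abs_of_nonneg (by positivity)]
    have h1 : ρ ^ (m + 1) / (m + 1) ≤ ρ ^ m := by
      rw [div_le_iff₀ (by positivity), pow_succ]
      gcongr
      linarith [(Nat.cast_nonneg m : (0 : ℝ) ≤ m)]
    calc _ ≤ ρ ^ m * 1 := by
          gcongr
          exact Real.abs_cos_le_one _
      _ = _ := mul_one _
  have hFi (m : ℕ) : IntegrableOn (F m) (Ioi 0) :=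
    integrableOn_planaKernel_mul (by fun_prop) (hb m)
  have hsum : Summable fun m => ∫ y in Ioi (0 : ℝ), ‖F m y‖ := by
    refine Summable.of_nonneg_of_le (fun m => integral_nonneg fun y => norm_nonneg _)
      (fun m => ?_) ((summable_geometric_of_lt_one hρ0 hρ1).mul_left (1 / 24))
    rw [← integral_planaKernel, ← integral_mul_const]
    refine setIntegral_mono_on (hFi m).norm (integrableOn_planaKernel.mul_const _)
      measurableSet_Ioi fun y hy => ?_
    rw [hF, norm_mul, Real.norm_of_nonneg (planaKernel_nonneg hy), Real.norm_eq_abs]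
    exact mul_le_mul_of_nonneg_left (hb m y) (planaKernel_nonneg hy)
  have h := (hasSum_integral_of_summable_integral_norm hFi hsum).mul_left (-2)
  have e1 : (∫ y in Ioi (0 : ℝ), ∑' m, F m y) = -∫ y in Ioi (0 : ℝ), planaKernel y *
      Real.log ‖1 - (ρ : ℂ) * Complex.exp (Complex.I * (r * y : ℝ))‖ := by
    rw [← integral_neg]
    refine integral_congr_ae (Eventually.of_forall fun y => ?_)
    have hz : ‖(ρ : ℂ) * Complex.exp (Complex.I * (r * y : ℝ))‖ < 1 := by
      rw [norm_mul, mul_comm Complex.I, Complex.norm_exp_ofReal_mul_I, Complex.norm_real,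
        Real.norm_of_nonneg hρ0, mul_one]
      exact hρ1
    have h1 := (Complex.hasSum_re (Complex.hasSum_taylorSeries_neg_log' hz)).mul_left
      (planaKernel y)
    rw [Complex.neg_re, Complex.log_re] at h1
    change ∑' m, F m y = -(planaKernel y * Real.log _)
    rw [← mul_neg, ← h1.tsum_eq]
    refine tsum_congr fun m => ?_
    rw [hF]
    rw [mul_pow, ← Complex.exp_nat_mul,
      show ((m + 1 : ℕ) : ℂ) * (Complex.I * (r * y : ℝ)) =
        (((m + 1) * r * y : ℝ) : ℂ) * Complex.I by push_cast; ring,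
      show (ρ : ℂ) ^ (m + 1) * Complex.exp ((((m + 1) * r * y : ℝ) : ℂ) * Complex.I) / (m + 1) =
        ((ρ ^ (m + 1) / (m + 1) : ℝ) : ℂ) *
          Complex.exp ((((m + 1) * r * y : ℝ) : ℂ) * Complex.I) by push_cast; ring,
      Complex.re_ofReal_mul, Complex.exp_ofReal_mul_I_re]
  rw [e1, mul_neg, neg_mul, neg_neg] at h
  refine h.congr_fun fun m => ?_
  rw [powExpRem_one (by positivity), hF]
  simp_rw [mul_left_comm (planaKernel _)]
  rw [integral_const_mul]
  ring

lemma one_sub_exp_neg_le {t : ℝ} (ht : 0 ≤ t) : 1 - Real.exp (-t) ≤ t ^ (1 / 4 : ℝ) := by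
  rcases le_or_gt t 1 with h1 | h1
  · have := Real.add_one_le_exp (-t)
    have h2 : t ≤ t ^ (1 / 4 : ℝ) := by
      rcases ht.eq_or_lt with h0 | h0
      · rw [← h0]; positivity
      · simpa using Real.rpow_le_rpow_of_exponent_ge h0 h1 (show (1 / 4 : ℝ) ≤ 1 by norm_num)
    linarith
  · have := Real.one_le_rpow h1.le (show (0 : ℝ) ≤ 1 / 4 by norm_num)
    linarith [Real.exp_pos (-t)]

lemma logSeries_zero_asymp :
    ∃ C, 0 ≤ C ∧ ∀ r, 0 < r → r ≤ 1 →
      |logSeries 0 r - (zeta3 / r ^ 2 + Real.log r / 12 + 2 * cConst)| ≤ C * r := by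
  obtain ⟨C₁, hC₁⟩ := integral_planaKernel_log_norm
  obtain ⟨C₂, hC₂0, hC₂⟩ := powExpRem_bound (k := 1) le_rfl (α := 1 / 2) (by norm_num) (by norm_num)
  have hsum : Summable fun m : ℕ => ((m : ℝ) + 1) ^ (-(5 / 4) : ℝ) := by
    have := (summable_nat_add_iff 1).2
      (Real.summable_nat_rpow.2 (show (-(5 / 4) : ℝ) < -1 by norm_num))
    simpa using this
  set S := ∑' m : ℕ, ((m : ℝ) + 1) ^ (-(5 / 4) : ℝ) with hS
  have hS0 : 0 ≤ S := tsum_nonneg fun m => by positivity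
  refine ⟨C₂ * S + 2 * |C₁|, by positivity, fun r hr hr1 => ?_⟩
  set ρ := Real.exp (-r ^ 6) with hρ
  have hρ1 : ρ < 1 := by rw [hρ, Real.exp_lt_one_iff]; simp; positivity
  have h1 := hasSum_pow_mul_powExpRem_one hr (Real.exp_pos (-r ^ 6)).le hρ1
  have h2 := (hasSum_logSeries 0 hr).sub h1
  have h3 : ‖_‖ ≤ C₂ * r * S := h2.norm_le_of_bounded (hsum.hasSum.mul_left (C₂ * r)) fun m => by
    have hm : (0 : ℝ) < m + 1 := by positivity
    have e : ((m : ℝ) + 1) ^ 0 / (m + 1) * powExpRem (0 + 1) ((m + 1) * r) -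
        Real.exp (-r ^ 6) ^ (m + 1) / (m + 1) * powExpRem 1 ((m + 1) * r) =
        (1 - Real.exp (-((m + 1) * r ^ 6))) * powExpRem 1 ((m + 1) * r) / (m + 1) := by
      rw [← Real.exp_nat_mul]
      have : ((m + 1 : ℕ) : ℝ) * (-r ^ 6) = -((m + 1) * r ^ 6) := by push_cast; ring
      rw [this]; ring
    rw [e, norm_div, norm_mul, Real.norm_of_nonneg hm.le, Real.norm_of_nonneg (by
      have : Real.exp (-((m + 1) * r ^ 6)) ≤ 1 := Real.exp_le_one_iff.2 (by
        have : (0 : ℝ) ≤ (m + 1) * r ^ 6 := by positivity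
        linarith)
      linarith), Real.norm_eq_abs]
    have ha := one_sub_exp_neg_le (t := (m + 1) * r ^ 6) (by positivity)
    have hb := hC₂ ((m + 1) * r) (by positivity)
    calc _ ≤ ((m + 1) * r ^ 6) ^ (1 / 4 : ℝ) * (C₂ * ((m + 1) * r) ^ (-(1 / 2) : ℝ)) / (m + 1) := by
          gcongr
      _ = C₂ * r * ((m : ℝ) + 1) ^ (-(5 / 4) : ℝ) := by
          rw [Real.mul_rpow hm.le (by positivity), Real.mul_rpow hm.le hr.le,
            ← Real.rpow_natCast r 6, ← Real.rpow_mul hr.le]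
          have e1 : ((m : ℝ) + 1) ^ (-(5 / 4) : ℝ) = ((m : ℝ) + 1) ^ (1 / 4 : ℝ) *
              ((m : ℝ) + 1) ^ (-(1 / 2) : ℝ) / (m + 1) := by
            rw [← Real.rpow_add hm, ← Real.rpow_sub_one hm.ne']; norm_num
          have e2 : r ^ (((6 : ℕ) : ℝ) * (1 / 4)) * r ^ (-(1 / 2) : ℝ) = r := by
            rw [← Real.rpow_add hr]; norm_num
          rw [e1]
          linear_combination (C₂ * (((m : ℝ) + 1) ^ (1 / 4 : ℝ) *
            ((m : ℝ) + 1) ^ (-(1 / 2) : ℝ) / (m + 1))) * e2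
  have h4 := hC₁ r hr hr1
  rw [Real.norm_eq_abs] at h3
  have h5 : C₁ * r ≤ |C₁| * r := by gcongr; exact le_abs_self _
  simp only [Nat.factorial, zero_add, Nat.cast_one, one_mul, mul_one] at h3
  rw [abs_le] at h3 h4 ⊢
  constructor <;> nlinarith

end

lemma norm_cexp_sub_quadratic_le (x : ℝ) :
    ‖Complex.exp (-x * Complex.I) - 1 + x * Complex.I + x ^ 2 / 2‖ ≤ 4 * |x| ^ 3 := by
  rcases le_or_gt |x| 1 with hx | hx
  · have h := Complex.norm_exp_sub_sum_le_norm_mul_exp (-x * Complex.I) 3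
    simp only [Finset.sum_range_succ, Finset.sum_range_zero, Nat.factorial] at h
    have e : Complex.exp (-x * Complex.I) - 1 + x * Complex.I + x ^ 2 / 2 =
        Complex.exp (-x * Complex.I) - (0 + (-x * Complex.I) ^ 0 / ((1 : ℕ) : ℂ) +
          (-x * Complex.I) ^ 1 / (((0 + 1) * 1 : ℕ) : ℂ) +
          (-x * Complex.I) ^ 2 / (((1 + 1) * ((0 + 1) * 1) : ℕ) : ℂ)) := by
      push_cast
      linear_combination (x ^ 2 / 2 : ℂ) * Complex.I_sq
    rw [e]
    refine h.trans ?_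
    have h1 : ‖-(x : ℂ) * Complex.I‖ = |x| := by simp
    rw [h1, mul_comm]
    gcongr
    have := Real.exp_le_exp.2 hx
    linarith [Real.exp_one_lt_d9]
  · have h1 : ‖Complex.exp (-x * Complex.I)‖ = 1 := by
      simpa using Complex.norm_exp_ofReal_mul_I (-x)
    have h2 : ‖(x : ℂ) * Complex.I‖ = |x| := by simp
    have h3 : ‖(x : ℂ) ^ 2 / 2‖ = |x| ^ 2 / 2 := by simp
    have h4 := norm_add_le (Complex.exp (-x * Complex.I) - 1 + x * Complex.I) ((x : ℂ) ^ 2 / 2)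
    have h5 := norm_add_le (Complex.exp (-x * Complex.I) - 1) (x * Complex.I)
    have h6 := norm_sub_le (Complex.exp (-x * Complex.I)) 1
    rw [norm_one] at h6
    have h7 : 1 ≤ |x| ^ 2 := one_le_pow₀ hx.le
    nlinarith

lemma norm_logGen_taylor_le {r : ℝ} (hr : 0 < r) (θ : ℝ) :
    ‖logGen (r + θ * Complex.I) - logSeries 0 r + θ * logSeries 1 r * Complex.I +
      θ ^ 2 / 2 * logSeries 2 r‖ ≤ 4 * |θ| ^ 3 * logSeries 3 r := by
  have hj (j : ℕ) : HasSum (fun p : ℕ × ℕ =>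
      ((coeff p * freq p ^ j * Real.exp (-freq p * r) : ℝ) : ℂ)) (logSeries j r : ℂ) :=
    Complex.hasSum_ofReal.2 (summable_logSeries j hr).hasSum
  have h0 : HasSum (fun p : ℕ × ℕ => (coeff p : ℂ) * Complex.exp (-freq p * (r + θ * Complex.I)))
      (logGen (r + θ * Complex.I)) := (summable_logGen (by simpa using hr)).hasSum
  have h := ((h0.sub (hj 0)).add ((hj 1).mul_left (θ * Complex.I))).add
    ((hj 2).mul_left ((θ : ℂ) ^ 2 / 2))
  have h3 := (summable_logSeries 3 hr).hasSum.mul_left (4 * |θ| ^ 3)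
  have e : (θ : ℂ) * logSeries 1 r * Complex.I = θ * Complex.I * logSeries 1 r := by ring
  rw [e]
  refine h.norm_le_of_bounded h3 fun p => ?_
  have e2 : (coeff p : ℂ) * Complex.exp (-freq p * (r + θ * Complex.I)) -
        ((coeff p * freq p ^ 0 * Real.exp (-freq p * r) : ℝ) : ℂ) +
      θ * Complex.I * ((coeff p * freq p ^ 1 * Real.exp (-freq p * r) : ℝ) : ℂ) +
      (θ : ℂ) ^ 2 / 2 * ((coeff p * freq p ^ 2 * Real.exp (-freq p * r) : ℝ) : ℂ) =
      ((coeff p * Real.exp (-freq p * r) : ℝ) : ℂ) *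
        (Complex.exp (-(freq p * θ : ℝ) * Complex.I) - 1 + (freq p * θ : ℝ) * Complex.I +
          ((freq p * θ : ℝ) : ℂ) ^ 2 / 2) := by
    have : -(freq p : ℂ) * (r + θ * Complex.I) = -freq p * r + -(freq p * θ : ℝ) * Complex.I := by
      push_cast; ring
    rw [this, Complex.exp_add]
    push_cast
    ring
  have hc := coeff_pos p
  have hf := freq_pos p
  have he := Real.exp_pos (-freq p * r)
  rw [e2, norm_mul, Complex.norm_real, Real.norm_of_nonneg (by positivity)]
  have h4 := norm_cexp_sub_quadratic_le (freq p * θ)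
  rw [abs_mul, abs_of_pos hf] at h4
  calc _ ≤ coeff p * Real.exp (-freq p * r) * (4 * (freq p * |θ|) ^ 3) := by gcongr
    _ = _ := by ring

/-- The part of the double series of the derivative of the generating function with trivial second
index. -/
lemma hasSum_succ_mul_pow {q : ℂ} (hq : ‖q‖ < 1) :
    HasSum (fun m : ℕ => ((m : ℂ) + 1) * q ^ (m + 1)) (q / (1 - q) ^ 2) := by
  have h := hasSum_coe_mul_geometric_of_norm_lt_one hq
  rw [← hasSum_nat_add_iff' 1] at h
  simpa using h

lemma re_logGen_sub_le {r : ℝ} (hr : 0 < r) (θ : ℝ) :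
    (logGen (r + θ * Complex.I)).re - logSeries 0 r ≤
      ‖Complex.exp (-(r + θ * Complex.I)) / (1 - Complex.exp (-(r + θ * Complex.I))) ^ 2‖ -
        Real.exp (-r) / (1 - Real.exp (-r)) ^ 2 := by
  set z : ℂ := r + θ * Complex.I with hz
  have hzr : z.re = r := by simp [hz]
  have hq : ‖Complex.exp (-z)‖ = Real.exp (-r) := by rw [Complex.norm_exp]; simp [hzr]
  have hq1 : Real.exp (-r) < 1 := by rw [Real.exp_lt_one_iff]; linarith
  have h0 := Complex.hasSum_re (summable_logGen (z := z) (by rw [hzr]; exact hr)).hasSum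
  have h1 := (summable_logSeries 0 hr).hasSum
  have h2 := h0.sub h1
  have hterm (p : ℕ × ℕ) : ((coeff p : ℂ) * Complex.exp (-freq p * z)).re -
      coeff p * freq p ^ 0 * Real.exp (-freq p * r) ≤ 0 := by
    have := Complex.re_le_norm ((coeff p : ℂ) * Complex.exp (-freq p * z))
    rw [norm_logGen_term, hzr] at this
    linarith
  have hg1 := Complex.hasSum_re (hasSum_succ_mul_pow (q := Complex.exp (-z)) (by rw [hq]; exact hq1))
  have hg2 := Complex.hasSum_re (hasSum_succ_mul_pow (q := (Real.exp (-r) : ℂ)) (by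
    rw [Complex.norm_real, Real.norm_of_nonneg (Real.exp_pos _).le]; exact hq1))
  have hg := hg1.sub hg2
  have hinj : Function.Injective fun m : ℕ => ((m, 0) : ℕ × ℕ) := fun a b h => by simpa using h
  have hle := hasSum_le_inj _ hinj (fun p _ => neg_nonneg.2 (hterm p)) (fun m => le_of_eq ?_)
    hg.neg h2.neg
  rotate_left
  · rw [← Complex.exp_nat_mul, ← Complex.ofReal_pow, ← Real.exp_nat_mul]
    have e1 : ((m + 1 : ℕ) : ℂ) * -z = -((m + 1) * z) := by push_cast; ring
    have e2 : ((m + 1 : ℕ) : ℝ) * -r = -((m + 1) * r) := by push_cast; ring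
    have e3 : (m : ℂ) + 1 = ((m + 1 : ℝ) : ℂ) := by push_cast; ring
    rw [e1, e2, e3, Complex.re_ofReal_mul, Complex.re_ofReal_mul, Complex.ofReal_re]
    simp [coeff, freq, -Complex.ofReal_exp]
    ring_nf
  have h5 := Complex.re_le_norm (Complex.exp (-z) / (1 - Complex.exp (-z)) ^ 2)
  have e4 : ((Real.exp (-r) : ℂ) / (1 - (Real.exp (-r) : ℂ)) ^ 2).re =
      Real.exp (-r) / (1 - Real.exp (-r)) ^ 2 := by
    rw [← Complex.ofReal_re (Real.exp (-r) / (1 - Real.exp (-r)) ^ 2)]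
    push_cast
    rfl
  rw [e4] at hle
  simp only [logGen, logSeries]
  linarith

lemma re_logGen_sub_le_neg_rpow {r θ : ℝ} (hr : 0 < r) (hr1 : r ≤ 1 / 2)
    (hθ : r ^ (5 / 3 : ℝ) ≤ |θ|) (hθπ : |θ| ≤ π) :
    (logGen (r + θ * Complex.I)).re - logSeries 0 r ≤ -(r ^ (-(2 / 3) : ℝ) / 20) := by
  refine (re_logGen_sub_le hr θ).trans ?_
  set ρ := Real.exp (-r) with hρ
  have hρ0 : 0 < ρ := Real.exp_pos _
  have hρr : 1 - r ≤ ρ := by have := Real.add_one_le_exp (-r); linarith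
  have hρ1 : ρ < 1 := by rw [hρ, Real.exp_lt_one_iff]; linarith
  have hcos := Real.cos_le_one_sub_mul_cos_sq hθπ
  have hnorm : ‖1 - Complex.exp (-(r + θ * Complex.I))‖ ^ 2 =
      (1 - ρ) ^ 2 + 2 * ρ * (1 - Real.cos θ) := by
    have e : -((r : ℂ) + θ * Complex.I) = (-r : ℝ) + (-θ : ℝ) * Complex.I := by push_cast; ring
    rw [← Complex.normSq_eq_norm_sq, Complex.normSq_apply, e, Complex.sub_re, Complex.sub_im,
      Complex.exp_re, Complex.exp_im]
    simp only [Complex.add_re, Complex.add_im, Complex.ofReal_re, Complex.ofReal_im,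
      Complex.mul_re, Complex.mul_im, Complex.I_re, Complex.I_im, Complex.one_re, Complex.one_im,
      mul_zero, mul_one, sub_zero, add_zero, zero_add, Real.cos_neg, Real.sin_neg, ← hρ]
    linear_combination ρ ^ 2 * Real.sin_sq_add_cos_sq θ
  have hn2 : ‖Complex.exp (-((r : ℂ) + θ * Complex.I))‖ = ρ := by rw [Complex.norm_exp]; simp [hρ]
  rw [norm_div, norm_pow, hnorm, hn2]
  set Y := (r ^ (5 / 3 : ℝ)) ^ 2 / 5 with hY
  have hY0 : 0 < Y := by positivity
  have hYX : Y ≤ 2 * ρ * (1 - Real.cos θ) := by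
    have h1 : (r ^ (5 / 3 : ℝ)) ^ 2 ≤ θ ^ 2 := by
      rw [← sq_abs θ]; gcongr
    have h2 : 1 / 5 ≤ 2 / π ^ 2 := by
      rw [div_le_div_iff₀ (by norm_num) (by positivity)]
      nlinarith [Real.pi_lt_d2, Real.pi_pos]
    have h3 : 1 / 5 * θ ^ 2 ≤ 2 / π ^ 2 * θ ^ 2 := by gcongr
    have h4 : 0 ≤ 1 - Real.cos θ := by linarith [Real.cos_le_one θ]
    nlinarith
  have hYr : Y ≤ r ^ 2 := by
    have : r ^ (5 / 3 : ℝ) ≤ r := by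
      simpa using Real.rpow_le_rpow_of_exponent_ge hr (by linarith) (show (1 : ℝ) ≤ 5 / 3 by norm_num)
    have : (r ^ (5 / 3 : ℝ)) ^ 2 ≤ r ^ 2 := by gcongr
    have := sq_nonneg r
    rw [hY]; linarith
  have hs : 0 < (1 - ρ) ^ 2 := by have : 0 < 1 - ρ := by linarith
                                  positivity
  have hsr : (1 - ρ) ^ 2 ≤ r ^ 2 := by
    have : 0 ≤ 1 - ρ := by linarith
    gcongr
    linarith
  have h1 : ρ / ((1 - ρ) ^ 2 + 2 * ρ * (1 - Real.cos θ)) ≤ ρ / ((1 - ρ) ^ 2 + Y) := by gcongr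
  have h2 : ρ / ((1 - ρ) ^ 2 + Y) - ρ / (1 - ρ) ^ 2 = -(ρ * (Y / ((1 - ρ) ^ 2 * ((1 - ρ) ^ 2 + Y)))) := by
    generalize (1 - ρ) ^ 2 = S at hs
    field_simp
    ring
  have h3 : Y / (r ^ 2 * (r ^ 2 + r ^ 2)) ≤ Y / ((1 - ρ) ^ 2 * ((1 - ρ) ^ 2 + Y)) := by gcongr
  have h4 : (1 / 2) * (Y / (r ^ 2 * (r ^ 2 + r ^ 2))) ≤
      ρ * (Y / ((1 - ρ) ^ 2 * ((1 - ρ) ^ 2 + Y))) := by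
    gcongr; linarith
  have h5 : (1 / 2) * (Y / (r ^ 2 * (r ^ 2 + r ^ 2))) = r ^ (-(2 / 3) : ℝ) / 20 := by
    have : (r ^ (5 / 3 : ℝ)) ^ 2 = r ^ (-(2 / 3) : ℝ) * r ^ 4 := by
      rw [← Real.rpow_natCast r 4, ← Real.rpow_natCast _ 2, ← Real.rpow_mul hr.le,
        ← Real.rpow_add hr]
      norm_num
    rw [hY, this]
    field_simp
    norm_num
  linarith

lemma exp_neg_rpow_le {r : ℝ} (hr : 0 < r) (hr1 : r ≤ 1) :
    Real.exp (-(r ^ (-(2 / 3) : ℝ) / 20)) ≤ 120 * 20 ^ 5 * r ^ 3 := by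
  have h := Real.pow_div_factorial_le_exp (r ^ (-(2 / 3) : ℝ) / 20) (by positivity) 5
  rw [Real.exp_neg, inv_le_comm₀ (Real.exp_pos _) (by positivity)]
  refine le_trans ?_ h
  have e : (r ^ (-(2 / 3) : ℝ)) ^ 5 = r ^ (-(10 / 3) : ℝ) := by
    rw [← Real.rpow_natCast, ← Real.rpow_mul hr.le]; norm_num
  have e2 : (r ^ 3)⁻¹ ≤ r ^ (-(10 / 3) : ℝ) := by
    rw [← Real.rpow_natCast r 3, ← Real.rpow_neg hr.le]
    exact Real.rpow_le_rpow_of_exponent_ge hr hr1 (by norm_num)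
  rw [div_pow, e, mul_inv]
  have : ((Nat.factorial 5 : ℕ) : ℝ) = 120 := by norm_num [Nat.factorial]
  rw [this]
  linarith

lemma zeta3_pos : 0 < zeta3 := by
  have hs : Summable fun j : ℕ => 1 / ((j : ℝ) + 1) ^ 3 := by
    have := (summable_nat_add_iff 1).2 (Real.summable_one_div_nat_pow.2 (show 1 < 3 by norm_num))
    simpa using this
  exact hs.tsum_pos (fun j => by positivity) 0 (by norm_num)

/-- The exponent of the Cauchy integrand relative to its value at the saddle point, after the
scaling `θ = r ^ 2 * u`. -/
noncomputable def phase (r u : ℝ) : ℂ :=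
  logGen (r + (r ^ 2 * u : ℝ) * Complex.I) - logSeries 0 r +
    (2 * zeta3 / r ^ 3 * (r ^ 2 * u) : ℝ) * Complex.I

lemma norm_phase_add_le {η : ℝ} (hη : 0 < η) (hη1 : η < 1) :
    ∃ K, 0 ≤ K ∧ ∀ r u, 0 < r → r ≤ 1 → ‖phase r u + (3 * zeta3 * u ^ 2 : ℝ)‖ ≤
      K * (|u| * r ^ (1 - η) + |u| ^ 2 * r + |u| ^ 3 * r) := by
  obtain ⟨C₁, h10, h1⟩ := logSeries_bound 1 (α := 1 + η) (by push_cast; linarith)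
    (by push_cast; linarith)
  obtain ⟨C₂, h20, h2⟩ := logSeries_bound 2 (α := 3 - 1 / 2) (by norm_num) (by norm_num)
  obtain ⟨C₃, h30, h3⟩ := logSeries_bound 3 (α := 4 - 1 / 2) (by norm_num) (by norm_num)
  have hz := zeta3_pos
  refine ⟨C₁ + C₂ + 4 * (24 * zeta3 + C₃), by positivity, fun r u hr hr1 => ?_⟩
  replace h1 := h1 r hr
  replace h2 := h2 r hr
  replace h3 := h3 r hr
  norm_num [Nat.factorial] at h1 h2 h3
  have e : phase r u + (3 * zeta3 * u ^ 2 : ℝ) =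
      (logGen (r + (r ^ 2 * u : ℝ) * Complex.I) - logSeries 0 r +
        (r ^ 2 * u : ℝ) * logSeries 1 r * Complex.I +
        ((r ^ 2 * u : ℝ) : ℂ) ^ 2 / 2 * logSeries 2 r) -
      ((r ^ 2 * u * (logSeries 1 r - 2 * zeta3 / r ^ 3) : ℝ) : ℂ) * Complex.I -
      (((r ^ 2 * u) ^ 2 / 2 * (logSeries 2 r - 6 * zeta3 / r ^ 4) : ℝ) : ℂ) := by
    have : (3 * zeta3 * u ^ 2 : ℝ) = (r ^ 2 * u) ^ 2 / 2 * (6 * zeta3 / r ^ 4) := by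
      field_simp; ring
    rw [this, phase]
    push_cast
    ring
  have hT := norm_logGen_taylor_le hr (r ^ 2 * u)
  rw [e]
  refine (norm_sub_le _ _).trans ((add_le_add (norm_sub_le _ _) le_rfl).trans ?_)
  rw [norm_mul, Complex.norm_I, mul_one, Complex.norm_real, Complex.norm_real, Real.norm_eq_abs,
    Real.norm_eq_abs, abs_mul (r ^ 2 * u), abs_mul ((r ^ 2 * u) ^ 2 / 2),
    abs_of_nonneg (show 0 ≤ (r ^ 2 * u) ^ 2 / 2 by positivity)]
  have hu : |r ^ 2 * u| = r ^ 2 * |u| := by rw [abs_mul, abs_of_nonneg (by positivity)]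
  rw [hu] at hT ⊢
  have hinv (k : ℕ) : r⁻¹ ^ k = r ^ (-(k : ℝ)) := by
    rw [Real.rpow_neg hr.le, Real.rpow_natCast, inv_pow]
  have hD3 : logSeries 3 r ≤ (24 * zeta3 + C₃) * r⁻¹ ^ 5 := by
    have h4 := (abs_le.1 h3).2
    have h5 : r ^ (-(7 / 2) : ℝ) ≤ r⁻¹ ^ 5 := by
      rw [hinv]
      exact Real.rpow_le_rpow_of_exponent_ge hr hr1 (by norm_num)
    have h6 : C₃ * r ^ (-(7 / 2) : ℝ) ≤ C₃ * r⁻¹ ^ 5 := by gcongr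
    rw [div_eq_mul_inv, ← inv_pow] at h4
    linarith
  have b1 : 4 * (r ^ 2 * |u|) ^ 3 * logSeries 3 r ≤ 4 * (24 * zeta3 + C₃) * (|u| ^ 3 * r) := by
    calc _ ≤ 4 * (r ^ 2 * |u|) ^ 3 * ((24 * zeta3 + C₃) * r⁻¹ ^ 5) := by gcongr
      _ = _ := by field_simp
  have b2 : r ^ 2 * |u| * |logSeries 1 r - 2 * zeta3 / r ^ 3| ≤ C₁ * (|u| * r ^ (1 - η)) := by
    calc _ ≤ r ^ 2 * |u| * (C₁ * r ^ (-η + -1)) := by gcongr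
      _ = C₁ * (|u| * (r ^ 2 * r ^ (-η + -1))) := by ring
      _ = _ := by
        rw [← Real.rpow_natCast r 2, ← Real.rpow_add hr]
        norm_num
        left; left
        ring_nf
  have b3 : (r ^ 2 * u) ^ 2 / 2 * |logSeries 2 r - 6 * zeta3 / r ^ 4| ≤ C₂ * (|u| ^ 2 * r) := by
    have h5 : r ^ (-(5 / 2) : ℝ) ≤ r⁻¹ ^ 3 := by
      rw [hinv]
      exact Real.rpow_le_rpow_of_exponent_ge hr hr1 (by norm_num)
    calc _ ≤ (r ^ 2 * u) ^ 2 / 2 * (C₂ * r⁻¹ ^ 3) := by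
          gcongr
          exact h2.trans (by gcongr)
      _ = C₂ * (u ^ 2 * r) / 2 := by field_simp
      _ ≤ _ := by
        rw [sq_abs]
        have : 0 ≤ C₂ * (u ^ 2 * r) := by positivity
        linarith
  have p1 : 0 ≤ |u| * r ^ (1 - η) := by positivity
  have p2 : 0 ≤ |u| ^ 2 * r := by positivity
  have p3 : 0 ≤ |u| ^ 3 * r := by positivity
  set K₃ := 4 * (24 * zeta3 + C₃) with hK
  have hK0 : 0 ≤ K₃ := by positivity
  have : (C₁ + C₂ + K₃) * (|u| * r ^ (1 - η) + |u| ^ 2 * r + |u| ^ 3 * r) =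
    C₁ * (|u| * r ^ (1 - η)) + C₂ * (|u| ^ 2 * r) + K₃ * (|u| ^ 3 * r) +
    (C₁ * (|u| ^ 2 * r) + C₁ * (|u| ^ 3 * r) + C₂ * (|u| * r ^ (1 - η)) + C₂ * (|u| ^ 3 * r) +
      K₃ * (|u| * r ^ (1 - η)) + K₃ * (|u| ^ 2 * r)) := by ring
  rw [this]
  have : 0 ≤ C₁ * (|u| ^ 2 * r) + C₁ * (|u| ^ 3 * r) + C₂ * (|u| * r ^ (1 - η)) +
    C₂ * (|u| ^ 3 * r) + K₃ * (|u| * r ^ (1 - η)) + K₃ * (|u| ^ 2 * r) := by positivity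
  linarith

/-- The error of the Gaussian approximation at scale `1`. -/
noncomputable def gaussErr (u : ℝ) : ℝ :=
  (|u| + |u| ^ 2 + |u| ^ 3) * Real.exp (-(3 * zeta3 * u ^ 2))

lemma gaussErr_nonneg (u : ℝ) : 0 ≤ gaussErr u := by unfold gaussErr; positivity

lemma norm_exp_phase_sub_le {η : ℝ} (hη : 0 < η) (hη1 : η < 2 / 3) :
    ∃ K, 0 ≤ K ∧ ∀ r u, 0 < r → r ≤ 1 → |u| ≤ r ^ (-(1 / 3) : ℝ) →
      ‖Complex.exp (phase r u) - (Real.exp (-(3 * zeta3 * u ^ 2)) : ℝ)‖ ≤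
        K * r ^ (1 - η) * gaussErr u := by
  obtain ⟨K, hK0, hK⟩ := norm_phase_add_le hη (by linarith)
  refine ⟨K * Real.exp (3 * K), by positivity, fun r u hr hr1 hu => ?_⟩
  have h := hK r u hr hr1
  set W := phase r u + (3 * zeta3 * u ^ 2 : ℝ) with hW
  have e : Complex.exp (phase r u) - (Real.exp (-(3 * zeta3 * u ^ 2)) : ℝ) =
      (Real.exp (-(3 * zeta3 * u ^ 2)) : ℝ) * (Complex.exp W - 1) := by
    have : phase r u = W + (-(3 * zeta3 * u ^ 2) : ℝ) := by rw [hW]; push_cast; ring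
    rw [this, Complex.exp_add, Complex.ofReal_exp]
    ring
  have b1 : |u| * r ^ (1 - η) ≤ 1 := by
    calc _ ≤ r ^ (-(1 / 3) : ℝ) * r ^ (1 - η) := by gcongr
      _ = r ^ (-(1 / 3) + (1 - η)) := by rw [Real.rpow_add hr]
      _ ≤ 1 := Real.rpow_le_one hr.le hr1 (by linarith)
  have b2 : |u| ^ 2 * r ≤ 1 := by
    calc _ ≤ (r ^ (-(1 / 3) : ℝ)) ^ 2 * r := by gcongr
      _ = r ^ (1 / 3 : ℝ) := by
        rw [← Real.rpow_natCast, ← Real.rpow_mul hr.le, ← Real.rpow_add_one hr.ne']; norm_num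
      _ ≤ 1 := Real.rpow_le_one hr.le hr1 (by norm_num)
  have b3 : |u| ^ 3 * r ≤ 1 := by
    calc _ ≤ (r ^ (-(1 / 3) : ℝ)) ^ 3 * r := by gcongr
      _ = 1 := by
        rw [← Real.rpow_natCast, ← Real.rpow_mul hr.le, ← Real.rpow_add_one hr.ne']; norm_num
  have hW3 : ‖W‖ ≤ 3 * K := h.trans (by nlinarith)
  have hrη : r ≤ r ^ (1 - η) := by
    simpa using Real.rpow_le_rpow_of_exponent_ge hr hr1 (show 1 - η ≤ 1 by linarith)
  have hWQ : ‖W‖ ≤ K * (r ^ (1 - η) * (|u| + |u| ^ 2 + |u| ^ 3)) := by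
    refine h.trans ?_
    gcongr
    have p2 : |u| ^ 2 * r ≤ |u| ^ 2 * r ^ (1 - η) := by gcongr
    have p3 : |u| ^ 3 * r ≤ |u| ^ 3 * r ^ (1 - η) := by gcongr
    linarith
  have hexp : ‖Complex.exp W - 1‖ ≤ ‖W‖ * Real.exp ‖W‖ := by
    simpa using Complex.norm_exp_sub_sum_le_norm_mul_exp W 1
  rw [e, norm_mul, Complex.norm_real, Real.norm_of_nonneg (Real.exp_pos _).le]
  calc _ ≤ Real.exp (-(3 * zeta3 * u ^ 2)) *
        (K * (r ^ (1 - η) * (|u| + |u| ^ 2 + |u| ^ 3)) * Real.exp (3 * K)) := by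
        gcongr
        exact hexp.trans (by gcongr)
    _ = _ := by rw [gaussErr]; ring

lemma gauss_le_gaussErr {η r u : ℝ} (hη : 0 < η) (hr : 0 < r) (hr1 : r ≤ 1)
    (hu : r ^ (-(1 / 3) : ℝ) ≤ |u|) :
    Real.exp (-(3 * zeta3 * u ^ 2)) ≤ r ^ (1 - η) * gaussErr u := by
  have hrη : r ≤ r ^ (1 - η) := by
    simpa using Real.rpow_le_rpow_of_exponent_ge hr hr1 (show 1 - η ≤ 1 by linarith)
  have h1 : 1 ≤ r * |u| ^ 3 := by
    calc 1 = r * (r ^ (-(1 / 3) : ℝ)) ^ 3 := by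
          have : (r ^ (-(1 / 3) : ℝ)) ^ 3 = r⁻¹ := by
            rw [← Real.rpow_natCast, ← Real.rpow_mul hr.le, ← Real.rpow_neg_one]; norm_num
          rw [this, mul_inv_cancel₀ hr.ne']
      _ ≤ _ := by gcongr
  have h2 : 1 ≤ r ^ (1 - η) * (|u| + |u| ^ 2 + |u| ^ 3) := by
    refine h1.trans ?_
    gcongr
    have := abs_nonneg u
    have := sq_nonneg |u|
    linarith
  rw [gaussErr, ← mul_assoc]
  exact le_mul_of_one_le_left (Real.exp_pos _).le h2

lemma norm_exp_phase_le {r u : ℝ} (hr : 0 < r) (hr1 : r ≤ 1 / 2)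
    (hu : r ^ (-(1 / 3) : ℝ) ≤ |u|) (huπ : r ^ 2 * |u| ≤ π) :
    ‖Complex.exp (phase r u)‖ ≤ 120 * 20 ^ 5 * r ^ 3 := by
  have hab : |r ^ 2 * u| = r ^ 2 * |u| := by rw [abs_mul, abs_of_nonneg (by positivity)]
  have h := re_logGen_sub_le_neg_rpow (θ := r ^ 2 * u) hr hr1 (by
    rw [hab]
    calc r ^ (5 / 3 : ℝ) = r ^ 2 * r ^ (-(1 / 3) : ℝ) := by
          rw [← Real.rpow_natCast r 2, ← Real.rpow_add hr]; norm_num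
      _ ≤ _ := by gcongr) (by rw [hab]; exact huπ)
  rw [Complex.norm_exp]
  refine le_trans (Real.exp_le_exp.2 ?_) (exp_neg_rpow_le hr (by linarith))
  refine le_trans (le_of_eq ?_) h
  rw [phase, Complex.add_re, Complex.sub_re, Complex.re_ofReal_mul, Complex.I_re, Complex.ofReal_re]
  ring

lemma norm_exp_phase_sub_le_of_le {η : ℝ} (hη : 0 < η) (hη1 : η < 2 / 3) :
    ∃ K, 0 ≤ K ∧ ∀ r u, 0 < r → r ≤ 1 / 2 →
      ‖(if r ^ 2 * |u| ≤ π then Complex.exp (phase r u) else 0) -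
        (Real.exp (-(3 * zeta3 * u ^ 2)) : ℝ)‖ ≤
        K * r ^ (1 - η) * gaussErr u + if r ^ 2 * |u| ≤ π then K * r ^ 3 else 0 := by
  obtain ⟨K, hK0, hK⟩ := norm_exp_phase_sub_le hη hη1
  refine ⟨K + 120 * 20 ^ 5, by positivity, fun r u hr hr1 => ?_⟩
  have hg := gaussErr_nonneg u
  have hrη : 0 < r ^ (1 - η) := by positivity
  have hgn : ‖((Real.exp (-(3 * zeta3 * u ^ 2)) : ℝ) : ℂ)‖ = Real.exp (-(3 * zeta3 * u ^ 2)) := by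
    rw [Complex.norm_real, Real.norm_of_nonneg (Real.exp_pos _).le]
  rcases le_or_gt |u| (r ^ (-(1 / 3) : ℝ)) with hu | hu
  · have hπ : r ^ 2 * |u| ≤ π := by
      calc _ ≤ r ^ 2 * r ^ (-(1 / 3) : ℝ) := by gcongr
        _ = r ^ (5 / 3 : ℝ) := by rw [← Real.rpow_natCast r 2, ← Real.rpow_add hr]; norm_num
        _ ≤ 1 := Real.rpow_le_one hr.le (by linarith) (by norm_num)
        _ ≤ π := by linarith [Real.pi_gt_three]
    rw [if_pos hπ, if_pos hπ]
    refine (hK r u hr (by linarith) hu).trans ?_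
    have : 0 ≤ 120 * 20 ^ 5 * r ^ (1 - η) * gaussErr u := by positivity
    have : 0 ≤ (K + 120 * 20 ^ 5) * r ^ 3 := by positivity
    linarith
  · have h1 := gauss_le_gaussErr hη hr (by linarith) hu.le
    have h2 : r ^ (1 - η) * gaussErr u ≤ (K + 120 * 20 ^ 5) * r ^ (1 - η) * gaussErr u := by
      rw [mul_assoc]
      exact le_mul_of_one_le_left (by positivity) (by linarith)
    refine (norm_sub_le _ _).trans ?_
    rw [hgn]
    split_ifs with hπ
    · have h3 := norm_exp_phase_le hr hr1 hu.le hπ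
      have : 0 ≤ K * r ^ 3 := by positivity
      linarith
    · rw [norm_zero]; linarith

section

open MeasureTheory Set

lemma integrable_abs_pow_mul_gauss {b : ℝ} (hb : 0 < b) (k : ℕ) :
    Integrable fun u : ℝ => |u| ^ k * Real.exp (-(b * u ^ 2)) := by
  have h := (integrable_rpow_mul_exp_neg_mul_sq hb (s := k)
    (by linarith [(Nat.cast_nonneg k : (0 : ℝ) ≤ k)])).norm
  refine h.congr (Eventually.of_forall fun u => ?_)
  simp

lemma integrable_gaussErr : Integrable gaussErr := by
  have hb : 0 < 3 * zeta3 := by have := zeta3_pos; positivity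
  have h := ((integrable_abs_pow_mul_gauss hb 1).add (integrable_abs_pow_mul_gauss hb 2)).add
    (integrable_abs_pow_mul_gauss hb 3)
  refine h.congr (Eventually.of_forall fun u => ?_)
  simp only [gaussErr, Pi.add_apply]
  ring

lemma continuous_phase {r : ℝ} (hr : 0 < r) : Continuous (phase r) := by
  unfold phase
  refine ((Continuous.comp (continuous_logGen hr) (by fun_prop : Continuous fun u : ℝ => r ^ 2 * u)).sub
    continuous_const).add ?_
  fun_prop

lemma norm_integral_exp_phase_sub_le {η : ℝ} (hη : 0 < η) (hη1 : η < 2 / 3) :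
    ∃ C, 0 ≤ C ∧ ∀ r, 0 < r → r ≤ 1 / 2 →
      ‖(∫ u : ℝ, if r ^ 2 * |u| ≤ π then Complex.exp (phase r u) else 0) -
        (√(π / (3 * zeta3)) : ℝ)‖ ≤ C * r ^ (1 - η) := by
  obtain ⟨K, hK0, hK⟩ := norm_exp_phase_sub_le_of_le hη hη1
  have hI : 0 ≤ ∫ u, gaussErr u := integral_nonneg gaussErr_nonneg
  refine ⟨K * (∫ u, gaussErr u) + 2 * π * K, by positivity, fun r hr hr1 => ?_⟩
  have hb : 0 < 3 * zeta3 := by have := zeta3_pos; positivity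
  set f : ℝ → ℂ := fun u => if r ^ 2 * |u| ≤ π then Complex.exp (phase r u) else 0 with hf
  set g : ℝ → ℂ := fun u => (Real.exp (-(3 * zeta3 * u ^ 2)) : ℝ) with hg
  have hset : {u : ℝ | r ^ 2 * |u| ≤ π} = Icc (-(π / r ^ 2)) (π / r ^ 2) := by
    ext u
    rw [mem_ofPred_eq, mem_Icc, ← abs_le, le_div_iff₀ (by positivity), mul_comm]
  have hmeas : MeasurableSet {u : ℝ | r ^ 2 * |u| ≤ π} := by rw [hset]; exact measurableSet_Icc
  have hfm : Measurable f :=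
    Measurable.ite hmeas (continuous_phase hr).cexp.measurable measurable_const
  have hgi : Integrable g := by
    have := integrable_abs_pow_mul_gauss hb 0
    simp only [pow_zero, one_mul] at this
    exact this.ofReal
  have hgv : ∫ u, g u = (√(π / (3 * zeta3)) : ℝ) := by
    rw [← integral_gaussian, hg, integral_complex_ofReal]
    simp
  have hconst : (fun u : ℝ => if r ^ 2 * |u| ≤ π then K * r ^ 3 else 0) =
      {u : ℝ | r ^ 2 * |u| ≤ π}.indicator fun _ => K * r ^ 3 := by
    ext u; simp [indicator]
  have hci : Integrable fun u : ℝ => if r ^ 2 * |u| ≤ π then K * r ^ 3 else 0 := by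
    rw [hconst, integrable_indicator_iff hmeas, hset]
    exact integrableOn_const (by simp)
  have hcv : ∫ u : ℝ, (if r ^ 2 * |u| ≤ π then K * r ^ 3 else 0) = 2 * π * K * r := by
    rw [hconst, integral_indicator hmeas, hset, setIntegral_const, measureReal_def, Real.volume_Icc,
      ENNReal.toReal_ofReal (by
        have : 0 ≤ π / r ^ 2 := by positivity
        linarith), smul_eq_mul]
    field_simp
    ring
  have hbi : Integrable fun u => K * r ^ (1 - η) * gaussErr u +
      if r ^ 2 * |u| ≤ π then K * r ^ 3 else 0 := (integrable_gaussErr.const_mul _).add hci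
  have hdi : Integrable fun u => f u - g u :=
    hbi.mono' (hfm.aestronglyMeasurable.sub hgi.aestronglyMeasurable)
      (Eventually.of_forall fun u => hK r u hr hr1)
  have hfi : Integrable f := by
    refine (hdi.add hgi).congr (Eventually.of_forall fun u => ?_)
    simp
  rw [← hgv, ← integral_sub hfi hgi]
  refine (norm_integral_le_of_norm_le hbi (Eventually.of_forall fun u => hK r u hr hr1)).trans ?_
  rw [integral_add (integrable_gaussErr.const_mul _) hci, integral_const_mul, hcv]
  have hrη : r ≤ r ^ (1 - η) := by
    simpa using Real.rpow_le_rpow_of_exponent_ge hr (by linarith) (show 1 - η ≤ 1 by linarith)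
  have : 2 * π * K * r ≤ 2 * π * K * r ^ (1 - η) := by gcongr
  linarith

lemma ppCount_eq_phase {n : ℕ} {r : ℝ} (hr : 0 < r) (hn : (n : ℝ) = 2 * zeta3 / r ^ 3) :
    (2 * π * ppCount n : ℂ) = (Real.exp (logSeries 0 r + n * r) * r ^ 2 : ℝ) *
      ∫ u : ℝ, if r ^ 2 * |u| ≤ π then Complex.exp (phase r u) else 0 := by
  rw [ppCount_eq_integral n hr]
  set f : ℝ → ℂ := fun u => if r ^ 2 * |u| ≤ π then Complex.exp (phase r u) else 0 with hf
  have h1 := Measure.integral_comp_div f (r ^ 2)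
  rw [abs_of_pos (by positivity), Complex.real_smul] at h1
  rw [Complex.ofReal_mul, mul_assoc, ← h1, intervalIntegral.integral_of_le (by linarith [Real.pi_pos]),
    ← integral_Icc_eq_integral_Ioc, ← integral_const_mul, ← integral_indicator measurableSet_Icc]
  refine integral_congr_ae (Eventually.of_forall fun θ => ?_)
  have hθ : r ^ 2 * |θ / r ^ 2| = |θ| := by
    rw [abs_div, abs_of_pos (show 0 < r ^ 2 by positivity)]; field_simp
  have hθ2 : r ^ 2 * (θ / r ^ 2) = θ := by field_simp
  simp only [hf, hθ, indicator, mem_Icc, ← abs_le]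
  split_ifs
  · rw [Complex.ofReal_exp, ← Complex.exp_add, phase, hθ2, ← hn]
    congr 1
    push_cast
    ring
  · simp

lemma ppCount_asymp {η : ℝ} (hη : 0 < η) (hη1 : η < 2 / 3) :
    ∃ C, 0 ≤ C ∧ ∀ (n : ℕ) (r : ℝ), 0 < r → r ≤ 1 / 2 → (n : ℝ) = 2 * zeta3 / r ^ 3 →
      |ppCount n / (Real.exp (logSeries 0 r + n * r) * r ^ 2 / (2 * √(3 * π * zeta3))) - 1| ≤
        C * r ^ (1 - η) := by
  obtain ⟨C, hC0, hC⟩ := norm_integral_exp_phase_sub_le hη hη1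
  have hz := zeta3_pos
  set s := √(π / (3 * zeta3)) with hs
  have hs0 : 0 < s := Real.sqrt_pos.2 (by positivity)
  refine ⟨C / s, by positivity, fun n r hr hr1 hn => ?_⟩
  have h1 := ppCount_eq_phase hr hn
  have h2 := hC r hr hr1
  set J := ∫ u : ℝ, if r ^ 2 * |u| ≤ π then Complex.exp (phase r u) else 0 with hJ
  set M := Real.exp (logSeries 0 r + n * r) * r ^ 2 with hM
  have hM0 : 0 < M := by positivity
  have hJM : J = (2 * π * ppCount n / M : ℝ) := by
    have : (M : ℂ) ≠ 0 := by exact_mod_cast hM0.ne'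
    push_cast
    rw [h1]
    field_simp
  rw [hJM, ← Complex.ofReal_sub, Complex.norm_real, Real.norm_eq_abs] at h2
  have hsq : 2 * √(3 * π * zeta3) = 2 * π / s := by
    have : s * √(3 * π * zeta3) = π := by
      rw [hs, ← Real.sqrt_mul (by positivity),
        show π / (3 * zeta3) * (3 * π * zeta3) = π ^ 2 by field_simp, Real.sqrt_sq Real.pi_pos.le]
    field_simp
    linarith
  have e : ppCount n / (M / (2 * √(3 * π * zeta3))) - 1 = (2 * π * ppCount n / M - s) / s := by
    rw [hsq]; field_simp
  rw [e, abs_div, abs_of_pos hs0, div_mul_eq_mul_div]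
  gcongr

end

/-- The main term of the asymptotic expansion. -/
noncomputable def mainTerm (x : ℝ) : ℝ :=
  zeta3 ^ ((7 : ℝ) / 36) / (2 ^ ((11 : ℝ) / 36) * 3 ^ ((1 : ℝ) / 2) * π ^ ((1 : ℝ) / 2)) *
    Real.exp (2 * cConst) * x ^ (-(25 : ℝ) / 36) *
    Real.exp (3 * zeta3 ^ ((1 : ℝ) / 3) * (x / 2) ^ ((2 : ℝ) / 3))

lemma mainTerm_pos {x : ℝ} (hx : 0 < x) : 0 < mainTerm x := by
  have := zeta3_pos
  unfold mainTerm
  positivity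

lemma mainTerm_eq {r x : ℝ} (hr : 0 < r) (hx : x = 2 * zeta3 / r ^ 3) :
    mainTerm x = Real.exp (zeta3 / r ^ 2 + Real.log r / 12 + 2 * cConst + x * r) * r ^ 2 /
      (2 * √(3 * π * zeta3)) := by
  have hz := zeta3_pos
  have h1 : x ^ (-(25 : ℝ) / 36) = 2 ^ (-(25 : ℝ) / 36) * zeta3 ^ (-(25 : ℝ) / 36) *
      (r ^ (1 / 12 : ℝ) * r ^ 2) := by
    have : (r ^ 3) ^ (-(25 : ℝ) / 36) = (r ^ (1 / 12 : ℝ) * r ^ 2)⁻¹ := by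
      rw [← Real.rpow_natCast r 3, ← Real.rpow_natCast r 2, ← Real.rpow_mul hr.le,
        ← Real.rpow_add hr, ← Real.rpow_neg hr.le]
      norm_num
    rw [hx, Real.div_rpow (by positivity) (by positivity), Real.mul_rpow (by norm_num) hz.le, this,
      div_inv_eq_mul]
  have h2 : 3 * zeta3 ^ ((1 : ℝ) / 3) * (x / 2) ^ ((2 : ℝ) / 3) = zeta3 / r ^ 2 + x * r := by
    have e1 : (r ^ 3) ^ ((2 : ℝ) / 3) = r ^ 2 := by
      rw [← Real.rpow_natCast r 3, ← Real.rpow_natCast r 2, ← Real.rpow_mul hr.le]; norm_num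
    have e2 : zeta3 ^ ((1 : ℝ) / 3) * zeta3 ^ ((2 : ℝ) / 3) = zeta3 := by
      rw [← Real.rpow_add hz]; norm_num
    rw [hx, show 2 * zeta3 / r ^ 3 / 2 = zeta3 / r ^ 3 by ring, Real.div_rpow hz.le (by positivity),
      e1]
    calc _ = 3 * (zeta3 ^ ((1 : ℝ) / 3) * zeta3 ^ ((2 : ℝ) / 3)) / r ^ 2 := by ring
      _ = _ := by rw [e2]; field_simp; ring
  have h3 : Real.exp (Real.log r / 12) = r ^ (1 / 12 : ℝ) := by
    rw [Real.rpow_def_of_pos hr]; ring_nf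
  have h4 : √(3 * π * zeta3) = 3 ^ ((1 : ℝ) / 2) * π ^ ((1 : ℝ) / 2) * zeta3 ^ ((1 : ℝ) / 2) := by
    rw [Real.sqrt_eq_rpow, Real.mul_rpow (by positivity) hz.le, Real.mul_rpow (by norm_num)
      Real.pi_pos.le]
  have h5 : (2 : ℝ) ^ (-(25 : ℝ) / 36) * 2 = 2 ^ ((11 : ℝ) / 36) := by
    rw [← Real.rpow_add_one (by norm_num)]; norm_num
  have h6 : zeta3 ^ ((7 : ℝ) / 36) * zeta3 ^ (-(25 : ℝ) / 36) * zeta3 ^ ((1 : ℝ) / 2) = 1 := by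
    rw [← Real.rpow_add hz, ← Real.rpow_add hz]; norm_num
  have h7 : Real.exp (zeta3 / r ^ 2 + Real.log r / 12 + 2 * cConst + x * r) =
      Real.exp (zeta3 / r ^ 2 + x * r) * r ^ (1 / 12 : ℝ) * Real.exp (2 * cConst) := by
    rw [← h3, ← Real.exp_add, ← Real.exp_add]; ring_nf
  rw [mainTerm, h1, h2, h4, h7, ← h5]
  have p1 : (0 : ℝ) < 3 ^ ((1 : ℝ) / 2) := by positivity
  have p2 : (0 : ℝ) < π ^ ((1 : ℝ) / 2) := by positivity
  have p3 : (0 : ℝ) < zeta3 ^ ((1 : ℝ) / 2) := by positivity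
  have p4 : (0 : ℝ) < 2 ^ (-(25 : ℝ) / 36) := by positivity
  rw [neg_div] at h6
  field_simp
  linear_combination h6

lemma abs_ppCount_div_mainTerm_sub_one_le {η : ℝ} (hη : 0 < η) (hη1 : η < 2 / 3) :
    ∃ C, 0 ≤ C ∧ ∀ (n : ℕ) (r : ℝ), 0 < r → r ≤ 1 / 2 → (n : ℝ) = 2 * zeta3 / r ^ 3 →
      |ppCount n / mainTerm n - 1| ≤ C * r ^ (1 - η) := by
  obtain ⟨C₁, h10, h1⟩ := ppCount_asymp hη hη1
  obtain ⟨C₂, h20, h2⟩ := logSeries_zero_asymp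
  refine ⟨C₁ + C₂ * Real.exp C₂ + C₁ * (C₂ * Real.exp C₂), by positivity,
    fun n r hr hr1 hn => ?_⟩
  have hz := zeta3_pos
  have a1 := h1 n r hr hr1 hn
  have a2 := h2 r hr (by linarith)
  set δ := logSeries 0 r - (zeta3 / r ^ 2 + Real.log r / 12 + 2 * cConst) with hδ
  set M := Real.exp (logSeries 0 r + n * r) * r ^ 2 / (2 * √(3 * π * zeta3)) with hM
  have hs : 0 < √(3 * π * zeta3) := Real.sqrt_pos.2 (by have := Real.pi_pos; positivity)
  have hM0 : 0 < M := by positivity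
  have hMm : M = mainTerm n * Real.exp δ := by
    rw [mainTerm_eq hr hn, hM, show logSeries 0 r + n * r = zeta3 / r ^ 2 + Real.log r / 12 +
      2 * cConst + n * r + δ by rw [hδ]; ring, Real.exp_add]
    ring
  have hm0 : 0 < mainTerm n := mainTerm_pos (by rw [hn]; positivity)
  have b : |Real.exp δ - 1| ≤ C₂ * Real.exp C₂ * r := by
    have h := Complex.norm_exp_sub_sum_le_norm_mul_exp (δ : ℂ) 1
    simp only [Finset.range_one, Finset.sum_singleton, pow_zero, Nat.factorial_zero, Nat.cast_one,
      div_one, pow_one, Complex.norm_real, Real.norm_eq_abs, ← Complex.ofReal_exp] at h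
    rw [← Complex.ofReal_one, ← Complex.ofReal_sub, Complex.norm_real, Real.norm_eq_abs] at h
    have h3 : |δ| ≤ C₂ := a2.trans (by nlinarith)
    calc _ ≤ |δ| * Real.exp |δ| := h
      _ ≤ C₂ * r * Real.exp C₂ := by gcongr
      _ = _ := by ring
  have hrη : r ≤ r ^ (1 - η) := by
    simpa using Real.rpow_le_rpow_of_exponent_ge hr (by linarith) (show 1 - η ≤ 1 by linarith)
  set t := r ^ (1 - η) with ht
  have ht0 : 0 < t := by positivity
  have e : ppCount n / mainTerm n - 1 =
      (ppCount n / M - 1) + (Real.exp δ - 1) + (ppCount n / M - 1) * (Real.exp δ - 1) := by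
    rw [hMm]
    field_simp
    ring
  rw [e]
  set B := C₂ * Real.exp C₂ with hB
  have hB0 : 0 ≤ B := by positivity
  have b1 : |Real.exp δ - 1| ≤ B * t := b.trans (by gcongr)
  have b2 : |Real.exp δ - 1| ≤ B := b.trans (by nlinarith)
  refine (abs_add_le _ _).trans ((add_le_add (abs_add_le _ _) le_rfl).trans ?_)
  rw [abs_mul]
  have b3 : |ppCount n / M - 1| * |Real.exp δ - 1| ≤ C₁ * t * B := by gcongr
  linarith

end PlanePartition


open PlanePartition in
theorem plane_partition_asymptotics_with_error (ε₁ : ℝ) (hε₁ : 0 < ε₁) (hε₁' : ε₁ < 1 / 3) :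
    ∃ E : ℕ → ℝ,
      (∀ n : ℕ, (planePartitionCount n : ℝ) =
          zeta3 ^ ((7 : ℝ) / 36) / (2 ^ ((11 : ℝ) / 36) * 3 ^ ((1 : ℝ) / 2) * π ^ ((1 : ℝ) / 2)) *
            Real.exp (2 * cConst) * (n : ℝ) ^ (-(25 : ℝ) / 36) *
            Real.exp (3 * zeta3 ^ ((1 : ℝ) / 3) * ((n : ℝ) / 2) ^ ((2 : ℝ) / 3)) * (1 + E n)) ∧
      E =O[atTop] fun n : ℕ => (n : ℝ) ^ (-(1 / 3 - ε₁)) := by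
  have hz := zeta3_pos
  refine ⟨fun n => ppCount n / mainTerm n - 1, fun n => ?_, ?_⟩
  · change (planePartitionCount n : ℝ) = mainTerm n * (1 + (ppCount n / mainTerm n - 1))
    rcases eq_or_ne n 0 with rfl | hn
    · rw [planePartitionCount_zero]
      norm_num [mainTerm]
    · have := mainTerm_pos (x := n) (by positivity)
      rw [planePartitionCount_eq hn]
      field_simp
      ring
  · obtain ⟨C, hC0, hC⟩ := abs_ppCount_div_mainTerm_sub_one_le (η := 3 * ε₁ / 2) (by positivity)
      (by linarith)
    refine IsBigO.of_bound (C * (2 * zeta3) ^ ((1 - 3 * ε₁ / 2) / 3)) ?_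
    filter_upwards [eventually_ge_atTop ⌈16 * zeta3⌉₊, eventually_ge_atTop 1] with n hn hn1
    have hn' : 16 * zeta3 ≤ n := (Nat.le_ceil _).trans (by exact_mod_cast hn)
    have hn1' : (1 : ℝ) ≤ n := by exact_mod_cast hn1
    have hn0 : (0 : ℝ) < n := by linarith
    have hq : 0 < 2 * zeta3 / n := by positivity
    set r := (2 * zeta3 / n) ^ ((1 : ℝ) / 3) with hr
    have hr0 : 0 < r := by positivity
    have hr3 : r ^ 3 = 2 * zeta3 / n := by
      rw [hr, ← Real.rpow_natCast, ← Real.rpow_mul hq.le]; norm_num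
    have hr1 : r ≤ 1 / 2 := by
      refine le_of_pow_le_pow_left₀ (n := 3) (by norm_num) (by norm_num) ?_
      rw [hr3, div_le_iff₀ hn0]
      linarith
    have h := hC n r hr0 hr1 (by rw [hr3]; field_simp)
    rw [Real.norm_eq_abs, Real.norm_of_nonneg (by positivity)]
    refine h.trans ?_
    rw [mul_assoc]
    gcongr
    rw [hr, ← Real.rpow_mul hq.le, Real.div_rpow (by positivity) hn0.le, div_eq_mul_inv,
      ← Real.rpow_neg hn0.le, one_div_mul_eq_div]
    gcongr
    linarith
end

section
/- The generating function of plane partitions satisfies the identity 1 + Σ_{n=1}^∞ q(n) x^n = ∏_{j=1}^∞ (1 − x^j)^{−j}, as an identity of formal power series (equivalently, for all complex x with |x| < 1). -/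
open Real Filter

/-- The growth array of a plane partition: its boundary slices `i = 0` and `j = 0` are the diagonals
of `ω`, and the remaining slices are obtained by toggling. -/
def diagonalGrowth (ω : ℕ → ℕ → ℕ) : ℕ → ℕ → ℕ → ℕ
  | 0, j, k => ω k (j + k)
  | i + 1, 0, k => ω (i + 1 + k) k
  | i + 1, j + 1, k =>
    min (diagonalGrowth ω i (j + 1) k) (diagonalGrowth ω (i + 1) j k) +
      max (diagonalGrowth ω i (j + 1) (k + 1)) (diagonalGrowth ω (i + 1) j (k + 1)) -
      diagonalGrowth ω i j (k + 1)

/-- Arrays of sequences `L i j` in which neighbouring sequences interlace and each unit square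
satisfies the local toggle rule. -/
structure IsGrowth (L : ℕ → ℕ → ℕ → ℕ) : Prop where
  succ_le_fst : ∀ i j k, L (i + 1) j k ≤ L i j k
  le_succ_fst : ∀ i j k, L i j (k + 1) ≤ L (i + 1) j k
  succ_le_snd : ∀ i j k, L i (j + 1) k ≤ L i j k
  le_succ_snd : ∀ i j k, L i j (k + 1) ≤ L i (j + 1) k
  rule : ∀ i j k, L (i + 1) (j + 1) k + L i j (k + 1) =
    min (L i (j + 1) k) (L (i + 1) j k) + max (L i (j + 1) (k + 1)) (L (i + 1) j (k + 1))

lemma isGrowth_diagonalGrowth {ω : ℕ → ℕ → ℕ} (h₁ : ∀ i j, ω (i + 1) j ≤ ω i j)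
    (h₂ : ∀ i j, ω i (j + 1) ≤ ω i j) : IsGrowth (diagonalGrowth ω) := by
  set L := diagonalGrowth ω with hL
  have hrow : ∀ i, (∀ j k, L i (j + 1) k ≤ L i j k ∧ L i j (k + 1) ≤ L i (j + 1) k) →
      ∀ j, ∀ k, L (i + 1) j k ≤ L i j k ∧ L i j (k + 1) ≤ L (i + 1) j k := by
    intro i hi j
    induction j with
    | zero =>
      intro k
      cases i with
      | zero =>
        simp only [hL, diagonalGrowth, zero_add]
        rw [add_comm 1 k]
        exact ⟨h₁ _ _, h₂ _ _⟩
      | succ i =>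
        simp only [hL, diagonalGrowth]
        rw [show i + 1 + 1 + k = i + 1 + k + 1 by ring,
          show i + 1 + (k + 1) = i + 1 + k + 1 by ring]
        exact ⟨h₁ _ _, h₂ _ _⟩
    | succ j ih =>
      intro k
      have e : L (i + 1) (j + 1) k = min (L i (j + 1) k) (L (i + 1) j k) +
          max (L i (j + 1) (k + 1)) (L (i + 1) j (k + 1)) - L i j (k + 1) := by
        simp only [hL, diagonalGrowth]
      have := ih k; have := ih (k + 1); have := hi j k; have := hi j (k + 1)
      omega
  have hcol : ∀ i, ∀ j k, L i (j + 1) k ≤ L i j k ∧ L i j (k + 1) ≤ L i (j + 1) k := by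
    intro i
    induction i with
    | zero =>
      intro j k
      simp only [hL, diagonalGrowth]
      rw [show j + 1 + k = j + k + 1 by ring, show j + (k + 1) = j + k + 1 by ring]
      exact ⟨h₂ _ _, h₁ _ _⟩
    | succ i ih =>
      intro j k
      have e : L (i + 1) (j + 1) k = min (L i (j + 1) k) (L (i + 1) j k) +
          max (L i (j + 1) (k + 1)) (L (i + 1) j (k + 1)) - L i j (k + 1) := by
        simp only [hL, diagonalGrowth]
      have := hrow i ih j k; have := hrow i ih j (k + 1); have := ih j k; have := ih j (k + 1)
      omega
  refine ⟨fun i j k ↦ (hrow i (hcol i) j k).1, fun i j k ↦ (hrow i (hcol i) j k).2,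
    fun i j k ↦ (hcol i j k).1, fun i j k ↦ (hcol i j k).2, fun i j k ↦ ?_⟩
  have e : L (i + 1) (j + 1) k = min (L i (j + 1) k) (L (i + 1) j k) +
      max (L i (j + 1) (k + 1)) (L (i + 1) j (k + 1)) - L i j (k + 1) := by
    simp only [hL, diagonalGrowth]
  have := hrow i (hcol i) j k; have := hcol i j k
  omega

/-- The growth array with local increments `a`, for a matrix `a` supported in the box `N × N`. -/
def matrixGrowth (N : ℕ) (a : ℕ → ℕ → ℕ) (i j k : ℕ) : ℕ :=
  if i < N ∧ j < N then
    match k with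
    | 0 => a i j + max (matrixGrowth N a i (j + 1) 0) (matrixGrowth N a (i + 1) j 0)
    | k + 1 => min (matrixGrowth N a i (j + 1) k) (matrixGrowth N a (i + 1) j k) +
        max (matrixGrowth N a i (j + 1) (k + 1)) (matrixGrowth N a (i + 1) j (k + 1)) -
        matrixGrowth N a (i + 1) (j + 1) k
  else 0
termination_by (N - i) + (N - j)

lemma matrixGrowth_eq_zero {N : ℕ} {a : ℕ → ℕ → ℕ} {i j : ℕ} (k : ℕ) (h : N ≤ i ∨ N ≤ j) :
    matrixGrowth N a i j k = 0 := by
  rw [matrixGrowth.eq_def, if_neg (by omega)]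

lemma matrixGrowth_zero {N : ℕ} {a : ℕ → ℕ → ℕ} (ha : ∀ i j, N ≤ i ∨ N ≤ j → a i j = 0)
    (i j : ℕ) : matrixGrowth N a i j 0 =
      a i j + max (matrixGrowth N a i (j + 1) 0) (matrixGrowth N a (i + 1) j 0) := by
  by_cases h : i < N ∧ j < N
  · rw [matrixGrowth.eq_def, if_pos h]
  · have h' : N ≤ i ∨ N ≤ j := by omega
    rw [matrixGrowth_eq_zero _ h', matrixGrowth_eq_zero (j := j + 1) _ (by omega),
      matrixGrowth_eq_zero (i := i + 1) _ (by omega), ha i j h']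
    rfl

lemma matrixGrowth_succ (N : ℕ) (a : ℕ → ℕ → ℕ) (i j k : ℕ) : matrixGrowth N a i j (k + 1) =
    min (matrixGrowth N a i (j + 1) k) (matrixGrowth N a (i + 1) j k) +
      max (matrixGrowth N a i (j + 1) (k + 1)) (matrixGrowth N a (i + 1) j (k + 1)) -
      matrixGrowth N a (i + 1) (j + 1) k := by
  by_cases h : i < N ∧ j < N
  · rw [matrixGrowth.eq_def, if_pos h]
  · have h' : N ≤ i ∨ N ≤ j := by omega
    simp only [matrixGrowth_eq_zero (i := i) (j := j) _ h',
      matrixGrowth_eq_zero (i := i) (j := j + 1) (N := N) _ (by omega),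
      matrixGrowth_eq_zero (i := i + 1) (j := j) (N := N) _ (by omega)]
    simp

lemma isGrowth_matrixGrowth {N : ℕ} {a : ℕ → ℕ → ℕ} (ha : ∀ i j, N ≤ i ∨ N ≤ j → a i j = 0) :
    IsGrowth (matrixGrowth N a) := by
  have key : ∀ m i j, (N - i) + (N - j) ≤ m → ∀ k,
      (matrixGrowth N a (i + 1) j k ≤ matrixGrowth N a i j k ∧
        matrixGrowth N a i j (k + 1) ≤ matrixGrowth N a (i + 1) j k) ∧
      (matrixGrowth N a i (j + 1) k ≤ matrixGrowth N a i j k ∧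
        matrixGrowth N a i j (k + 1) ≤ matrixGrowth N a i (j + 1) k) := by
    intro m
    induction m with
    | zero =>
      intro i j h k
      simp only [matrixGrowth_eq_zero (i := i) (j := j) (N := N) _ (by omega),
        matrixGrowth_eq_zero (i := i) (j := j + 1) (N := N) _ (by omega),
        matrixGrowth_eq_zero (i := i + 1) (j := j) (N := N) _ (by omega)]
      simp
    | succ m ih =>
      intro i j h k
      by_cases hij : i < N ∧ j < N
      · have h1 := ih (i + 1) j (by omega)
        have h2 := ih i (j + 1) (by omega)
        have := h1 k; have := h2 k
        have := matrixGrowth_succ N a i j k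
        cases k with
        | zero =>
          have := matrixGrowth_zero ha i j
          omega
        | succ k =>
          have := matrixGrowth_succ N a i j k
          have := h1 k; have := h2 k
          omega
      · simp only [matrixGrowth_eq_zero (i := i) (j := j) (N := N) _ (by omega),
          matrixGrowth_eq_zero (i := i) (j := j + 1) (N := N) _ (by omega),
          matrixGrowth_eq_zero (i := i + 1) (j := j) (N := N) _ (by omega)]
        simp
  refine ⟨fun i j k ↦ (key _ i j le_rfl k).1.1, fun i j k ↦ (key _ i j le_rfl k).1.2,
    fun i j k ↦ (key _ i j le_rfl k).2.1, fun i j k ↦ (key _ i j le_rfl k).2.2, fun i j k ↦ ?_⟩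
  have := matrixGrowth_succ N a i j k
  have := key _ (i + 1) j le_rfl k
  have := key _ i (j + 1) le_rfl k
  omega

namespace IsGrowth

variable {L L' : ℕ → ℕ → ℕ → ℕ}

lemma le_zero_fst (h : IsGrowth L) (i j k : ℕ) : L i j k ≤ L 0 j k := by
  induction i with
  | zero => rfl
  | succ i ih => exact (h.succ_le_fst i j k).trans ih

lemma le_zero_snd (h : IsGrowth L) (i j k : ℕ) : L i j k ≤ L i 0 k := by
  induction j with
  | zero => rfl
  | succ j ih => exact (h.succ_le_snd i j k).trans ih

lemma le_add_fst (h : IsGrowth L) (i j k : ℕ) : L i j k ≤ L (i + k) j 0 := by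
  induction k generalizing i with
  | zero => rfl
  | succ k ih =>
    rw [show i + (k + 1) = i + 1 + k by ring]
    exact (h.le_succ_fst i j k).trans (ih _)

lemma le_add_snd (h : IsGrowth L) (i j k : ℕ) : L i j k ≤ L i (j + k) 0 := by
  induction k generalizing j with
  | zero => rfl
  | succ k ih =>
    rw [show j + (k + 1) = j + 1 + k by ring]
    exact (h.le_succ_snd i j k).trans (ih _)

/-- A growth array is determined by its matrix of local increments. -/
lemma ext_of_increment (h : IsGrowth L) (h' : IsGrowth L') {N : ℕ}
    (hN : ∀ i j k, N ≤ i ∨ N ≤ j → L i j k = 0) (hN' : ∀ i j k, N ≤ i ∨ N ≤ j → L' i j k = 0)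
    (ha : ∀ i j, L i j 0 - max (L i (j + 1) 0) (L (i + 1) j 0) =
      L' i j 0 - max (L' i (j + 1) 0) (L' (i + 1) j 0)) : L = L' := by
  have key : ∀ m i j, (N - i) + (N - j) ≤ m → ∀ k, L i j k = L' i j k := by
    intro m
    induction m with
    | zero =>
      intro i j hm k
      rw [hN _ _ _ (by omega), hN' _ _ _ (by omega)]
    | succ m ih =>
      intro i j hm k
      by_cases hij : i < N ∧ j < N
      · have h1 := ih (i + 1) j (by omega)
        have h2 := ih i (j + 1) (by omega)
        have h3 := ih (i + 1) (j + 1) (by omega)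
        cases k with
        | zero =>
          have := ha i j
          have := h1 0; have := h2 0
          have := h.succ_le_fst i j 0; have := h.succ_le_snd i j 0
          have := h'.succ_le_fst i j 0; have := h'.succ_le_snd i j 0
          omega
        | succ k =>
          have e := h.rule i j k
          rw [h1, h1, h2, h2, h3, ← h'.rule] at e
          omega
      · rw [hN _ _ _ (by omega), hN' _ _ _ (by omega)]
  funext i j k
  exact key _ i j le_rfl k

/-- A growth array is determined by its boundary. -/
lemma diagonalGrowth_eq (h : IsGrowth L) {ω : ℕ → ℕ → ℕ} (h₁ : ∀ j k, ω k (j + k) = L 0 j k)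
    (h₂ : ∀ i k, ω (i + k) k = L i 0 k) : diagonalGrowth ω = L := by
  funext i
  induction i with
  | zero =>
    funext j k
    simp only [diagonalGrowth, h₁]
  | succ i ih =>
    funext j
    induction j with
    | zero =>
      funext k
      simp only [diagonalGrowth, h₂]
    | succ j ih' =>
      funext k
      simp only [diagonalGrowth, ih, ih']
      have := h.rule i j k
      omega

lemma sum_recurrence (h : IsGrowth L) {N : ℕ} (hN : ∀ i j, L i j N = 0) (i j : ℕ) :
    ∑ k ∈ Finset.range N, L i j k + ∑ k ∈ Finset.range N, L (i + 1) (j + 1) k =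
      ∑ k ∈ Finset.range N, L (i + 1) j k + ∑ k ∈ Finset.range N, L i (j + 1) k +
        (L i j 0 - max (L i (j + 1) 0) (L (i + 1) j 0)) := by
  have shift : ∀ f : ℕ → ℕ, f N = 0 →
      ∑ k ∈ Finset.range N, f k = ∑ k ∈ Finset.range N, f (k + 1) + f 0 := by
    intro f hf
    rw [← Finset.sum_range_succ', Finset.sum_range_succ, hf, add_zero]
  have e := Finset.sum_congr rfl fun k (_ : k ∈ Finset.range N) ↦ h.rule i j k
  rw [Finset.sum_add_distrib, Finset.sum_add_distrib] at e
  have e1 := shift _ (hN i j)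
  have e2 := shift (fun k ↦ max (L i (j + 1) k) (L (i + 1) j k)) (by simp [hN])
  have e3 : ∑ k ∈ Finset.range N, min (L i (j + 1) k) (L (i + 1) j k) +
      ∑ k ∈ Finset.range N, max (L i (j + 1) k) (L (i + 1) j k) =
      ∑ k ∈ Finset.range N, L i (j + 1) k + ∑ k ∈ Finset.range N, L (i + 1) j k := by
    simp only [← Finset.sum_add_distrib, min_add_max]
  have := h.succ_le_fst i j 0; have := h.succ_le_snd i j 0
  omega

end IsGrowth

lemma sum_range_mul_sub_succ (u : ℕ → ℤ) (c : ℤ) (n : ℕ) :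
    ∑ j ∈ Finset.range n, (c + j) * (u j - u (j + 1)) =
      c * u 0 + ∑ j ∈ Finset.range n, u (j + 1) - (c + n) * u n := by
  induction n with
  | zero => simp
  | succ n ih =>
    rw [Finset.sum_range_succ, ih, Finset.sum_range_succ]
    push_cast
    ring

lemma sum_sum_mul_mixed_difference (S : ℕ → ℕ → ℤ) {N : ℕ}
    (hS : ∀ i j, N ≤ i ∨ N ≤ j → S i j = 0) :
    ∑ i ∈ Finset.range N, ∑ j ∈ Finset.range N,
        ((i : ℤ) + 1 + j) * (S i j + S (i + 1) (j + 1) - S (i + 1) j - S i (j + 1)) =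
      ∑ j ∈ Finset.range N, S 0 j + ∑ i ∈ Finset.range N, S (i + 1) 0 := by
  have h1 : ∀ i ∈ Finset.range N, ∑ j ∈ Finset.range N,
      ((i : ℤ) + 1 + j) * (S i j + S (i + 1) (j + 1) - S (i + 1) j - S i (j + 1)) =
      (1 + i) * (S i 0 - S (i + 1) 0) +
        ∑ j ∈ Finset.range N, (S i (j + 1) - S (i + 1) (j + 1)) := by
    intro i _
    have := sum_range_mul_sub_succ (fun j ↦ S i j - S (i + 1) j) (i + 1) N
    simp only [hS _ N (Or.inr le_rfl)] at this
    rw [add_comm (1 : ℤ)]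
    simp only [sub_self, mul_zero, sub_zero] at this
    rw [← this]
    exact Finset.sum_congr rfl fun j _ ↦ by ring
  have h2 := sum_range_mul_sub_succ (fun i ↦ S i 0) 1 N
  have h3 : ∑ i ∈ Finset.range N, ∑ j ∈ Finset.range N, (S i (j + 1) - S (i + 1) (j + 1)) =
      ∑ j ∈ Finset.range N, S 0 (j + 1) := by
    rw [Finset.sum_comm]
    refine Finset.sum_congr rfl fun j _ ↦ ?_
    rw [Finset.sum_range_sub' (fun i ↦ S i (j + 1)), hS N _ (Or.inl le_rfl), sub_zero]
  have h4 := Finset.sum_range_succ' (fun j ↦ S 0 j) N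
  rw [Finset.sum_range_succ, hS 0 N (Or.inr le_rfl), add_zero] at h4
  rw [Finset.sum_congr rfl h1, Finset.sum_add_distrib, h2, h3, h4, hS N _ (Or.inl le_rfl)]
  ring

lemma sum_sum_eq_sum_diagonals (ω : ℕ → ℕ → ℕ) {N : ℕ} (h : ∀ i j, N ≤ i ∨ N ≤ j → ω i j = 0) :
    ∑ i ∈ Finset.range N, ∑ j ∈ Finset.range N, ω i j =
      ∑ j ∈ Finset.range N, ∑ k ∈ Finset.range N, ω k (j + k) +
        ∑ i ∈ Finset.range N, ∑ k ∈ Finset.range N, ω (i + 1 + k) k := by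
  have shift : ∀ (f : ℕ → ℕ) (m : ℕ), (∀ i, N ≤ i → f i = 0) →
      ∑ i ∈ Finset.range N, f (i + m) = ∑ i ∈ Finset.range N, if m ≤ i then f i else 0 := by
    intro f m hf
    have h1 : ∑ i ∈ Finset.range (N + m), (if m ≤ i then f i else 0) =
        ∑ i ∈ Finset.range N, if m ≤ i then f i else 0 := by
      rw [Finset.sum_range_add]
      simp only [add_eq_left]
      exact Finset.sum_eq_zero fun i _ ↦ by rw [hf _ (by omega), ite_self]
    rw [← h1, add_comm N m, Finset.sum_range_add]
    rw [Finset.sum_eq_zero fun i hi ↦ if_neg (by simpa using hi), zero_add]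
    exact Finset.sum_congr rfl fun i _ ↦ by rw [if_pos (by omega), add_comm]
  have e1 : ∑ j ∈ Finset.range N, ∑ k ∈ Finset.range N, ω k (j + k) =
      ∑ k ∈ Finset.range N, ∑ j ∈ Finset.range N, if k ≤ j then ω k j else 0 := by
    rw [Finset.sum_comm]
    exact Finset.sum_congr rfl fun k _ ↦ shift _ _ fun i hi ↦ h _ _ (Or.inr hi)
  have e2 : ∑ i ∈ Finset.range N, ∑ k ∈ Finset.range N, ω (i + 1 + k) k =
      ∑ i ∈ Finset.range N, ∑ k ∈ Finset.range N, if k + 1 ≤ i then ω i k else 0 := by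
    rw [Finset.sum_comm]
    refine Eq.trans ?_ Finset.sum_comm
    refine Finset.sum_congr rfl fun k _ ↦ ?_
    rw [← shift (fun i ↦ ω i k) (k + 1) fun i hi ↦ h _ _ (Or.inl hi)]
    exact Finset.sum_congr rfl fun i _ ↦ by rw [add_assoc, add_comm 1 k]
  rw [e1, e2, ← Finset.sum_add_distrib]
  refine Finset.sum_congr rfl fun i _ ↦ ?_
  rw [← Finset.sum_add_distrib]
  refine Finset.sum_congr rfl fun j _ ↦ ?_
  split_ifs <;> omega

/-- The matrix of local increments of a growth array. -/
def increment (L : ℕ → ℕ → ℕ → ℕ) (i j : ℕ) : ℕ :=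
  L i j 0 - max (L i (j + 1) 0) (L (i + 1) j 0)

lemma IsGrowth.eq_zero {L : ℕ → ℕ → ℕ → ℕ} (h : IsGrowth L) {N : ℕ}
    (hN : ∀ i j k, N ≤ i ∨ N ≤ j → L i j k = 0) {i j k : ℕ} (hk : N ≤ i + k ∨ N ≤ j + k) :
    L i j k = 0 := by
  rcases hk with hk | hk
  · exact Nat.le_zero.1 ((h.le_add_fst i j k).trans (hN _ _ _ (Or.inl hk)).le)
  · exact Nat.le_zero.1 ((h.le_add_snd i j k).trans (hN _ _ _ (Or.inr hk)).le)

lemma IsGrowth.sum_weight {L : ℕ → ℕ → ℕ → ℕ} (h : IsGrowth L) {N : ℕ}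
    (hN : ∀ i j k, N ≤ i ∨ N ≤ j → L i j k = 0) :
    ∑ i ∈ Finset.range N, ∑ j ∈ Finset.range N, (i + j + 1) * increment L i j =
      ∑ j ∈ Finset.range N, ∑ k ∈ Finset.range N, L 0 j k +
        ∑ i ∈ Finset.range N, ∑ k ∈ Finset.range N, L (i + 1) 0 k := by
  have := sum_sum_mul_mixed_difference (fun i j ↦ ((∑ k ∈ Finset.range N, L i j k : ℕ) : ℤ))
    (N := N) fun i j hij ↦ by simp [hN i j _ hij]
  zify
  push_cast at this
  rw [← this]
  refine Finset.sum_congr rfl fun i _ ↦ Finset.sum_congr rfl fun j _ ↦ ?_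
  have e := h.sum_recurrence (N := N) (fun i j ↦ h.eq_zero hN (by omega)) i j
  rw [← increment] at e
  zify at e
  linear_combination (-(i : ℤ) - j - 1) * e

section Diagonal

variable {ω : ℕ → ℕ → ℕ}

lemma diagonalGrowth_zero_snd (i k : ℕ) : diagonalGrowth ω i 0 k = ω (i + k) k := by
  cases i <;> simp [diagonalGrowth]

lemma diagonalGrowth_eq_zero (h₁ : ∀ i j, ω (i + 1) j ≤ ω i j)
    (h₂ : ∀ i j, ω i (j + 1) ≤ ω i j) {N : ℕ} (hN : ∀ i j, N ≤ i ∨ N ≤ j → ω i j = 0)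
    (i j k : ℕ) (hij : N ≤ i ∨ N ≤ j) : diagonalGrowth ω i j k = 0 := by
  have h := isGrowth_diagonalGrowth h₁ h₂
  rcases hij with hi | hj
  · refine Nat.le_zero.1 ((h.le_zero_snd i j k).trans ?_)
    rw [diagonalGrowth_zero_snd, hN _ _ (by omega)]
  · refine Nat.le_zero.1 ((h.le_zero_fst i j k).trans ?_)
    rw [diagonalGrowth, hN _ _ (by omega)]

lemma increment_eq_zero {L : ℕ → ℕ → ℕ → ℕ} {N : ℕ}
    (hN : ∀ i j k, N ≤ i ∨ N ≤ j → L i j k = 0) (i j : ℕ) (hij : N ≤ i ∨ N ≤ j) :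
    increment L i j = 0 := by
  rw [increment, hN i j 0 hij, Nat.zero_sub]

lemma sum_increment_diagonalGrowth (h₁ : ∀ i j, ω (i + 1) j ≤ ω i j)
    (h₂ : ∀ i j, ω i (j + 1) ≤ ω i j) {N : ℕ} (hN : ∀ i j, N ≤ i ∨ N ≤ j → ω i j = 0) :
    ∑ i ∈ Finset.range N, ∑ j ∈ Finset.range N, (i + j + 1) * increment (diagonalGrowth ω) i j =
      ∑ i ∈ Finset.range N, ∑ j ∈ Finset.range N, ω i j := by
  rw [(isGrowth_diagonalGrowth h₁ h₂).sum_weight (diagonalGrowth_eq_zero h₁ h₂ hN),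
    sum_sum_eq_sum_diagonals ω hN]
  simp only [diagonalGrowth]

lemma eq_of_increment_diagonalGrowth_eq {ω' : ℕ → ℕ → ℕ} (h₁ : ∀ i j, ω (i + 1) j ≤ ω i j)
    (h₂ : ∀ i j, ω i (j + 1) ≤ ω i j) (h₁' : ∀ i j, ω' (i + 1) j ≤ ω' i j)
    (h₂' : ∀ i j, ω' i (j + 1) ≤ ω' i j) {N : ℕ} (hN : ∀ i j, N ≤ i ∨ N ≤ j → ω i j = 0)
    (hN' : ∀ i j, N ≤ i ∨ N ≤ j → ω' i j = 0)
    (h : ∀ i j, increment (diagonalGrowth ω) i j = increment (diagonalGrowth ω') i j) :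
    ω = ω' := by
  have e := (isGrowth_diagonalGrowth h₁ h₂).ext_of_increment (isGrowth_diagonalGrowth h₁' h₂')
    (diagonalGrowth_eq_zero h₁ h₂ hN) (diagonalGrowth_eq_zero h₁' h₂' hN') h
  funext r s
  rcases le_total r s with hrs | hrs
  · have := congrFun (congrFun (congrFun e 0) (s - r)) r
    simpa [diagonalGrowth, hrs] using this
  · have := congrFun (congrFun (congrFun e (r - s)) 0) s
    simpa [diagonalGrowth_zero_snd, hrs] using this

end Diagonal

lemma exists_increment_diagonalGrowth_eq {a : ℕ → ℕ → ℕ} {N : ℕ}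
    (ha : ∀ i j, N ≤ i ∨ N ≤ j → a i j = 0) :
    ∃ ω : ℕ → ℕ → ℕ, (∀ i j, ω (i + 1) j ≤ ω i j) ∧ (∀ i j, ω i (j + 1) ≤ ω i j) ∧
      (∀ i j, N ≤ i ∨ N ≤ j → ω i j = 0) ∧ increment (diagonalGrowth ω) = a := by
  have hL := isGrowth_matrixGrowth ha
  have h0 : ∀ i j k, N ≤ i ∨ N ≤ j → matrixGrowth N a i j k = 0 :=
    fun i j k h ↦ matrixGrowth_eq_zero k h
  let ω : ℕ → ℕ → ℕ := fun r s ↦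
    if r ≤ s then matrixGrowth N a 0 (s - r) r else matrixGrowth N a (r - s) 0 s
  have e1 : ∀ j k, ω k (j + k) = matrixGrowth N a 0 j k := by
    intro j k
    simp [ω]
  have e2 : ∀ i k, ω (i + k) k = matrixGrowth N a i 0 k := by
    intro i k
    rcases Nat.eq_zero_or_pos i with rfl | hi
    · simp [ω]
    · simp only [ω]
      rw [if_neg (by omega), Nat.add_sub_cancel]
  refine ⟨ω, fun r s ↦ ?_, fun r s ↦ ?_, fun r s h ↦ ?_, ?_⟩
  · rcases lt_or_ge r s with h | h
    · obtain ⟨d, rfl⟩ := Nat.exists_eq_add_of_lt h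
      have h1 := e1 d (r + 1)
      have h2 := e1 (d + 1) r
      rw [show d + (r + 1) = r + d + 1 by ring] at h1
      rw [show d + 1 + r = r + d + 1 by ring] at h2
      rw [h1, h2]
      exact hL.le_succ_snd _ _ _
    · obtain ⟨d, rfl⟩ := Nat.exists_eq_add_of_le h
      have h1 := e2 d s
      have h2 := e2 (d + 1) s
      rw [add_comm d s] at h1
      rw [show d + 1 + s = s + d + 1 by ring] at h2
      rw [h1, h2]
      exact hL.succ_le_fst _ _ _
  · rcases lt_or_ge s r with h | h
    · obtain ⟨d, rfl⟩ := Nat.exists_eq_add_of_lt h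
      have h1 := e2 d (s + 1)
      have h2 := e2 (d + 1) s
      rw [show d + (s + 1) = s + d + 1 by ring] at h1
      rw [show d + 1 + s = s + d + 1 by ring] at h2
      rw [h1, h2]
      exact hL.le_succ_fst _ _ _
    · obtain ⟨d, rfl⟩ := Nat.exists_eq_add_of_le h
      have h1 := e1 d r
      have h2 := e1 (d + 1) r
      rw [add_comm d r] at h1
      rw [show d + 1 + r = r + d + 1 by ring] at h2
      rw [h1, h2]
      exact hL.succ_le_snd _ _ _
  · simp only [ω]
    split_ifs
    · exact hL.eq_zero h0 (by omega)
    · exact hL.eq_zero h0 (by omega)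
  · rw [hL.diagonalGrowth_eq e1 e2]
    funext i j
    rw [increment, matrixGrowth_zero ha i j, Nat.add_sub_cancel]

lemma finite_support_of_summable_nat {ι : Type*} {f : ι → ℕ} (hf : Summable f) :
    f.support.Finite := by
  have h := hf.map (Nat.castAddMonoidHom ℤ) continuous_of_discreteTopology
  refine (Summable.hasFiniteSupport_of_discreteTopology _ h).subset fun i hi ↦ ?_
  simpa using hi

lemma exists_box_of_finite {f : ℕ → ℕ → ℕ}
    (hf : (Function.support fun p : ℕ × ℕ ↦ f p.1 p.2).Finite) :
    ∃ N, ∀ i j, N ≤ i ∨ N ≤ j → f i j = 0 := by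
  obtain ⟨b, hb⟩ := hf.bddAbove
  refine ⟨b.1 + b.2 + 1, fun i j hij ↦ ?_⟩
  by_contra h
  have : (i, j) ≤ b := hb h
  have h1 := this.1; have h2 := this.2
  simp only at h1 h2
  omega

lemma finite_support_of_box {f : ℕ → ℕ → ℕ} {N : ℕ} (hf : ∀ i j, N ≤ i ∨ N ≤ j → f i j = 0) :
    (Function.support fun p : ℕ × ℕ ↦ f p.1 p.2).Finite := by
  refine (Finset.range N ×ˢ Finset.range N).finite_toSet.subset fun p hp ↦ ?_
  by_contra h
  refine hp (hf p.1 p.2 ?_)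
  simp only [Finset.coe_product, Set.mem_prod, Finset.coe_range, Set.mem_Iio] at h
  omega

lemma tsum_eq_sum_box {f : ℕ → ℕ → ℕ} {N : ℕ} (hf : ∀ i j, N ≤ i ∨ N ≤ j → f i j = 0) :
    ∑' p : ℕ × ℕ, f p.1 p.2 = ∑ i ∈ Finset.range N, ∑ j ∈ Finset.range N, f i j := by
  rw [← Finset.sum_product', tsum_eq_sum]
  intro p hp
  refine hf p.1 p.2 ?_
  simp only [Finset.mem_product, Finset.mem_range] at hp
  omega

/-- The hook weight of a finitely supported matrix of natural numbers. -/
def hookWeight (a : ℕ × ℕ →₀ ℕ) : ℕ :=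
  a.sum fun p m ↦ (p.1 + p.2 + 1) * m

lemma hookWeight_eq_sum_box {a : ℕ × ℕ →₀ ℕ} {N : ℕ} (ha : ∀ i j, N ≤ i ∨ N ≤ j → a (i, j) = 0) :
    hookWeight a = ∑ i ∈ Finset.range N, ∑ j ∈ Finset.range N, (i + j + 1) * a (i, j) := by
  rw [hookWeight, Finsupp.sum_of_support_subset (s := Finset.range N ×ˢ Finset.range N),
    Finset.sum_product]
  · intro p hp
    by_contra h
    refine Finsupp.mem_support_iff.1 hp (ha p.1 p.2 ?_)
    simp only [Finset.mem_product, Finset.mem_range] at h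
    omega
  · simp

lemma planePartitionCount_eq_card_hookWeight {n : ℕ} (hn : n ≠ 0) :
    planePartitionCount n = Nat.card {a : ℕ × ℕ →₀ ℕ // hookWeight a = n} := by
  have box : ∀ ω : ℕ → ℕ → ℕ, ∑' p : ℕ × ℕ, ω p.1 p.2 = n →
      ∃ N, ∀ i j, N ≤ i ∨ N ≤ j → ω i j = 0 := by
    intro ω hω
    refine exists_box_of_finite (finite_support_of_summable_nat ?_)
    by_contra h
    exact hn (hω ▸ tsum_eq_zero_of_not_summable h)
  let X := {ω : ℕ → ℕ → ℕ // (∀ i j, ω (i + 1) j ≤ ω i j) ∧ (∀ i j, ω i (j + 1) ≤ ω i j) ∧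
    (∑' p : ℕ × ℕ, ω p.1 p.2) = n}
  have hfin : ∀ ω : X, (Function.support fun p : ℕ × ℕ ↦
      increment (diagonalGrowth ω.1) p.1 p.2).Finite := by
    rintro ⟨ω, h₁, h₂, h⟩
    obtain ⟨N, hN⟩ := box ω h
    exact finite_support_of_box (increment_eq_zero (diagonalGrowth_eq_zero h₁ h₂ hN))
  have hw : ∀ ω : X, hookWeight (Finsupp.ofSupportFinite _ (hfin ω)) = n := by
    rintro ⟨ω, h₁, h₂, h⟩
    obtain ⟨N, hN⟩ := box ω h
    rw [hookWeight_eq_sum_box (N := N)]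
    · simp only [Finsupp.ofSupportFinite_coe]
      rw [sum_increment_diagonalGrowth h₁ h₂ hN, ← tsum_eq_sum_box hN, h]
    · exact increment_eq_zero (diagonalGrowth_eq_zero h₁ h₂ hN)
  refine Nat.card_congr (Equiv.ofBijective
    (fun ω : X ↦ (⟨Finsupp.ofSupportFinite _ (hfin ω), hw ω⟩ :
      {a : ℕ × ℕ →₀ ℕ // hookWeight a = n})) ⟨?_, ?_⟩)
  · rintro ⟨ω, h₁, h₂, h⟩ ⟨ω', h₁', h₂', h'⟩ e
    obtain ⟨N, hN⟩ := box ω h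
    obtain ⟨N', hN'⟩ := box ω' h'
    refine Subtype.ext (eq_of_increment_diagonalGrowth_eq (N := max N N') h₁ h₂ h₁' h₂'
      (fun i j hij ↦ hN i j (by omega)) (fun i j hij ↦ hN' i j (by omega)) fun i j ↦ ?_)
    exact DFunLike.congr_fun (congrArg Subtype.val e) (i, j)
  · rintro ⟨a, rfl⟩
    obtain ⟨N, hN⟩ := exists_box_of_finite (f := fun i j ↦ a (i, j)) a.hasFiniteSupport
    obtain ⟨ω, h₁, h₂, hω, hinc⟩ := exists_increment_diagonalGrowth_eq hN
    refine ⟨⟨ω, h₁, h₂, ?_⟩, Subtype.ext (Finsupp.ext fun p ↦ ?_)⟩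
    · rw [tsum_eq_sum_box hω, ← sum_increment_diagonalGrowth h₁ h₂ hω, hinc,
        hookWeight_eq_sum_box hN]
    · exact congrFun (congrFun hinc p.1) p.2

section EulerProduct

variable {ι : Type*}

lemma sum_finsupp_prod_pow {R : Type*} [CommSemiring R] (y : ι → R) (s : Finset ι) (K : ℕ) :
    ∑ a ∈ s.finsupp fun _ ↦ Finset.range K, a.prod (fun i m ↦ y i ^ m) =
      ∏ i ∈ s, ∑ k ∈ Finset.range K, y i ^ k := by
  classical
  rw [Finset.prod_sum, Finset.finsupp, Finset.sum_map]
  refine Finset.sum_congr (by congr!) fun p _ ↦ ?_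
  rw [Function.Embedding.coeFn_mk, Finsupp.prod_of_support_subset _
    (Finsupp.support_indicator_subset s p) _ (by simp), ← Finset.prod_attach]
  exact Finset.prod_congr rfl fun i _ ↦ by simp

open scoped Classical in
lemma tendsto_finsupp_range_atTop :
    Filter.Tendsto (fun q : Finset ι × ℕ ↦ q.1.finsupp fun _ ↦ Finset.range (q.2 + 1))
      Filter.atTop Filter.atTop := by
  refine Filter.tendsto_atTop_finset_of_monotone (fun q q' h a ha ↦ ?_) fun a ↦ ?_
  · rw [Finset.mem_finsupp_iff] at ha ⊢
    refine ⟨ha.1.trans h.1, fun i _ ↦ ?_⟩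
    by_cases hi : i ∈ q.1
    · exact Finset.range_mono (by gcongr; exact h.2) (ha.2 i hi)
    · rw [Finsupp.notMem_support_iff.1 fun hi' ↦ hi (ha.1 hi')]
      simp
  · refine ⟨(a.support, a.support.sup a), ?_⟩
    rw [Finset.mem_finsupp_iff]
    exact ⟨subset_rfl, fun i hi ↦ Finset.mem_range.2 (Nat.lt_succ_of_le (Finset.le_sup hi))⟩

/-- The product of geometric series, expanded over finitely supported exponents. -/
lemma hasProd_inv_one_sub_eq_tsum_finsupp {y : ι → ℂ} {ρ : ℝ} (hρ : ρ < 1) (hy : ∀ i, ‖y i‖ ≤ ρ)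
    (hs : Summable fun i ↦ ‖y i‖) :
    Summable (fun a : ι →₀ ℕ ↦ a.prod fun i m ↦ y i ^ m) ∧
      HasProd (fun i ↦ (1 - y i)⁻¹) (∑' a : ι →₀ ℕ, a.prod fun i m ↦ y i ^ m) := by
  classical
  have hlt : ∀ i, ‖y i‖ < 1 := fun i ↦ (hy i).trans_lt hρ
  have hsum : Summable (fun a : ι →₀ ℕ ↦ a.prod fun i m ↦ y i ^ m) := by
    refine Summable.of_norm ?_
    have hnorm : ∀ a : ι →₀ ℕ, ‖a.prod fun i m ↦ y i ^ m‖ = a.prod fun i m ↦ ‖y i‖ ^ m :=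
      fun a ↦ by simp [Finsupp.prod]
    refine summable_of_sum_le (c := Real.exp (∑' i, ‖y i‖ / (1 - ρ))) (fun a ↦ norm_nonneg _) ?_
    intro u
    obtain ⟨q, hq⟩ := (tendsto_finsupp_range_atTop.eventually (Filter.eventually_ge_atTop u)).exists
    refine (Finset.sum_le_sum_of_subset_of_nonneg hq fun _ _ _ ↦ norm_nonneg _).trans ?_
    simp only [hnorm]
    rw [sum_finsupp_prod_pow (fun i ↦ ‖y i‖)]
    calc ∏ i ∈ q.1, ∑ k ∈ Finset.range (q.2 + 1), ‖y i‖ ^ k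
        ≤ ∏ i ∈ q.1, Real.exp (‖y i‖ / (1 - ρ)) := by
          refine Finset.prod_le_prod (fun i _ ↦ by positivity) fun i _ ↦ ?_
          have h1 := (summable_geometric_of_lt_one (norm_nonneg _) (hlt i)).sum_le_tsum
            (Finset.range (q.2 + 1)) fun _ _ ↦ by positivity
          rw [tsum_geometric_of_lt_one (norm_nonneg _) (hlt i)] at h1
          refine h1.trans (le_trans ?_ (Real.add_one_le_exp _))
          have h2 : 0 < 1 - ‖y i‖ := sub_pos.2 (hlt i)
          have h3 : ‖y i‖ / (1 - ‖y i‖) ≤ ‖y i‖ / (1 - ρ) :=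
            div_le_div_of_nonneg_left (norm_nonneg _) (by linarith) (by linarith [hy i])
          refine le_trans (le_of_eq ?_) (add_le_add_left h3 1)
          field_simp
          ring
      _ = Real.exp (∑ i ∈ q.1, ‖y i‖ / (1 - ρ)) := (Real.exp_sum _ _).symm
      _ ≤ _ := Real.exp_le_exp.2 ((hs.div_const _).sum_le_tsum _ fun i _ ↦
          div_nonneg (norm_nonneg _) (by linarith))
  refine ⟨hsum, ?_⟩
  have hT := hsum.hasSum
  simp only [HasSum, SummationFilter.unconditional_filter] at hT
  have hq := hT.comp tendsto_finsupp_range_atTop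
  simp only [Function.comp_def, sum_finsupp_prod_pow] at hq
  simp only [HasProd, SummationFilter.unconditional_filter]
  rw [Metric.tendsto_atTop] at hq ⊢
  intro ε hε
  obtain ⟨⟨s₀, K₀⟩, h₀⟩ := hq (ε / 2) (by positivity)
  refine ⟨s₀, fun s hs₀ ↦ lt_of_le_of_lt ?_ (half_lt_self hε)⟩
  have hlim : Filter.Tendsto (fun K ↦ ∏ i ∈ s, ∑ k ∈ Finset.range (K + 1), y i ^ k) Filter.atTop
      (nhds (∏ i ∈ s, (1 - y i)⁻¹)) :=
    tendsto_finsetProd _ fun i _ ↦ (hasSum_geometric_of_norm_lt_one (hlt i)).tendsto_sum_nat.comp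
      (Filter.tendsto_add_atTop_nat 1)
  refine le_of_tendsto (hlim.dist tendsto_const_nhds) ?_
  filter_upwards [Filter.eventually_ge_atTop K₀] with K hK
  exact (h₀ (s, K) ⟨hs₀, hK⟩).le

end EulerProduct

lemma hookWeight_eq_zero_iff {a : ℕ × ℕ →₀ ℕ} : hookWeight a = 0 ↔ a = 0 := by
  refine ⟨fun h ↦ Finsupp.ext fun p ↦ ?_, fun h ↦ by simp [h, hookWeight]⟩
  by_contra hp
  have := Finset.sum_eq_zero_iff.1 h p (Finsupp.mem_support_iff.2 hp)
  simp_all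

lemma card_hookWeight_eq_zero : Nat.card {a : ℕ × ℕ →₀ ℕ // hookWeight a = 0} = 1 := by
  simp [hookWeight_eq_zero_iff]

/-- MacMahon's generating function identity for plane partitions:
`1 + Σ_{n≥1} q(n) x^n = ∏_{j≥1} (1 - x^j)^{-j}` for all complex `x` with `|x| < 1`. -/
theorem plane_partition_generating_function (x : ℂ) (hx : ‖x‖ < 1) :
    1 + ∑' n : ℕ, (planePartitionCount (n + 1) : ℂ) * x ^ (n + 1) =
      ∏' j : ℕ, (1 - x ^ (j + 1)) ^ (-((j : ℤ) + 1)) := by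
  have hle : ∀ p : ℕ × ℕ, ‖x ^ (p.1 + p.2 + 1)‖ ≤ ‖x‖ := fun p ↦ by
    rw [norm_pow]
    exact pow_le_of_le_one (norm_nonneg _) hx.le (Nat.succ_ne_zero _)
  have hs : Summable fun p : ℕ × ℕ ↦ ‖x ^ (p.1 + p.2 + 1)‖ := by
    have hg := summable_geometric_of_lt_one (norm_nonneg x) hx
    refine ((hg.mul_of_nonneg hg (fun _ ↦ by positivity) (fun _ ↦ by positivity)).mul_right
      ‖x‖).congr fun p ↦ ?_
    rw [norm_pow, pow_succ, pow_add]
  obtain ⟨hsum, hprod⟩ := hasProd_inv_one_sub_eq_tsum_finsupp hx hle hs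
  have hF : ∀ a : ℕ × ℕ →₀ ℕ, (a.prod fun p m ↦ (x ^ (p.1 + p.2 + 1)) ^ m) =
      x ^ hookWeight a := fun a ↦ by
    simp only [Finsupp.prod, hookWeight, Finsupp.sum, ← pow_mul, Finset.prod_pow_eq_pow_sum]
  simp only [hF] at hsum hprod
  have hR : HasProd (fun j : ℕ ↦ (1 - x ^ (j + 1)) ^ (-((j : ℤ) + 1)))
      (∑' a : ℕ × ℕ →₀ ℕ, x ^ hookWeight a) := by
    refine ((Finset.HasAntidiagonal.sigmaAntidiagonalEquivProd.hasProd_iff).2 hprod).sigma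
      fun j ↦ ?_
    have e : ∏ p : Finset.HasAntidiagonal.antidiagonal j, (1 - x ^ (p.1.1 + p.1.2 + 1))⁻¹ =
        (1 - x ^ (j + 1)) ^ (-((j : ℤ) + 1)) := by
      rw [Finset.prod_congr rfl fun p _ ↦ by
        rw [Finset.HasAntidiagonal.mem_antidiagonal.1 p.2], Finset.prod_const, Finset.card_univ,
        Fintype.card_coe, Finset.Nat.card_antidiagonal, zpow_neg, inv_pow]
      norm_cast
    rw [← e]
    exact hasProd_fintype _
  have hL : HasSum (fun n : ℕ ↦
      (Nat.card {a : ℕ × ℕ →₀ ℕ // hookWeight a = n} : ℂ) * x ^ n)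
      (∑' a : ℕ × ℕ →₀ ℕ, x ^ hookWeight a) := by
    have h := ((Equiv.sigmaFiberEquiv hookWeight).hasSum_iff).2 hsum.hasSum
    refine h.sigma fun n ↦ ?_
    have h' := (h.summable.sigma_factor n).hasSum
    have e : (fun c : {a // hookWeight a = n} ↦ ((fun a ↦ x ^ hookWeight a) ∘
        (Equiv.sigmaFiberEquiv hookWeight)) ⟨n, c⟩) = fun _ ↦ x ^ n := by
      funext c
      simp [Equiv.sigmaFiberEquiv, c.2]
    rw [e, tsum_const, nsmul_eq_mul] at h'
    rwa [e]
  rw [hR.tprod_eq, ← hL.tsum_eq, hL.summable.tsum_eq_zero_add, card_hookWeight_eq_zero]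
  simp [planePartitionCount_eq_card_hookWeight]
end
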